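/- The set {p q⁻¹ : p, q Hurwitz primes with integer coordinates} is dense in the quaternions. -/

import Mathlib

noncomputable def qNorm (a : Quaternion ℝ) : ℝ :=
  a.re ^ 2 + a.imI ^ 2 + a.imJ ^ 2 + a.imK ^ 2

def IsHurwitz (a : Quaternion ℝ) : Prop :=
  (∃ x₁ x₂ x₃ x₄ : ℤ, a = ⟨(x₁ : ℝ), x₂, x₃, x₄⟩) ∨
  (∃ x₁ x₂ x₃ x₄ : ℤ, a = ⟨(x₁ : ℝ) + 1/2, (x₂ : ℝ) + 1/2, (x₃ : ℝ) + 1/2, (x₄ : ℝ) + 1/2⟩)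

def IsHurwitzPrime (p : Quaternion ℝ) : Prop :=
  IsHurwitz p ∧ ∃ r : ℕ, r.Prime ∧ qNorm p = r

namespace GaussianInt

open Complex

/-- The norm of a Gaussian integer as a real number. -/
noncomputable def nm (z : GaussianInt) : ℝ := (z.norm : ℝ)

lemma nm_eq_norm_sq (z : GaussianInt) : nm z = ‖(z : ℂ)‖ ^ 2 := by
  rw [nm, intCast_real_norm, Complex.normSq_eq_norm_sq]

lemma nm_nonneg (z : GaussianInt) : 0 ≤ nm z := by
  rw [nm_eq_norm_sq]; positivity

lemma nm_zero : nm 0 = 0 := by simp [nm]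

lemma nm_mul (z w : GaussianInt) : nm (z * w) = nm z * nm w := by
  simp [nm, Zsqrtd.norm_mul]

lemma one_le_nm {z : GaussianInt} (hz : z ≠ 0) : 1 ≤ nm z := by
  have : 0 < z.norm := norm_pos.mpr hz
  unfold nm
  exact_mod_cast this

lemma nm_pos {z : GaussianInt} (hz : z ≠ 0) : 0 < nm z := one_pos.trans_le (one_le_nm hz)

lemma nm_eq (z : GaussianInt) : nm z = (z.re : ℝ) ^ 2 + (z.im : ℝ) ^ 2 := by
  simp [nm, Zsqrtd.norm_def]; ring

lemma nm_natCast (k : ℕ) : nm (k : GaussianInt) = (k : ℝ) ^ 2 := by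
  simp [nm_eq]

/-- Gaussian integers as vectors of length two. -/
def equivFinTwo : GaussianInt ≃ (Fin 2 → ℤ) where
  toFun z := ![z.re, z.im]
  invFun v := ⟨v 0, v 1⟩
  left_inv z := by simp
  right_inv v := by ext i; fin_cases i <;> simp

lemma summable_nm_rpow {σ : ℝ} (hσ : 1 < σ) : Summable fun z : GaussianInt ↦ nm z ^ (-σ) := by
  have h := (EisensteinSeries.summable_one_div_norm_rpow (k := 2 * σ) (by linarith))
  rw [← equivFinTwo.summable_iff] at h
  refine Summable.of_nonneg_of_le (fun z ↦ Real.rpow_nonneg (nm_nonneg z) _) (fun z ↦ ?_) h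
  by_cases hz : z = 0
  · subst hz
    rw [nm_zero, Real.zero_rpow (by linarith)]
    exact Real.rpow_nonneg (_root_.norm_nonneg _) _
  · have h1 : ‖equivFinTwo z‖ ^ 2 ≤ nm z := by
      have hle : ‖equivFinTwo z‖ ≤ Real.sqrt (nm z) := by
        rw [pi_norm_le_iff_of_nonneg (Real.sqrt_nonneg _)]
        intro i
        apply Real.le_sqrt_of_sq_le
        rw [nm_eq]
        fin_cases i <;> simp [equivFinTwo, Int.norm_eq_abs] <;> positivity
      calc _ ≤ Real.sqrt (nm z) ^ 2 := by gcongr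
        _ = _ := Real.sq_sqrt (nm_nonneg z)
    have h0 : 0 < ‖equivFinTwo z‖ := by
      rw [norm_pos_iff]
      intro h
      apply hz
      have := congrArg equivFinTwo.symm h
      rw [Equiv.symm_apply_apply] at this
      rw [this]; rfl
    calc nm z ^ (-σ) ≤ (‖equivFinTwo z‖ ^ 2) ^ (-σ) :=
          Real.rpow_le_rpow_of_nonpos (by positivity) h1 (by linarith)
      _ = ‖equivFinTwo z‖ ^ (-(2 * σ)) := by
          rw [← Real.rpow_natCast, ← Real.rpow_mul h0.le]; congr 1; push_cast; ring

lemma finite_nm_lt (M : ℝ) : {z : GaussianInt | nm z < M}.Finite := by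
  have h := (summable_nm_rpow one_lt_two).tendsto_cofinite_zero
  by_cases hM : 0 < M
  · have h2 := h.eventually (gt_mem_nhds (show 0 < M ^ (-2 : ℝ) by positivity))
    rw [Filter.eventually_cofinite] at h2
    refine (h2.union (Set.finite_singleton 0)).subset fun z hz ↦ ?_
    by_cases h0 : z = 0
    · right; exact h0
    · left
      simp only [Set.mem_ofPred_eq, not_lt] at hz ⊢
      exact Real.rpow_le_rpow_of_nonpos (nm_pos h0) hz.le (by norm_num)
  · convert Set.finite_empty
    ext z
    simp only [Set.mem_ofPred_eq, Set.mem_empty_iff_false, iff_false, not_lt]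
    exact (not_lt.mp hM).trans (nm_nonneg z)

/-- The phase `z / |z|` of a Gaussian integer. -/
noncomputable def phase (z : GaussianInt) : ℂ := (z : ℂ) / (‖(z : ℂ)‖ : ℂ)

lemma phase_mul (z w : GaussianInt) : phase (z * w) = phase z * phase w := by
  simp [phase, mul_div_mul_comm]

lemma norm_phase {z : GaussianInt} (hz : z ≠ 0) : ‖phase z‖ = 1 := by
  have : ‖(z : ℂ)‖ ≠ 0 := by simpa using hz
  simp [phase, this]

lemma phase_natCast {k : ℕ} (hk : k ≠ 0) : phase (k : GaussianInt) = 1 := by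
  have : (k : ℂ) ≠ 0 := by exact_mod_cast hk
  simp [phase, this]

/-- The multiplicative function `z ↦ (z / |z|) ^ m`. -/
noncomputable def phaseHom (m : ℤ) : GaussianInt →* ℂ where
  toFun z := phase z ^ m
  map_one' := by simp [phase]
  map_mul' z w := by rw [phase_mul, mul_zpow]

lemma norm_phaseHom {z : GaussianInt} (hz : z ≠ 0) (m : ℤ) : ‖phaseHom m z‖ = 1 := by
  simp [phaseHom, norm_phase hz]

lemma norm_phaseHom_le (m : ℤ) (z : GaussianInt) : ‖phaseHom m z‖ ≤ 1 := by
  by_cases hz : z = 0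
  · subst hz
    by_cases hm : m = 0
    · simp [phaseHom, hm]
    · simp [phaseHom, phase, zero_zpow m hm]
  · exact (norm_phaseHom hz m).le

lemma phaseHom_zero_apply (z : GaussianInt) : phaseHom 0 z = 1 := by simp [phaseHom]

lemma phaseHom_natCast (m : ℤ) {k : ℕ} (hk : k ≠ 0) : phaseHom m (k : GaussianInt) = 1 := by
  simp [phaseHom, phase_natCast hk]

/-- The term of the Dirichlet series attached to a function on Gaussian integers. -/
noncomputable def term (ψ : GaussianInt → ℂ) (s : ℂ) (z : GaussianInt) : ℂ :=
  ψ z * (nm z : ℂ) ^ (-s)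

/-- The Dirichlet series attached to a function on Gaussian integers. -/
noncomputable def series (ψ : GaussianInt → ℂ) (s : ℂ) : ℂ := ∑' z, term ψ s z

lemma term_mul (ψ : GaussianInt →* ℂ) (s : ℂ) (z w : GaussianInt) :
    term ψ s (z * w) = term ψ s z * term ψ s w := by
  simp only [term, map_mul, nm_mul, ofReal_mul]
  rw [Complex.mul_cpow_ofReal_nonneg (nm_nonneg z) (nm_nonneg w)]
  ring

lemma norm_nm_cpow {s : ℂ} (hs : 0 < s.re) (z : GaussianInt) :
    ‖(nm z : ℂ) ^ (-s)‖ = nm z ^ (-s.re) := by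
  by_cases hz : z = 0
  · subst hz
    have : s ≠ 0 := by rintro rfl; simp at hs
    simp [nm_zero, this, Real.zero_rpow, hs.ne']
  · rw [Complex.norm_cpow_eq_rpow_re_of_pos (nm_pos hz)]; simp

lemma norm_term_le {ψ : GaussianInt → ℂ} (hψ : ∀ z, ‖ψ z‖ ≤ 1) {s : ℂ} (hs : 0 < s.re)
    (z : GaussianInt) : ‖term ψ s z‖ ≤ nm z ^ (-s.re) := by
  rw [term, norm_mul, norm_nm_cpow hs]
  exact mul_le_of_le_one_left (Real.rpow_nonneg (nm_nonneg z) _) (hψ z)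

lemma nm_rpow_le_one {σ : ℝ} (hσ : 0 < σ) (z : GaussianInt) : nm z ^ (-σ) ≤ 1 := by
  by_cases hz : z = 0
  · subst hz; simp [nm_zero, Real.zero_rpow, hσ.ne']
  · exact Real.rpow_le_one_of_one_le_of_nonpos (one_le_nm hz) (by linarith)

lemma summable_term {ψ : GaussianInt → ℂ} (hψ : ∀ z, ‖ψ z‖ ≤ 1) {s : ℂ} (hs : 1 < s.re) :
    Summable (term ψ s) :=
  Summable.of_norm_bounded (summable_nm_rpow hs) fun z ↦ norm_term_le hψ (by linarith) z

lemma norm_zpow_sub_zpow_le {x y : ℂ} (hx : ‖x‖ = 1) (hy : ‖y‖ = 1) (m : ℤ) :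
    ‖x ^ m - y ^ m‖ ≤ |(m : ℝ)| * ‖x - y‖ := by
  have hnat (n : ℕ) : ‖x ^ n - y ^ n‖ ≤ n * ‖x - y‖ := by
    induction n with
    | zero => simp
    | succ n ih =>
      calc ‖x ^ (n + 1) - y ^ (n + 1)‖ = ‖x ^ n * (x - y) + (x ^ n - y ^ n) * y‖ := by
            congr 1; ring
        _ ≤ ‖x ^ n * (x - y)‖ + ‖(x ^ n - y ^ n) * y‖ := norm_add_le _ _
        _ = ‖x - y‖ + ‖x ^ n - y ^ n‖ := by simp [hx, hy]
        _ ≤ _ := by push_cast; linarith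
  have hx0 : x ≠ 0 := by rintro rfl; simp at hx
  have hy0 : y ≠ 0 := by rintro rfl; simp at hy
  obtain ⟨n, rfl | rfl⟩ := m.eq_nat_or_neg
  · simpa using hnat n
  · have : x ^ (-(n : ℤ)) - y ^ (-(n : ℤ)) = (y ^ n - x ^ n) / (x ^ n * y ^ n) := by
      simp only [zpow_neg, zpow_natCast]; field_simp
    rw [this, norm_div, norm_sub_rev]
    simpa [hx, hy] using hnat n

lemma norm_phase_sub_le {a b : GaussianInt} (ha : a ≠ 0) (hb : b ≠ 0) :
    ‖phase b - phase a‖ ≤ 2 * ‖(b : ℂ) - a‖ / ‖(a : ℂ)‖ := by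
  have ha' : ‖(a : ℂ)‖ ≠ 0 := by simpa using ha
  have hb' : ‖(b : ℂ)‖ ≠ 0 := by simpa using hb
  have ha'' : ((‖(a : ℂ)‖ : ℝ) : ℂ) ≠ 0 := by exact_mod_cast ha'
  have hb'' : ((‖(b : ℂ)‖ : ℝ) : ℂ) ≠ 0 := by exact_mod_cast hb'
  have h : phase b - phase a = ((b : ℂ) - a) / (‖(a : ℂ)‖ : ℂ) +
      phase b * (((‖(a : ℂ)‖ - ‖(b : ℂ)‖ : ℝ) : ℂ) / (‖(a : ℂ)‖ : ℂ)) := by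
    rw [phase, phase]; push_cast; field_simp; ring
  rw [h]
  refine (norm_add_le _ _).trans ?_
  rw [norm_mul, norm_phase hb, norm_div, norm_div, Complex.norm_real, Complex.norm_real, one_mul,
    norm_norm, ← add_div]
  gcongr
  have := abs_norm_sub_norm_le (a : ℂ) b
  rw [norm_sub_rev] at this
  rw [Real.norm_eq_abs]; linarith

lemma norm_cpow_sub_cpow_le {s : ℂ} {σ B c x y : ℝ} (hσ : 0 ≤ σ) (hs : σ ≤ s.re) (hB : ‖s‖ ≤ B)
    (hc : 1 ≤ c) (hx : c ≤ x) (hy : c ≤ y) :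
    ‖(x : ℂ) ^ (-s) - (y : ℂ) ^ (-s)‖ ≤ B * c ^ (-σ - 1) * |x - y| := by
  have hd : ∀ t ∈ Set.Ici c, HasDerivWithinAt (fun t : ℝ ↦ (t : ℂ) ^ (-s))
      (-s * (t : ℂ) ^ (-s - 1)) (Set.Ici c) t := by
    intro t ht
    have ht0 : (0 : ℝ) < t := by linarith [Set.mem_Ici.mp ht]
    have := ((hasDerivAt_id (t : ℂ)).cpow_const (c := -s) (Or.inl (by simpa using ht0))).comp_ofReal
    simpa using this.hasDerivWithinAt
  have hb : ∀ t ∈ Set.Ici c, ‖-s * (t : ℂ) ^ (-s - 1)‖ ≤ B * c ^ (-σ - 1) := by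
    intro t ht
    have ht0 : (0 : ℝ) < t := by linarith [Set.mem_Ici.mp ht]
    have hB0 : 0 ≤ B := (_root_.norm_nonneg s).trans hB
    rw [norm_mul, norm_neg, Complex.norm_cpow_eq_rpow_re_of_pos ht0]
    gcongr
    calc t ^ (-s - 1).re ≤ t ^ (-σ - 1) := by
          apply Real.rpow_le_rpow_of_exponent_le (hc.trans ht)
          simp; linarith
      _ ≤ c ^ (-σ - 1) :=
          Real.rpow_le_rpow_of_nonpos (by linarith) ht (by linarith)
  simpa using (convex_Ici c).norm_image_sub_le_of_norm_hasDerivWithin_le hd hb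
    (Set.mem_Ici.mpr hy) (Set.mem_Ici.mpr hx)

lemma norm_term_add_sub_term_le (m : ℤ) {z r : GaussianInt} {s : ℂ} {σ B : ℝ} (hσ : 0 < σ)
    (hs : σ ≤ s.re) (hB : ‖s‖ ≤ B) (hz : 4 ≤ nm z) (hr : 4 * nm r ≤ nm z) :
    ‖term (phaseHom m) s (z + r) - term (phaseHom m) s z‖ ≤
      (B * 4 ^ (σ + 1) * (5 / 2) + 2 * |(m : ℝ)|) * ‖(r : ℂ)‖ * nm z ^ (-(σ + 1 / 2)) := by
  have hz0 : z ≠ 0 := by rintro rfl; rw [nm_zero] at hz; linarith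
  have hzp : 0 < nm z := nm_pos hz0
  set a : ℝ := ‖(z : ℂ)‖ with ha
  set b : ℝ := ‖((z + r : GaussianInt) : ℂ)‖ with hb
  set ρ : ℝ := ‖(r : ℂ)‖ with hρ
  have hρ0 : 0 ≤ ρ := _root_.norm_nonneg _
  have ha0 : 0 < a := by
    rw [ha, norm_pos_iff]; simpa using hz0
  have hB0 : 0 ≤ B := (_root_.norm_nonneg s).trans hB
  have hna : nm z = a ^ 2 := nm_eq_norm_sq z
  have hnb : nm (z + r) = b ^ 2 := nm_eq_norm_sq _
  have hρa : ρ ≤ a / 2 := by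
    rw [hna, nm_eq_norm_sq] at hr
    nlinarith
  have hab : |b - a| ≤ ρ := by
    have := abs_norm_sub_norm_le ((z + r : GaussianInt) : ℂ) (z : ℂ)
    rwa [show ((z + r : GaussianInt) : ℂ) - z = r by rw [toComplex_add]; ring] at this
  obtain ⟨hab1, hab2⟩ := abs_le.mp hab
  have hzr0 : z + r ≠ 0 := by
    intro h
    rw [h] at hb
    simp at hb
    linarith
  have h1 : ‖phaseHom m (z + r) - phaseHom m z‖ ≤ |(m : ℝ)| * (2 * ρ / a) := by
    refine (norm_zpow_sub_zpow_le (norm_phase hzr0) (norm_phase hz0) m).trans ?_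
    gcongr
    simpa using norm_phase_sub_le hz0 hzr0
  have h2 : ‖(nm (z + r) : ℂ) ^ (-s) - (nm z : ℂ) ^ (-s)‖ ≤
      B * (nm z / 4) ^ (-σ - 1) * |nm (z + r) - nm z| :=
    norm_cpow_sub_cpow_le hσ.le hs hB (by linarith) (by rw [hna, hnb]; nlinarith) (by linarith)
  have h3 : |nm (z + r) - nm z| ≤ 5 / 2 * ρ * a := by
    rw [hna, hnb, show b ^ 2 - a ^ 2 = (b - a) * (b + a) by ring, abs_mul,
      abs_of_pos (by linarith : 0 < b + a)]
    calc |b - a| * (b + a) ≤ ρ * (5 / 2 * a) := by gcongr; linarith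
      _ = _ := by ring
  have hpa : nm z ^ (-σ - 1) * a = nm z ^ (-(σ + 1 / 2)) := by
    have : a = nm z ^ (1 / 2 : ℝ) := by
      rw [hna, ← Real.sqrt_eq_rpow, Real.sqrt_sq ha0.le]
    rw [this, ← Real.rpow_add hzp]; congr 1; ring
  have hpa2 : nm z ^ (-σ) / a = nm z ^ (-(σ + 1 / 2)) := by
    have : a = nm z ^ (1 / 2 : ℝ) := by
      rw [hna, ← Real.sqrt_eq_rpow, Real.sqrt_sq ha0.le]
    rw [this, ← Real.rpow_sub hzp]; congr 1; ring
  have h4 : (nm z / 4) ^ (-σ - 1) = 4 ^ (σ + 1) * nm z ^ (-σ - 1) := by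
    rw [Real.div_rpow hzp.le (by norm_num), show (-σ - 1) = -(σ + 1) by ring,
      Real.rpow_neg (by norm_num : (0 : ℝ) ≤ 4)]
    field_simp
  have h5 : ‖(nm z : ℂ) ^ (-s)‖ ≤ nm z ^ (-σ) := by
    rw [norm_nm_cpow (by linarith)]
    exact Real.rpow_le_rpow_of_exponent_le (by linarith) (by linarith)
  calc ‖term (phaseHom m) s (z + r) - term (phaseHom m) s z‖
      = ‖phaseHom m (z + r) * ((nm (z + r) : ℂ) ^ (-s) - (nm z : ℂ) ^ (-s)) +
          (phaseHom m (z + r) - phaseHom m z) * (nm z : ℂ) ^ (-s)‖ := by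
        simp only [term]; congr 1; ring
    _ ≤ 1 * (B * (4 ^ (σ + 1) * nm z ^ (-σ - 1)) * (5 / 2 * ρ * a)) +
          |(m : ℝ)| * (2 * ρ / a) * nm z ^ (-σ) := by
        refine (norm_add_le _ _).trans ?_
        rw [norm_mul, norm_mul]
        rw [h4] at h2
        gcongr
        · exact norm_phaseHom_le m _
        · exact h2.trans (by gcongr)
    _ = B * 4 ^ (σ + 1) * (5 / 2) * ρ * (nm z ^ (-σ - 1) * a) +
          |(m : ℝ)| * 2 * ρ * (nm z ^ (-σ) / a) := by ring
    _ = _ := by rw [hpa, hpa2]; ring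

lemma exists_summable_norm_term_add_sub_term_le (m : ℤ) (r : GaussianInt) {σ : ℝ} (B : ℝ)
    (hσ : 1 / 2 < σ) : ∃ u : GaussianInt → ℝ, Summable u ∧ ∀ z s, σ ≤ s.re → ‖s‖ ≤ B →
      ‖term (phaseHom m) s (z + r) - term (phaseHom m) s z‖ ≤ u z := by
  classical
  set M : ℝ := 4 + 4 * nm r with hM
  set C : ℝ := (B * 4 ^ (σ + 1) * (5 / 2) + 2 * |(m : ℝ)|) * ‖(r : ℂ)‖ with hC
  refine ⟨fun z ↦ (if nm z < M then 2 else 0) + |C| * nm z ^ (-(σ + 1 / 2)), ?_, ?_⟩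
  · refine Summable.add ?_ ((summable_nm_rpow (by linarith)).mul_left _)
    refine summable_of_ne_finset_zero (s := (finite_nm_lt M).toFinset) fun z hz ↦ ?_
    simpa using hz
  · intro z s hs hB
    have hr0 := nm_nonneg r
    beta_reduce
    split_ifs with h
    · have h1 (y : GaussianInt) : ‖term (phaseHom m) s y‖ ≤ 1 :=
        (norm_term_le (norm_phaseHom_le m) (by linarith) y).trans (nm_rpow_le_one (by linarith) y)
      have h2 : 0 ≤ |C| * nm z ^ (-(σ + 1 / 2)) :=
        mul_nonneg (abs_nonneg _) (Real.rpow_nonneg (nm_nonneg z) _)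
      linarith [norm_sub_le (term (phaseHom m) s (z + r)) (term (phaseHom m) s z), h1 z, h1 (z + r)]
    · rw [zero_add]
      push Not at h
      refine (norm_term_add_sub_term_le m (by linarith) hs hB (by linarith) (by linarith)).trans ?_
      have := Real.rpow_nonneg (nm_nonneg z) (-(σ + 1 / 2))
      gcongr
      exact le_abs_self C

lemma differentiableAt_term (ψ : GaussianInt → ℂ) (z : GaussianInt) {s : ℂ} (hs : 0 < s.re) :
    DifferentiableAt ℂ (fun s ↦ term ψ s z) s := by
  unfold term
  refine DifferentiableAt.const_mul ?_ _
  refine DifferentiableAt.const_cpow (by fun_prop) (Or.inr ?_)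
  rintro h
  have : s = 0 := by simpa using h
  simp [this] at hs

lemma isOpen_re_gt (σ : ℝ) : IsOpen {s : ℂ | σ < s.re} := isOpen_lt continuous_const continuous_re

/-- The local boundedness needed to sum holomorphic functions on a right half-plane. -/
lemma differentiableOn_tsum_of_halfPlane {ι : Type*} {σ₀ : ℝ} {F : ι → ℂ → ℂ}
    (hF : ∀ i s, σ₀ < s.re → DifferentiableAt ℂ (F i) s)
    (hb : ∀ σ B, σ₀ < σ → ∃ u : ι → ℝ, Summable u ∧ ∀ i s, σ ≤ s.re → ‖s‖ ≤ B → ‖F i s‖ ≤ u i) :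
    DifferentiableOn ℂ (fun s ↦ ∑' i, F i s) {s | σ₀ < s.re} := by
  intro s₀ hs₀
  obtain ⟨σ, hσ1, hσ2⟩ := exists_between (show σ₀ < s₀.re from hs₀)
  obtain ⟨u, hu, hle⟩ := hb σ (‖s₀‖ + 1) hσ1
  have hopen : IsOpen ({s : ℂ | σ < s.re} ∩ Metric.ball 0 (‖s₀‖ + 1)) :=
    (isOpen_re_gt σ).inter Metric.isOpen_ball
  have h := differentiableOn_tsum_of_summable_norm (F := F) hu (fun i s hs ↦
      (hF i s (hσ1.trans hs.1)).differentiableWithinAt) hopen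
      (fun i s hs ↦ hle i s (le_of_lt hs.1) ((mem_ball_zero_iff.mp hs.2).le))
  exact (h.differentiableAt (hopen.mem_nhds ⟨hσ2, by simp⟩)).differentiableWithinAt

/-- Residue of a Gaussian integer in the box `[0, k) × [0, k)`. -/
def boxRep (k : ℕ) (r : Fin k × Fin k) : GaussianInt := ⟨r.1, r.2⟩

/-- Division with remainder of both coordinates by `k`. -/
def divModEquiv (k : ℕ) [NeZero k] : GaussianInt ≃ GaussianInt × (Fin k × Fin k) where
  toFun z := (⟨(Int.divModEquiv k z.re).1, (Int.divModEquiv k z.im).1⟩,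
    ((Int.divModEquiv k z.re).2, (Int.divModEquiv k z.im).2))
  invFun p := ⟨(Int.divModEquiv k).symm (p.1.re, p.2.1), (Int.divModEquiv k).symm (p.1.im, p.2.2)⟩
  left_inv z := by ext <;> exact Equiv.symm_apply_apply (Int.divModEquiv k) _
  right_inv p := by
    refine Prod.ext (Zsqrtd.ext ?_ ?_) (Prod.ext ?_ ?_) <;>
      dsimp only <;> rw [Equiv.apply_symm_apply]

lemma divModEquiv_symm_apply (k : ℕ) [NeZero k] (p : GaussianInt × (Fin k × Fin k)) :
    (divModEquiv k).symm p = (k : GaussianInt) * p.1 + boxRep k p.2 := by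
  ext <;> simp [divModEquiv, boxRep, Int.divModEquiv_symm_apply, mul_comm]

/-- A Dirichlet series with periodic coefficients agrees, up to a function holomorphic for
`1 / 2 < re s`, with a multiple of the one with constant coefficients. -/
theorem exists_series_periodic_eq (k : ℕ) [NeZero k] (m : ℤ) (g : GaussianInt → ℂ)
    (hg : ∀ z w, g ((k : GaussianInt) * w + z) = g z) :
    ∃ H : ℂ → ℂ, DifferentiableOn ℂ H {s | 1 / 2 < s.re} ∧ ∀ s : ℂ, 1 < s.re →
      series (fun z ↦ g z * phaseHom m z) s =
        (∑ r, g (boxRep k r)) * (nm (k : GaussianInt) : ℂ) ^ (-s) * series (phaseHom m) s + H s := by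
  have hk : k ≠ 0 := NeZero.ne k
  have hk' : (k : GaussianInt) ≠ 0 := by exact_mod_cast hk
  have hinj : Function.Injective fun w : GaussianInt ↦ (k : GaussianInt) * w :=
    mul_right_injective₀ hk'
  refine ⟨fun s ↦ ∑ r, g (boxRep k r) * ∑' w : GaussianInt,
    (term (phaseHom m) s (k * w + boxRep k r) - term (phaseHom m) s (k * w)), ?_, ?_⟩
  · refine DifferentiableOn.fun_sum fun r _ ↦ DifferentiableOn.const_mul ?_ _
    refine differentiableOn_tsum_of_halfPlane (fun w s hs ↦ ?_) (fun σ B hσ ↦ ?_)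
    · exact (differentiableAt_term _ _ (by linarith)).sub (differentiableAt_term _ _ (by linarith))
    · obtain ⟨u, hu, hle⟩ := exists_summable_norm_term_add_sub_term_le m (boxRep k r) B hσ
      exact ⟨_, hu.comp_injective hinj, fun w s hs hB ↦ hle _ s hs hB⟩
  · intro s hs
    have hsum : Summable (term (phaseHom m) s) := summable_term (norm_phaseHom_le m) hs
    have hk1 (w : GaussianInt) : term (phaseHom m) s (k * w) =
        (nm (k : GaussianInt) : ℂ) ^ (-s) * term (phaseHom m) s w := by
      rw [term_mul]; congr 1; rw [term, phaseHom_natCast m hk, one_mul]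
    have hs1 (r : Fin k × Fin k) :
        Summable fun w : GaussianInt ↦ term (phaseHom m) s (k * w + boxRep k r) :=
      hsum.comp_injective ((add_left_injective _).comp hinj)
    have hs2 : Summable fun w : GaussianInt ↦ term (phaseHom m) s (k * w) :=
      hsum.comp_injective hinj
    have hterm (p : (Fin k × Fin k) × GaussianInt) :
        term (fun z ↦ g z * phaseHom m z) s ((k : GaussianInt) * p.2 + boxRep k p.1) =
          g (boxRep k p.1) * term (phaseHom m) s (k * p.2 + boxRep k p.1) := by
      simp only [term, hg]; ring
    rw [series, ← ((Equiv.prodComm _ _).trans (divModEquiv k).symm).tsum_eq]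
    simp only [Equiv.trans_apply, divModEquiv_symm_apply, Equiv.prodComm_apply, Prod.fst_swap,
      Prod.snd_swap, hterm]
    rw [Summable.tsum_prod', tsum_fintype]
    · rw [Finset.sum_mul, Finset.sum_mul, ← Finset.sum_add_distrib]
      refine Finset.sum_congr rfl fun r _ ↦ ?_
      dsimp only
      rw [tsum_mul_left, Summable.tsum_sub (hs1 r) hs2, mul_sub, series]
      simp_rw [hk1]
      rw [tsum_mul_left]
      ring
    · have := (((Equiv.prodComm _ _).trans (divModEquiv k).symm).summable_iff
        (f := term (fun z ↦ g z * phaseHom m z) s)).mpr ?_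
      · refine this.congr fun p ↦ ?_
        simp [divModEquiv_symm_apply, hterm]
      · have hbound : ∃ C : ℝ, ∀ z, ‖g z‖ ≤ C := by
          obtain ⟨C, hC⟩ := (Set.finite_range fun r ↦ ‖g (boxRep k r)‖).bddAbove
          refine ⟨C, fun z ↦ ?_⟩
          have := (divModEquiv k).symm_apply_apply z
          rw [divModEquiv_symm_apply] at this
          calc ‖g z‖ = ‖g (boxRep k (divModEquiv k z).2)‖ := by
                rw [← hg (boxRep k (divModEquiv k z).2) (divModEquiv k z).1, this]
            _ ≤ C := hC (Set.mem_range_self _)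
        obtain ⟨C, hC⟩ := hbound
        refine Summable.of_norm_bounded (hsum.norm.mul_left C) fun z ↦ ?_
        rw [show term (fun z ↦ g z * phaseHom m z) s z = g z * term (phaseHom m) s z by
          simp only [term]; ring, norm_mul]
        gcongr
        exact hC z
    · intro r
      dsimp only
      exact (hs1 r).mul_left _

end GaussianInt

namespace GaussianInt

open Complex Filter Topology

/-- On the half-plane `1 < re s` near `s₀`, the function has at most a pole of order `n`. -/
def PoleOrderLE (n : ℕ) (f : ℂ → ℂ) (s₀ : ℂ) : Prop :=
  ∃ G : ℂ → ℂ, AnalyticAt ℂ G s₀ ∧ ∀ᶠ s in 𝓝 s₀, 1 < s.re → (s - s₀) ^ n * f s = G s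

lemma analyticAt_of_differentiableOn_halfPlane {σ : ℝ} {H : ℂ → ℂ} {s₀ : ℂ}
    (hH : DifferentiableOn ℂ H {s | σ < s.re}) (hs : σ < s₀.re) : AnalyticAt ℂ H s₀ :=
  hH.analyticAt ((isOpen_re_gt σ).mem_nhds hs)

lemma PoleOrderLE.mono {n m : ℕ} {f : ℂ → ℂ} {s₀ : ℂ} (h : PoleOrderLE n f s₀) (hnm : n ≤ m) :
    PoleOrderLE m f s₀ := by
  obtain ⟨G, hG, he⟩ := h
  refine ⟨fun s ↦ (s - s₀) ^ (m - n) * G s, by fun_prop, he.mono fun s hs h1 ↦ ?_⟩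
  dsimp only
  rw [← hs h1, ← mul_assoc, ← pow_add, Nat.sub_add_cancel hnm]

lemma PoleOrderLE.mul_add {n : ℕ} {f A H : ℂ → ℂ} {s₀ : ℂ} (h : PoleOrderLE n f s₀)
    (hA : AnalyticAt ℂ A s₀) (hH : AnalyticAt ℂ H s₀) :
    PoleOrderLE n (fun s ↦ A s * f s + H s) s₀ := by
  obtain ⟨G, hG, he⟩ := h
  refine ⟨fun s ↦ A s * G s + (s - s₀) ^ n * H s, by fun_prop, he.mono fun s hs h1 ↦ ?_⟩
  dsimp only
  rw [← hs h1]; ring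

lemma PoleOrderLE.congr {n : ℕ} {f g : ℂ → ℂ} {s₀ : ℂ} (h : PoleOrderLE n f s₀)
    (hfg : ∀ s, 1 < s.re → g s = f s) : PoleOrderLE n g s₀ := by
  obtain ⟨G, hG, he⟩ := h
  exact ⟨G, hG, he.mono fun s hs h1 ↦ by rw [hfg s h1, hs h1]⟩

lemma poleOrderLE_zero_of_mul_eq {f A H : ℂ → ℂ} {s₀ : ℂ} (hA : AnalyticAt ℂ A s₀)
    (hH : AnalyticAt ℂ H s₀) (h0 : A s₀ ≠ 0) (h : ∀ s, 1 < s.re → A s * f s = H s) :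
    PoleOrderLE 0 f s₀ := by
  refine ⟨fun s ↦ H s / A s, hH.div hA h0, ?_⟩
  filter_upwards [hA.continuousAt.eventually_ne h0] with s hs h1
  rw [pow_zero, one_mul, ← h s h1, mul_div_cancel_left₀ _ hs]

lemma poleOrderLE_one_of_mul_eq {f A H : ℂ → ℂ} {s₀ : ℂ} (hA : AnalyticAt ℂ A s₀)
    (hH : AnalyticAt ℂ H s₀) (h0 : A s₀ = 0) (h1 : deriv A s₀ ≠ 0)
    (h : ∀ s, 1 < s.re → A s * f s = H s) : PoleOrderLE 1 f s₀ := by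
  obtain ⟨p, hp⟩ := hA
  have hd : AnalyticAt ℂ (dslope A s₀) s₀ := ⟨_, hp.has_fpower_series_dslope_fslope⟩
  have hd0 : dslope A s₀ s₀ ≠ 0 := by rwa [dslope_same]
  refine ⟨fun s ↦ H s / dslope A s₀ s, hH.div hd hd0, ?_⟩
  filter_upwards [hd.continuousAt.eventually_ne hd0] with s hs hs1
  have : A s = (s - s₀) * dslope A s₀ s := by
    have := sub_smul_dslope A s₀ s
    rw [h0, sub_zero, smul_eq_mul] at this
    exact this.symm
  rw [pow_one, eq_div_iff hs, ← h s hs1, this]; ring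

lemma mul_series_phaseHom_zero (k : ℕ) [NeZero k] : ∃ H : ℂ → ℂ,
    DifferentiableOn ℂ H {s | 1 / 2 < s.re} ∧ ∀ s : ℂ, 1 < s.re →
      (1 - (k : ℂ) ^ 2 * (((k : ℝ) ^ 2 : ℝ) : ℂ) ^ (-s)) * series (phaseHom 0) s = H s := by
  obtain ⟨H, hH, he⟩ := exists_series_periodic_eq k 0 (fun _ ↦ 1) (fun _ _ ↦ rfl)
  refine ⟨H, hH, fun s hs ↦ ?_⟩
  have := he s hs
  simp only [one_mul, nm_natCast, Finset.sum_const, Finset.card_univ, Fintype.card_prod,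
    Fintype.card_fin, nsmul_eq_mul, mul_one] at this
  rw [sub_mul, one_mul, sub_eq_iff_eq_add']
  convert this using 4
  push_cast; ring

lemma analyticAt_const_cpow_neg {c : ℝ} (hc : 0 < c) (s₀ : ℂ) :
    AnalyticAt ℂ (fun s ↦ (c : ℂ) ^ (-s)) s₀ := by
  have : (c : ℂ) ∈ slitPlane := by simpa using hc
  exact analyticAt_const.cpow (by fun_prop) this

lemma cpow_neg_one_add_I_mul {c : ℝ} (hc : 0 < c) (t : ℝ) :
    (c : ℂ) * (c : ℂ) ^ (-(1 + t * I)) = exp (-(t * Real.log c : ℝ) * I) := by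
  have hc' : (c : ℂ) ≠ 0 := by exact_mod_cast hc.ne'
  rw [neg_add, cpow_add _ _ hc', cpow_neg_one, mul_inv_cancel_left₀ hc', cpow_def_of_ne_zero hc',
    ← ofReal_log hc.le]
  congr 1; push_cast; ring

lemma poleOrderLE_series_phaseHom_zero_one : PoleOrderLE 1 (series (phaseHom 0)) 1 := by
  obtain ⟨H, hH, he⟩ := mul_series_phaseHom_zero 2
  refine poleOrderLE_one_of_mul_eq
    (A := fun s ↦ 1 - ((2 : ℕ) : ℂ) ^ 2 * ((((2 : ℕ) : ℝ) ^ 2 : ℝ) : ℂ) ^ (-s)) ?_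
    (analyticAt_of_differentiableOn_halfPlane hH (by norm_num)) ?_ ?_ he
  · exact analyticAt_const.sub (analyticAt_const.mul (analyticAt_const_cpow_neg (by norm_num) _))
  · norm_num [cpow_neg_one]
  · have hd : HasDerivAt (fun s : ℂ ↦ ((((2 : ℕ) : ℝ) ^ 2 : ℝ) : ℂ) ^ (-s)) _ 1 :=
      (hasDerivAt_neg (1 : ℂ)).const_cpow (Or.inl (by norm_num))
    rw [((hd.const_mul _).const_sub 1).deriv]
    have : log (4 : ℂ) ≠ 0 := by
      have : ((Real.log 4 : ℝ) : ℂ) ≠ 0 := by exact_mod_cast (Real.log_pos (by norm_num)).ne'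
      simpa [ofReal_log] using this
    norm_num [cpow_neg_one, this]

lemma int_mul_log_four_ne {a b : ℤ} (ha : a ≠ 0) (h : a * Real.log 9 = b * Real.log 4) : False := by
  have h4 : 0 < Real.log 4 := Real.log_pos (by norm_num)
  have h9 : 0 < Real.log 9 := Real.log_pos (by norm_num)
  have h' := congrArg abs h
  rw [abs_mul, abs_mul, abs_of_pos h4, abs_of_pos h9, ← Int.cast_abs, ← Int.cast_abs,
    Int.abs_eq_natAbs, Int.abs_eq_natAbs, Int.cast_natCast, Int.cast_natCast, ← Real.log_pow,
    ← Real.log_pow] at h'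
  have h2 := Real.log_injOn_pos (by simp) (by simp) h'
  have h3 : 9 ^ a.natAbs = 4 ^ b.natAbs := by exact_mod_cast h2
  have hodd : Odd (4 ^ b.natAbs) := h3 ▸ Odd.pow (by decide)
  have hb : b.natAbs = 0 := by
    by_contra hb
    exact (Nat.not_even_iff_odd.mpr hodd) (Even.pow_of_ne_zero (by decide) hb)
  rw [hb, pow_zero] at h3
  have : a.natAbs ≠ 0 := by simpa using ha
  exact absurd h3 (Nat.one_lt_pow this (by norm_num)).ne'

lemma poleOrderLE_series_phaseHom_zero {t : ℝ} (ht : t ≠ 0) :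
    PoleOrderLE 0 (series (phaseHom 0)) (1 + t * I) := by
  have key (k : ℕ) [NeZero k] (h : exp (-(t * Real.log ((k : ℝ) ^ 2) : ℝ) * I) ≠ 1) :
      PoleOrderLE 0 (series (phaseHom 0)) (1 + t * I) := by
    have hk : (0 : ℝ) < (k : ℝ) ^ 2 := by have := NeZero.ne k; positivity
    obtain ⟨H, hH, he⟩ := mul_series_phaseHom_zero k
    refine poleOrderLE_zero_of_mul_eq ?_
      (analyticAt_of_differentiableOn_halfPlane hH (by norm_num)) ?_ he
    · exact analyticAt_const.sub (analyticAt_const.mul (analyticAt_const_cpow_neg hk _))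
    · have := cpow_neg_one_add_I_mul hk t
      rw [sub_ne_zero]
      push_cast at this h ⊢
      rw [this]
      exact h.symm
  by_contra hcon
  have h2 : exp (-(t * Real.log ((2 : ℕ) ^ 2) : ℝ) * I) = 1 := by
    by_contra h; exact hcon (key 2 h)
  have h3 : exp (-(t * Real.log ((3 : ℕ) ^ 2) : ℝ) * I) = 1 := by
    by_contra h; exact hcon (key 3 h)
  rw [exp_eq_one_iff] at h2 h3
  obtain ⟨a, ha⟩ := h2
  obtain ⟨b, hb⟩ := h3
  rw [← mul_assoc] at ha hb
  have ha' := mul_right_cancel₀ I_ne_zero ha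
  have hb' := mul_right_cancel₀ I_ne_zero hb
  have ha2 : -(t * Real.log ((2 : ℕ) ^ 2)) = a * (2 * Real.pi) := by exact_mod_cast ha'
  have hb2 : -(t * Real.log ((3 : ℕ) ^ 2)) = b * (2 * Real.pi) := by exact_mod_cast hb'
  norm_num at ha2 hb2
  have h4 : 0 < Real.log 4 := Real.log_pos (by norm_num)
  have h9 : 0 < Real.log 9 := Real.log_pos (by norm_num)
  refine int_mul_log_four_ne (a := a) (b := b) ?_ ?_
  · rintro rfl
    simp [ht] at ha2
    linarith
  · have h1 : (a * Real.log 9 - b * Real.log 4) * (2 * Real.pi) = 0 := by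
      linear_combination -Real.log 9 * ha2 + Real.log 4 * hb2
    have := (mul_eq_zero.mp h1).resolve_right (by positivity)
    linarith

lemma dvd_iff_of_sq_eq_one {ε : ℤ} (hε : ε * ε = 1) (z : GaussianInt) :
    (⟨2, ε⟩ : GaussianInt) ∣ z ↔ 5 ∣ z.re - 2 * ε * z.im := by
  constructor
  · rintro ⟨w, rfl⟩
    refine ⟨-ε * w.im, ?_⟩
    simp only [Zsqrtd.re_mul, Zsqrtd.im_mul]
    linear_combination (-2 * w.re) * hε
  · rintro ⟨c, hc⟩
    refine ⟨⟨2 * c + ε * z.im, -ε * c⟩, ?_⟩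
    ext
    · simp only [Zsqrtd.re_mul]
      linear_combination hc - c * hε
    · simp only [Zsqrtd.im_mul]
      linear_combination (-z.im) * hε

lemma mul_series_phaseHom {ε : ℤ} (hε : ε = 1 ∨ ε = -1) (m : ℤ) :
    ∃ H : ℂ → ℂ, DifferentiableOn ℂ H {s | 1 / 2 < s.re} ∧ ∀ s : ℂ, 1 < s.re →
      (phaseHom m (⟨2, ε⟩ : GaussianInt) - ((5 : ℝ) : ℂ) * ((5 : ℝ) : ℂ) ^ (-s)) *
        series (phaseHom m) s = H s := by
  classical
  set α : GaussianInt := ⟨2, ε⟩ with hαdef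
  have hε' : ε * ε = 1 := by rcases hε with rfl | rfl <;> rfl
  have hn : α.norm = 5 := by rcases hε with rfl | rfl <;> rfl
  have hα0 : α ≠ 0 := by intro h; rw [h] at hn; norm_num at hn
  have hα5 : α ∣ ((5 : ℕ) : GaussianInt) := by
    rw [hαdef, dvd_iff_of_sq_eq_one hε']; simp
  obtain ⟨H, hH, he⟩ := exists_series_periodic_eq 5 m (fun z ↦ if α ∣ z then 1 else 0) (by
    intro z w
    rw [dvd_add_right (hα5.mul_right w)])
  have hsum : ∑ r, (if α ∣ boxRep 5 r then (1 : ℂ) else 0) = 5 := by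
    simp_rw [hαdef, dvd_iff_of_sq_eq_one hε']
    rw [Finset.sum_boole]
    have : (Finset.univ.filter fun r : Fin 5 × Fin 5 ↦
        (5 : ℤ) ∣ (boxRep 5 r).re - 2 * ε * (boxRep 5 r).im).card = 5 := by
      rcases hε with rfl | rfl <;> decide
    rw [this]; norm_num
  refine ⟨fun s ↦ ((5 : ℝ) : ℂ) ^ s * H s, ?_, fun s hs ↦ ?_⟩
  · refine DifferentiableOn.mul (fun s _ ↦ ?_) hH
    exact (DifferentiableAt.const_cpow (by fun_prop) (Or.inl (by norm_num))).differentiableWithinAt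
  have h := he s hs
  have hL : series (fun z ↦ (if α ∣ z then 1 else 0) * phaseHom m z) s =
      phaseHom m α * ((5 : ℝ) : ℂ) ^ (-s) * series (phaseHom m) s := by
    have hinj : Function.Injective fun w : GaussianInt ↦ α * w := mul_right_injective₀ hα0
    rw [series, ← hinj.tsum_eq]
    · rw [series, ← tsum_mul_left]
      refine tsum_congr fun w ↦ ?_
      have h5 : nm α = 5 := by rw [nm, hn]; norm_num
      have := term_mul (phaseHom m) s α w
      rw [show term (phaseHom m) s α = phaseHom m α * ((5 : ℝ) : ℂ) ^ (-s) by rw [term, h5]] at this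
      rw [← this]
      simp [term]
    · intro z hz
      by_contra hcon
      apply hz
      have : ¬ α ∣ z := fun ⟨w, hw⟩ ↦ hcon ⟨w, hw.symm⟩
      simp [term, this]
  rw [hL, hsum] at h
  have h25 : (nm ((5 : ℕ) : GaussianInt) : ℂ) ^ (-s) =
      ((5 : ℝ) : ℂ) ^ (-s) * ((5 : ℝ) : ℂ) ^ (-s) := by
    rw [nm_natCast, ← Complex.mul_cpow_ofReal_nonneg (by norm_num) (by norm_num)]
    norm_num
  rw [h25] at h
  have h1 : ((5 : ℝ) : ℂ) ^ s * ((5 : ℝ) : ℂ) ^ (-s) = 1 := by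
    rw [← cpow_add _ _ (by norm_num), add_neg_cancel, cpow_zero]
  have : H s = phaseHom m α * ((5 : ℝ) : ℂ) ^ (-s) * series (phaseHom m) s -
      5 * (((5 : ℝ) : ℂ) ^ (-s) * ((5 : ℝ) : ℂ) ^ (-s)) * series (phaseHom m) s := by
    rw [h]; ring
  dsimp only
  rw [this]
  have h5 : ((5 : ℝ) : ℂ) = 5 := by norm_num
  generalize ((5 : ℝ) : ℂ) ^ s = x at *
  generalize ((5 : ℝ) : ℂ) ^ (-s) = y at *
  rw [h5]
  linear_combination (-phaseHom m α * series (phaseHom m) s + 5 * y * series (phaseHom m) s) * h1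

/-- Reduction of the Gaussian integers modulo `k` sending `i` to a square root of `-1`. -/
def toZMod {k : ℕ} (ι : ZMod k) (hι : ι * ι = -1) : GaussianInt →+* ZMod k :=
  Zsqrtd.lift ⟨ι, by simpa using hι⟩

lemma toZMod_apply {k : ℕ} (ι : ZMod k) (hι : ι * ι = -1) (z : GaussianInt) :
    toZMod ι hι z = z.re + z.im * ι := rfl

lemma phaseHom_ne {m : ℤ} (hm : m ≠ 0) :
    phaseHom m (⟨2, 1⟩ : GaussianInt) ≠ phaseHom m (⟨2, -1⟩ : GaussianInt) := by
  have hnorm : ‖((⟨2, -1⟩ : GaussianInt) : ℂ)‖ = ‖((⟨2, 1⟩ : GaussianInt) : ℂ)‖ := by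
    rw [← Complex.norm_conj]; congr 1; simp [toComplex_def', Complex.ext_iff]
  have hne : ‖((⟨2, 1⟩ : GaussianInt) : ℂ)‖ ≠ 0 := by
    rw [norm_ne_zero_iff, Ne, toComplex_eq_zero]; decide
  have hnat (n : ℕ) (hn : n ≠ 0) :
      phase (⟨2, 1⟩ : GaussianInt) ^ n ≠ phase (⟨2, -1⟩ : GaussianInt) ^ n := by
    intro h
    rw [phase, phase, hnorm, div_pow, div_pow, div_left_inj' (pow_ne_zero _ (by exact_mod_cast hne)),
      ← map_pow, ← map_pow, toComplex_inj] at h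
    have := congrArg (toZMod (k := 5) 2 (by decide)) h
    rw [map_pow, map_pow, toZMod_apply, toZMod_apply] at this
    norm_num at this
    rw [zero_pow hn] at this
    have h4 : (4 : ZMod 5) ≠ 0 := by decide
    have : Fact (Nat.Prime 5) := ⟨by norm_num⟩
    exact pow_ne_zero n h4 (by assumption)
  obtain ⟨n, rfl | rfl⟩ := m.eq_nat_or_neg
  · simpa [phaseHom] using hnat n (by simpa using hm)
  · simpa [phaseHom] using hnat n (by simpa using hm)

lemma poleOrderLE_series_phaseHom {m : ℤ} (hm : m ≠ 0) (t : ℝ) :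
    PoleOrderLE 0 (series (phaseHom m)) (1 + t * I) := by
  have key {ε : ℤ} (hε : ε = 1 ∨ ε = -1)
      (h : phaseHom m (⟨2, ε⟩ : GaussianInt) ≠ exp (-(t * Real.log 5 : ℝ) * I)) :
      PoleOrderLE 0 (series (phaseHom m)) (1 + t * I) := by
    obtain ⟨H, hH, he⟩ := mul_series_phaseHom hε m
    refine poleOrderLE_zero_of_mul_eq ?_
      (analyticAt_of_differentiableOn_halfPlane hH (by norm_num)) ?_ he
    · exact analyticAt_const.sub (analyticAt_const.mul (analyticAt_const_cpow_neg (by norm_num) _))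
    · rw [sub_ne_zero, cpow_neg_one_add_I_mul (by norm_num)]
      exact h
  by_cases h : phaseHom m (⟨2, 1⟩ : GaussianInt) = exp (-(t * Real.log 5 : ℝ) * I)
  · refine key (ε := -1) (Or.inr rfl) ?_
    rw [← h]
    exact (phaseHom_ne hm).symm
  · exact key (ε := 1) (Or.inl rfl) h

lemma neg_mul_neg_eq_neg_one {k : ℕ} {ι : ZMod k} (hι : ι * ι = -1) : -ι * -ι = -1 := by
  rw [neg_mul_neg, hι]

/-- The character `z ↦ χ(φ z) χ⁻¹(φ' z) (z / |z|) ^ m`, where `φ, φ'` are the reductions modulo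
`k` sending `i` to `ι, -ι`. -/
noncomputable def hecke {k : ℕ} {ι : ZMod k} (hι : ι * ι = -1) (χ : DirichletCharacter ℂ k)
    (m : ℤ) : GaussianInt →* ℂ :=
  χ.toMonoidHom.comp (toZMod ι hι : GaussianInt →* ZMod k) *
    χ⁻¹.toMonoidHom.comp (toZMod (-ι) (neg_mul_neg_eq_neg_one hι) : GaussianInt →* ZMod k) *
    phaseHom m

lemma hecke_apply {k : ℕ} {ι : ZMod k} (hι : ι * ι = -1) (χ : DirichletCharacter ℂ k)
    (m : ℤ) (z : GaussianInt) : hecke hι χ m z =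
      χ (z.re + z.im * ι) * χ⁻¹ (z.re + z.im * -ι) * phaseHom m z := rfl

lemma norm_hecke_le {k : ℕ} {ι : ZMod k} (hι : ι * ι = -1) (χ : DirichletCharacter ℂ k)
    (m : ℤ) (z : GaussianInt) : ‖hecke hι χ m z‖ ≤ 1 := by
  rw [hecke_apply, norm_mul, norm_mul]
  exact mul_le_one₀ (mul_le_one₀ (χ.norm_le_one _) (_root_.norm_nonneg _) (χ⁻¹.norm_le_one _))
    (_root_.norm_nonneg _) (norm_phaseHom_le m z)

lemma bijective_boxRep {k : ℕ} [NeZero k] {ι : ZMod k} (hι : ι * ι = -1) (hk : Odd k) :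
    Function.Bijective fun r : Fin k × Fin k ↦
      ((((boxRep k r).re + (boxRep k r).im * ι : ZMod k)),
        ((boxRep k r).re + (boxRep k r).im * -ι : ZMod k)) := by
  have h2 : IsUnit (2 : ZMod k) := by
    have := (ZMod.isUnit_iff_coprime 2 k).mpr (Nat.coprime_two_left.mpr hk)
    exact_mod_cast this
  have hιu : IsUnit ι := IsUnit.of_mul_eq_one (-ι) (by rw [mul_neg, hι, neg_neg])
  have hfin (x y : Fin k) (h : ((x : ℕ) : ZMod k) = ((y : ℕ) : ZMod k)) : x = y := by
    rw [ZMod.natCast_eq_natCast_iff', Nat.mod_eq_of_lt x.2, Nat.mod_eq_of_lt y.2] at h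
    exact Fin.ext h
  rw [Fintype.bijective_iff_injective_and_card]
  refine ⟨fun x y h ↦ ?_, by simp [ZMod.card]⟩
  simp only [boxRep, Prod.mk.injEq, Int.cast_natCast] at h
  obtain ⟨h1, h3⟩ := h
  refine Prod.ext (hfin _ _ (h2.mul_left_cancel ?_)) (hfin _ _ ((h2.mul hιu).mul_left_cancel ?_))
  · linear_combination h1 + h3
  · linear_combination h1 - h3

lemma sum_hecke_boxRep {k : ℕ} [NeZero k] {ι : ZMod k} (hι : ι * ι = -1) (hk : Odd k)
    {χ : DirichletCharacter ℂ k} (hχ : χ ≠ 1) :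
    ∑ r, χ ((boxRep k r).re + (boxRep k r).im * ι) *
      χ⁻¹ ((boxRep k r).re + (boxRep k r).im * -ι) = 0 := by
  rw [(bijective_boxRep hι hk).sum_comp fun p : ZMod k × ZMod k ↦ χ p.1 * χ⁻¹ p.2,
    Fintype.sum_prod_type, ← Fintype.sum_mul_sum, MulChar.sum_eq_zero_of_ne_one hχ, zero_mul]

lemma exists_series_hecke_eq {k : ℕ} [NeZero k] {ι : ZMod k} (hι : ι * ι = -1)
    (χ : DirichletCharacter ℂ k) (m : ℤ) : ∃ H : ℂ → ℂ,
      DifferentiableOn ℂ H {s | 1 / 2 < s.re} ∧ ∀ s : ℂ, 1 < s.re → series (hecke hι χ m) s =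
        (∑ r, χ ((boxRep k r).re + (boxRep k r).im * ι) *
          χ⁻¹ ((boxRep k r).re + (boxRep k r).im * -ι)) *
          (nm (k : GaussianInt) : ℂ) ^ (-s) * series (phaseHom m) s + H s :=
  exists_series_periodic_eq k m
    (fun z ↦ χ (z.re + z.im * ι) * χ⁻¹ (z.re + z.im * -ι)) (fun z w ↦ by simp)

lemma poleOrderLE_series_hecke_of_ne_one {k : ℕ} [NeZero k] {ι : ZMod k} (hι : ι * ι = -1)
    (hk : Odd k) {χ : DirichletCharacter ℂ k} (hχ : χ ≠ 1) (m : ℤ) (t : ℝ) :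
    PoleOrderLE 0 (series (hecke hι χ m)) (1 + t * I) := by
  obtain ⟨H, hH, he⟩ := exists_series_hecke_eq hι χ m
  refine ⟨H, analyticAt_of_differentiableOn_halfPlane hH (by norm_num), .of_forall fun s hs ↦ ?_⟩
  rw [he s hs, sum_hecke_boxRep hι hk hχ]
  ring

lemma PoleOrderLE.series_hecke {k : ℕ} [NeZero k] {ι : ZMod k} (hι : ι * ι = -1)
    {χ : DirichletCharacter ℂ k} {m : ℤ} {t : ℝ} {n : ℕ}
    (h : PoleOrderLE n (series (phaseHom m)) (1 + t * I)) :
    PoleOrderLE n (series (hecke hι χ m)) (1 + t * I) := by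
  obtain ⟨H, hH, he⟩ := exists_series_hecke_eq hι χ m
  have hk : (0 : ℝ) < nm (k : GaussianInt) := nm_pos (by exact_mod_cast NeZero.ne k)
  exact (h.mul_add (analyticAt_const.mul (analyticAt_const_cpow_neg hk _))
    (analyticAt_of_differentiableOn_halfPlane hH (by norm_num))).congr he

/-- The Dirichlet series of the characters have at most a simple pole, only at `1` and only for
the principal character, on the line `re s = 1`. -/
theorem poleOrderLE_series_hecke {k : ℕ} [NeZero k] {ι : ZMod k} (hι : ι * ι = -1)
    (hk : Odd k) (χ : DirichletCharacter ℂ k) (m : ℤ) (t : ℝ) :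
    PoleOrderLE (if χ = 1 ∧ m = 0 ∧ t = 0 then 1 else 0) (series (hecke hι χ m)) (1 + t * I) := by
  by_cases hχ : χ = 1
  · by_cases hm : m = 0
    · subst hm
      by_cases ht : t = 0
      · rw [if_pos ⟨hχ, rfl, ht⟩]
        subst ht
        exact PoleOrderLE.series_hecke hι (by simpa using poleOrderLE_series_phaseHom_zero_one)
      · rw [if_neg (by tauto)]
        exact PoleOrderLE.series_hecke hι (poleOrderLE_series_phaseHom_zero ht)
    · rw [if_neg (by tauto)]
      exact PoleOrderLE.series_hecke hι (poleOrderLE_series_phaseHom hm t)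
  · rw [if_neg (by tauto)]
    exact poleOrderLE_series_hecke_of_ne_one hι hk hχ m t

lemma nm_le_of_dvd {d z : GaussianInt} (hz : z ≠ 0) (h : d ∣ z) : nm d ≤ nm z := by
  obtain ⟨e, rfl⟩ := h
  rw [nm_mul]
  exact le_mul_of_one_le_right (nm_nonneg d) (one_le_nm (right_ne_zero_of_mul hz))

open Classical in
/-- The divisors of a nonzero Gaussian integer. -/
noncomputable def divisors (z : GaussianInt) : Finset GaussianInt :=
  (finite_nm_lt (nm z + 1)).toFinset.filter (· ∣ z)

lemma mem_divisors {d z : GaussianInt} (hz : z ≠ 0) : d ∈ divisors z ↔ d ∣ z := by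
  simp only [divisors, Finset.mem_filter, Set.Finite.mem_toFinset, Set.mem_ofPred_eq,
    and_iff_right_iff_imp]
  intro h
  linarith [nm_le_of_dvd hz h]

lemma mem_divisors_one {u : GaussianInt} : u ∈ divisors 1 ↔ IsUnit u := by
  rw [mem_divisors one_ne_zero, isUnit_iff_dvd_one]

lemma nm_eq_one_iff {z : GaussianInt} : nm z = 1 ↔ IsUnit z := by
  rw [Zsqrtd.isUnit_iff_norm_isUnit, Int.isUnit_iff, nm]
  have := norm_nonneg z
  constructor
  · intro h
    left
    exact_mod_cast h
  · rintro (h | h)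
    · rw [h]; norm_num
    · omega

lemma nm_eq_of_associated {z w : GaussianInt} (h : Associated z w) : nm z = nm w := by
  obtain ⟨u, rfl⟩ := h
  rw [nm_mul, nm_eq_one_iff.mpr u.isUnit, mul_one]

lemma nm_pow (z : GaussianInt) (n : ℕ) : nm (z ^ n) = nm z ^ n := by
  induction n with
  | zero => simpa using nm_eq_one_iff.mpr isUnit_one
  | succ n ih => rw [pow_succ, pow_succ, nm_mul, ih]

open Classical in
/-- The von Mangoldt function on the Gaussian integers. -/
noncomputable def vm (z : GaussianInt) : ℝ :=
  if h : ∃ π : GaussianInt, Prime π ∧ ∃ j : ℕ, Associated (π ^ (j + 1)) z then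
    Real.log (nm h.choose) else 0

lemma vm_eq {π z : GaussianInt} (hπ : Prime π) {j : ℕ} (h : Associated (π ^ (j + 1)) z) :
    vm z = Real.log (nm π) := by
  have hex : ∃ π : GaussianInt, Prime π ∧ ∃ j : ℕ, Associated (π ^ (j + 1)) z := ⟨π, hπ, j, h⟩
  rw [vm, dif_pos hex]
  obtain ⟨h1, i, h2⟩ := hex.choose_spec
  congr 1
  apply nm_eq_of_associated
  have : hex.choose ∣ π ^ (j + 1) :=
    (dvd_pow_self _ i.succ_ne_zero).trans (h2.trans h.symm).dvd
  exact h1.associated_of_dvd hπ (h1.dvd_of_dvd_pow this)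

lemma exists_of_vm_ne_zero {z : GaussianInt} (h : vm z ≠ 0) :
    ∃ π : GaussianInt, Prime π ∧ ∃ j : ℕ, Associated (π ^ (j + 1)) z := by
  by_contra hcon
  exact h (by rw [vm, dif_neg hcon])

lemma vm_eq_of_associated {z w : GaussianInt} (h : Associated z w) : vm z = vm w := by
  by_cases hz : ∃ π : GaussianInt, Prime π ∧ ∃ j : ℕ, Associated (π ^ (j + 1)) z
  · obtain ⟨π, hπ, j, hj⟩ := hz
    rw [vm_eq hπ hj, vm_eq hπ (hj.trans h)]
  · by_contra hne
    by_cases hvz : vm z = 0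
    · have hvw : vm w ≠ 0 := by rw [← hvz]; exact Ne.symm hne
      obtain ⟨π, hπ, j, hj⟩ := exists_of_vm_ne_zero hvw
      exact hz ⟨π, hπ, j, hj.trans h.symm⟩
    · exact hz (exists_of_vm_ne_zero hvz)

lemma one_lt_nm_of_prime {π : GaussianInt} (hπ : Prime π) : 1 < nm π :=
  lt_of_le_of_ne (one_le_nm hπ.ne_zero) fun h ↦ hπ.not_isUnit (nm_eq_one_iff.mp h.symm)

lemma log_nm_pos_of_prime {π : GaussianInt} (hπ : Prime π) : 0 < Real.log (nm π) :=
  Real.log_pos (one_lt_nm_of_prime hπ)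

lemma vm_nonneg (z : GaussianInt) : 0 ≤ vm z := by
  by_cases h : vm z = 0
  · exact h.ge
  · obtain ⟨π, hπ, j, hj⟩ := exists_of_vm_ne_zero h
    rw [vm_eq hπ hj]
    exact (log_nm_pos_of_prime hπ).le

lemma ne_zero_of_vm_ne_zero {z : GaussianInt} (h : vm z ≠ 0) : z ≠ 0 := by
  obtain ⟨π, hπ, j, hj⟩ := exists_of_vm_ne_zero h
  exact hj.ne_zero_iff.mp (pow_ne_zero _ hπ.ne_zero)

lemma vm_zero : vm 0 = 0 := by
  by_contra h
  exact ne_zero_of_vm_ne_zero h rfl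

lemma vm_le_log (z : GaussianInt) : vm z ≤ Real.log (nm z) := by
  by_cases h : vm z = 0
  · rw [h]
    by_cases hz : z = 0
    · rw [hz, nm_zero, Real.log_zero]
    · exact Real.log_nonneg (one_le_nm hz)
  · obtain ⟨π, hπ, j, hj⟩ := exists_of_vm_ne_zero h
    rw [vm_eq hπ hj, ← nm_eq_of_associated hj, nm_pow, Real.log_pow]
    have := log_nm_pos_of_prime hπ
    push_cast
    nlinarith [(Nat.cast_nonneg j : (0 : ℝ) ≤ j)]

lemma associated_pow_of_dvd_mul {π z d : GaussianInt} (hπ : Prime π) {v : ℕ} {w : GaussianInt}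
    (hz : z = π ^ v * w) (hw : ¬ π ∣ w) (hd : d ∣ π * z) (hd' : ¬ d ∣ z) (hvm : vm d ≠ 0) :
    Associated (π ^ (v + 1)) d := by
  obtain ⟨ϖ, hϖ, j, hj⟩ := exists_of_vm_ne_zero hvm
  have hassoc : Associated ϖ π := by
    by_contra hna
    have hcop : IsCoprime ϖ π :=
      (hϖ.irreducible.coprime_iff_not_dvd).mpr fun h ↦ hna (hϖ.associated_of_dvd hπ h)
    refine hd' (hj.symm.dvd.trans ?_)
    exact (hcop.pow_left (m := j + 1)).dvd_of_dvd_mul_left (hj.dvd.trans hd)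
  have hj' : Associated (π ^ (j + 1)) d := (hassoc.symm.pow_pow).trans hj
  have hle : v ≤ j := by
    by_contra hlt
    push Not at hlt
    refine hd' (hj'.symm.dvd.trans ?_)
    rw [hz]
    exact (pow_dvd_pow π (by omega)).mul_right w
  have hge : j ≤ v := by
    by_contra hlt
    push Not at hlt
    have h1 : π ^ (v + 1) * π ∣ π ^ (v + 1) * w := by
      rw [← pow_succ, show π ^ (v + 1) * w = π * z by rw [hz]; ring]
      exact (pow_dvd_pow π (by omega)).trans (hj'.dvd.trans hd)
    exact hw ((mul_dvd_mul_iff_left (pow_ne_zero _ hπ.ne_zero)).mp h1)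
  rwa [le_antisymm hge hle] at hj'

lemma sum_vm_divisors {z : GaussianInt} (hz : z ≠ 0) :
    ∑ d ∈ divisors z, vm d = (divisors 1).card * Real.log (nm z) := by
  classical
  induction z using UniqueFactorizationMonoid.induction_on_prime with
  | h₁ => exact absurd rfl hz
  | h₂ u hu =>
    rw [nm_eq_one_iff.mpr hu, Real.log_one, mul_zero]
    refine Finset.sum_eq_zero fun d hd ↦ ?_
    have hdu : IsUnit d := isUnit_of_dvd_unit ((mem_divisors hz).mp hd) hu
    by_contra h
    obtain ⟨π, hπ, j, hj⟩ := exists_of_vm_ne_zero h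
    exact hπ.not_isUnit (isUnit_of_dvd_unit (dvd_pow_self π j.succ_ne_zero) (hj.symm.isUnit hdu))
  | h₃ z π hz0 hπ ih =>
    obtain ⟨w, hzw, hw⟩ := (FiniteMultiplicity.of_prime_left hπ hz0).exists_eq_pow_mul_and_not_dvd
    set v := multiplicity π z
    have hsub : divisors z ⊆ divisors (π * z) := fun d hd ↦
      (mem_divisors hz).mpr (((mem_divisors hz0).mp hd).mul_left π)
    have hpow : π ^ (v + 1) ≠ 0 := pow_ne_zero _ hπ.ne_zero
    have himg : (divisors 1).image (· * π ^ (v + 1)) ⊆ divisors (π * z) \ divisors z := by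
      intro d hd
      obtain ⟨u, hu, rfl⟩ := Finset.mem_image.mp hd
      rw [mem_divisors_one] at hu
      rw [Finset.mem_sdiff, mem_divisors hz, mem_divisors hz0, hu.mul_left_dvd, hu.mul_left_dvd]
      refine ⟨⟨w, ?_⟩, fun h ↦ hw ?_⟩
      · rw [pow_succ', mul_assoc, ← hzw]
      · rw [hzw, pow_succ] at h
        exact (mul_dvd_mul_iff_left (pow_ne_zero _ hπ.ne_zero)).mp h
    have hvm {u : GaussianInt} (hu : u ∈ divisors 1) :
        vm (u * π ^ (v + 1)) = Real.log (nm π) :=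
      vm_eq hπ (associated_unit_mul_right _ u (mem_divisors_one.mp hu))
    rw [← Finset.sum_sdiff hsub, ih hz0, ← Finset.sum_subset himg, Finset.sum_image
      (fun x _ y _ h ↦ mul_right_cancel₀ hpow h), Finset.sum_congr rfl fun u hu ↦ hvm hu,
      Finset.sum_const, nsmul_eq_mul, nm_mul, Real.log_mul (nm_pos hπ.ne_zero).ne' (nm_pos hz0).ne']
    · ring
    · intro d hd hd'
      by_contra hne
      rw [Finset.mem_sdiff, mem_divisors hz, mem_divisors hz0] at hd
      obtain ⟨u, hu⟩ := associated_pow_of_dvd_mul hπ hzw hw hd.1 hd.2 hne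
      exact hd' (Finset.mem_image.mpr ⟨u, mem_divisors_one.mpr u.isUnit, by rw [← hu, mul_comm]⟩)

/-- The Dirichlet series with coefficients weighted by the von Mangoldt function. -/
noncomputable def vmSeries (ψ : GaussianInt → ℂ) (s : ℂ) : ℂ := ∑' z, (vm z : ℂ) * term ψ s z

lemma summable_log_mul_nm_rpow {σ : ℝ} (hσ : 1 < σ) :
    Summable fun z : GaussianInt ↦ Real.log (nm z) * nm z ^ (-σ) := by
  set δ := (σ - 1) / 2 with hδ
  have hδ0 : 0 < δ := by linarith
  refine Summable.of_nonneg_of_le (fun z ↦ ?_) (fun z ↦ ?_)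
    ((summable_nm_rpow (show 1 < σ - δ by linarith)).mul_left δ⁻¹)
  · by_cases hz : z = 0
    · simp [hz, nm_zero]
    · exact mul_nonneg (Real.log_nonneg (one_le_nm hz)) (Real.rpow_nonneg (nm_nonneg z) _)
  · by_cases hz : z = 0
    · simp [hz, nm_zero, Real.zero_rpow (show δ - σ ≠ 0 by linarith)]
    · calc Real.log (nm z) * nm z ^ (-σ) ≤ (nm z ^ δ / δ) * nm z ^ (-σ) := by
            gcongr
            · exact Real.rpow_nonneg (nm_nonneg z) _
            · exact Real.log_le_rpow_div (nm_nonneg z) hδ0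
        _ = δ⁻¹ * (nm z ^ δ * nm z ^ (-σ)) := by ring
        _ = _ := by rw [← Real.rpow_add (nm_pos hz)]; congr 2; ring

lemma summable_vm_mul_nm_rpow {σ : ℝ} (hσ : 1 < σ) :
    Summable fun z : GaussianInt ↦ vm z * nm z ^ (-σ) := by
  refine Summable.of_nonneg_of_le (fun z ↦ ?_) (fun z ↦ ?_) (summable_log_mul_nm_rpow hσ)
  · exact mul_nonneg (vm_nonneg z) (Real.rpow_nonneg (nm_nonneg z) _)
  · exact mul_le_mul_of_nonneg_right (vm_le_log z) (Real.rpow_nonneg (nm_nonneg z) _)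

lemma norm_vm_mul_term_le {ψ : GaussianInt → ℂ} (hψ : ∀ z, ‖ψ z‖ ≤ 1) {s : ℂ} (hs : 0 < s.re)
    (z : GaussianInt) : ‖(vm z : ℂ) * term ψ s z‖ ≤ vm z * nm z ^ (-s.re) := by
  rw [norm_mul, norm_real, Real.norm_of_nonneg (vm_nonneg z)]
  exact mul_le_mul_of_nonneg_left (norm_term_le hψ hs z) (vm_nonneg z)

lemma summable_norm_vm_mul_term {ψ : GaussianInt → ℂ} (hψ : ∀ z, ‖ψ z‖ ≤ 1) {s : ℂ}
    (hs : 1 < s.re) : Summable fun z ↦ ‖(vm z : ℂ) * term ψ s z‖ :=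
  Summable.of_nonneg_of_le (fun _ ↦ _root_.norm_nonneg _) (norm_vm_mul_term_le hψ (by linarith))
    (summable_vm_mul_nm_rpow hs)

lemma hasDerivAt_term (ψ : GaussianInt → ℂ) (z : GaussianInt) {s : ℂ} (hs : 0 < s.re) :
    HasDerivAt (fun s ↦ term ψ s z) (-((Real.log (nm z) : ℝ) * term ψ s z)) s := by
  have h : HasDerivAt (fun s : ℂ ↦ (nm z : ℂ) ^ (-s)) _ s :=
    (hasDerivAt_neg s).const_cpow (Or.inr (by rintro h; rw [neg_eq_zero] at h; simp [h] at hs))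
  refine (h.const_mul (ψ z)).congr_deriv ?_
  rw [term, ofReal_log (nm_nonneg z)]
  ring

lemma differentiableOn_series {ψ : GaussianInt → ℂ} (hψ : ∀ z, ‖ψ z‖ ≤ 1) :
    DifferentiableOn ℂ (series ψ) {s | 1 < s.re} :=
  differentiableOn_tsum_of_halfPlane (fun z _ hs ↦ differentiableAt_term ψ z (by linarith))
    fun σ _ hσ ↦ ⟨_, summable_nm_rpow hσ, fun z s hs _ ↦
      (norm_term_le hψ (by linarith) z).trans <| by
        by_cases hz : z = 0
        · simp [hz, nm_zero, Real.zero_rpow (show -σ ≠ 0 by linarith),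
            Real.zero_rpow (show -s.re ≠ 0 by linarith)]
        · exact Real.rpow_le_rpow_of_exponent_le (one_le_nm hz) (by linarith)⟩

lemma deriv_series {ψ : GaussianInt → ℂ} (hψ : ∀ z, ‖ψ z‖ ≤ 1) {s : ℂ} (hs : 1 < s.re) :
    deriv (series ψ) s = -∑' z, (Real.log (nm z) : ℂ) * term ψ s z := by
  obtain ⟨σ, hσ1, hσ2⟩ := exists_between hs
  have h := hasSum_deriv_of_summable_norm (F := fun z s ↦ term ψ s z) (summable_nm_rpow hσ1)
    (fun z s hs ↦ (differentiableAt_term ψ z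
      (by linarith [show σ < s.re from hs])).differentiableWithinAt) (isOpen_re_gt σ)
    (fun z s (hs : σ < s.re) ↦ (norm_term_le hψ (by linarith) z).trans <| by
        by_cases hz : z = 0
        · simp [hz, nm_zero, Real.zero_rpow (show -σ ≠ 0 by linarith),
            Real.zero_rpow (show -s.re ≠ 0 by linarith)]
        · exact Real.rpow_le_rpow_of_exponent_le (one_le_nm hz) (by linarith)) hσ2
  rw [show series ψ = fun s ↦ ∑' z, term ψ s z from rfl, ← h.tsum_eq, ← tsum_neg]
  exact tsum_congr fun z ↦ (hasDerivAt_term ψ z (by linarith)).deriv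

/-- Factorisations `p.1 * p.2 = z` correspond to divisors of `z`. -/
noncomputable def fiberEquivDivisors {z : GaussianInt} (hz : z ≠ 0) :
    {p : GaussianInt × GaussianInt // p.1 * p.2 = z} ≃ {d // d ∈ divisors z} :=
  Equiv.ofBijective (fun p ↦ ⟨p.1.1, (mem_divisors hz).mpr ⟨p.1.2, p.2.symm⟩⟩) <| by
    constructor
    · rintro ⟨⟨a, b⟩, h⟩ ⟨⟨c, d⟩, h'⟩ heq
      obtain rfl : a = c := congrArg Subtype.val heq
      have ha : a ≠ 0 := by rintro rfl; simp at h; exact hz h.symm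
      obtain rfl : b = d := mul_left_cancel₀ ha (h.trans h'.symm)
      rfl
    · rintro ⟨d, hd⟩
      obtain ⟨e, he⟩ := (mem_divisors hz).mp hd
      exact ⟨⟨(d, e), he.symm⟩, rfl⟩

theorem vmSeries_mul_series (ψ : GaussianInt →* ℂ) (hψ : ∀ z, ‖ψ z‖ ≤ 1) {s : ℂ}
    (hs : 1 < s.re) :
    vmSeries ψ s * series ψ s = -(divisors 1).card * deriv (series ψ) s := by
  have h1 := summable_norm_vm_mul_term hψ hs
  have h2 := (summable_term hψ hs).norm
  rw [vmSeries, series, tsum_mul_tsum_of_summable_norm h1 h2,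
    ← (Equiv.sigmaFiberEquiv fun p : GaussianInt × GaussianInt ↦ p.1 * p.2).tsum_eq,
    Summable.tsum_sigma, deriv_series hψ hs, mul_neg, neg_mul, neg_neg, ← tsum_mul_left]
  · refine tsum_congr fun z ↦ ?_
    have hterm (p : {p : GaussianInt × GaussianInt // p.1 * p.2 = z}) :
        ((vm p.1.1 : ℂ) * term ψ s p.1.1) * term ψ s p.1.2 = (vm p.1.1 : ℂ) * term ψ s z := by
      rw [mul_assoc, ← term_mul, p.2]
    change ∑' p : {p : GaussianInt × GaussianInt // p.1 * p.2 = z},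
      ((vm p.1.1 : ℂ) * term ψ s p.1.1) * term ψ s p.1.2 = _
    simp_rw [hterm]
    rw [tsum_mul_right]
    by_cases hz : z = 0
    · have : term ψ s 0 = 0 := by
        have : s ≠ 0 := by rintro rfl; norm_num at hs
        simp [term, nm_zero, this]
      rw [hz, this]; simp
    · rw [← mul_assoc]
      congr 1
      have := (fiberEquivDivisors hz).tsum_eq fun d ↦ (vm d.1 : ℂ)
      rw [Finset.tsum_subtype (divisors z) fun d ↦ (vm d : ℂ)] at this
      refine this.trans ?_
      have := sum_vm_divisors hz
      exact_mod_cast this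
  · have := summable_mul_of_summable_norm h1 h2
    exact (Equiv.sigmaFiberEquiv fun p : GaussianInt × GaussianInt ↦ p.1 * p.2).summable_iff.mpr this

lemma vmSeries_eq_zero_of_isUnit (ψ : GaussianInt →* ℂ) {u : GaussianInt} (hu : IsUnit u)
    (h : ψ u ≠ 1) (s : ℂ) : vmSeries ψ s = 0 := by
  obtain ⟨u, rfl⟩ := hu
  have h1 : vmSeries ψ s = ψ u * vmSeries ψ s := by
    conv_lhs => rw [vmSeries, ← (Units.mulLeft u).tsum_eq]
    rw [vmSeries, ← tsum_mul_left]
    refine tsum_congr fun z ↦ ?_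
    have hassoc : Associated (u * z) z := associated_unit_mul_left _ _ u.isUnit
    rw [Units.mulLeft_apply, term, term, nm_eq_of_associated hassoc, vm_eq_of_associated hassoc,
      map_mul]
    ring
  have h2 : (1 - ψ u) * vmSeries ψ s = 0 := by linear_combination h1
  exact (mul_eq_zero.mp h2).resolve_left (sub_ne_zero.mpr h.symm)

lemma exists_series_ne_zero {ψ : GaussianInt → ℂ} (hψ : ∀ z, ‖ψ z‖ ≤ 1)
    (hu : ∀ u, IsUnit u → ψ u = 1) : ∃ s : ℂ, 1 < s.re ∧ series ψ s ≠ 0 := by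
  classical
  have hlim : Tendsto (fun σ : ℝ ↦ series ψ σ) atTop
      (𝓝 (∑' z : GaussianInt, if z ∈ divisors 1 then (1 : ℂ) else 0)) := by
    refine tendsto_tsum_of_dominated_convergence (summable_nm_rpow one_lt_two) (fun z ↦ ?_) ?_
    · by_cases hz : IsUnit z
      · rw [if_pos (mem_divisors_one.mpr hz)]
        refine tendsto_const_nhds.congr fun σ ↦ ?_
        rw [term, hu z hz, nm_eq_one_iff.mpr hz]; simp
      · rw [if_neg (mt mem_divisors_one.mp hz)]
        refine squeeze_zero_norm' (a := fun σ : ℝ ↦ nm z ^ (-σ)) ?_ ?_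
        · filter_upwards [eventually_gt_atTop 0] with σ hσ
          simpa using norm_term_le hψ (s := (σ : ℂ)) (by simpa using hσ) z
        · by_cases h0 : z = 0
          · refine tendsto_const_nhds.congr' ?_
            filter_upwards [eventually_gt_atTop 0] with σ hσ
            rw [h0, nm_zero, Real.zero_rpow (by linarith)]
          · have h1 : 1 < nm z :=
              lt_of_le_of_ne (one_le_nm h0) fun h ↦ hz (nm_eq_one_iff.mp h.symm)
            have := tendsto_rpow_atTop_of_base_lt_one (nm z)⁻¹
              (by have := inv_pos.mpr (nm_pos h0); linarith) (inv_lt_one_of_one_lt₀ h1)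
            refine this.congr fun σ ↦ ?_
            rw [Real.inv_rpow (nm_nonneg z), Real.rpow_neg (nm_nonneg z)]
    · filter_upwards [eventually_ge_atTop 2] with σ hσ z
      refine (norm_term_le hψ (s := (σ : ℂ)) (by simp; linarith) z).trans ?_
      by_cases h0 : z = 0
      · simp [h0, nm_zero, Real.zero_rpow (show -σ ≠ 0 by linarith)]
      · exact Real.rpow_le_rpow_of_exponent_le (one_le_nm h0) (by simpa using hσ)
  rw [tsum_eq_sum (s := divisors 1) (fun z hz ↦ if_neg hz), Finset.sum_ite_mem, Finset.inter_self,
    Finset.sum_const, nsmul_eq_mul, mul_one] at hlim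
  have hne : ((divisors 1).card : ℂ) ≠ 0 := by
    rw [Nat.cast_ne_zero]
    exact Finset.card_ne_zero_of_mem (mem_divisors_one.mpr isUnit_one)
  obtain ⟨σ, hσ, h1⟩ := ((hlim.eventually_ne hne).and (eventually_gt_atTop 1)).exists
  exact ⟨σ, by simpa using h1, hσ⟩

lemma frequently_re_gt_one (s₀ : ℂ) (h : s₀.re = 1) : ∃ᶠ s in 𝓝 s₀, 1 < s.re := by
  have : Tendsto (fun n : ℕ ↦ s₀ + ((1 / ((n : ℝ) + 1) : ℝ) : ℂ)) atTop (𝓝 s₀) := by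
    have h1 : Tendsto (fun n : ℕ ↦ ((1 / ((n : ℝ) + 1) : ℝ) : ℂ)) atTop (𝓝 ((0 : ℝ) : ℂ)) :=
      (continuous_ofReal.tendsto 0).comp tendsto_one_div_add_atTop_nhds_zero_nat
    simpa using h1.const_add s₀
  refine this.frequently (Frequently.of_forall fun n ↦ ?_)
  rw [add_re, ofReal_re, h]
  have : (0 : ℝ) < 1 / ((n : ℝ) + 1) := by positivity
  linarith

lemma frequently_series_ne_zero {ψ : GaussianInt → ℂ} (hψ : ∀ z, ‖ψ z‖ ≤ 1)
    (hu : ∀ u, IsUnit u → ψ u = 1) {s₀ : ℂ} (hs₀ : s₀.re = 1) :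
    ¬ ∀ᶠ s in 𝓝 s₀, 1 < s.re → series ψ s = 0 := by
  intro h
  obtain ⟨s₁, h1, hne⟩ := exists_series_ne_zero hψ hu
  obtain ⟨s₂, hs2, h2⟩ := (h.eventually_nhds.and_frequently (frequently_re_gt_one s₀ hs₀)).exists
  have han : AnalyticOnNhd ℂ (series ψ) {s | 1 < s.re} :=
    (differentiableOn_series hψ).analyticOnNhd (isOpen_re_gt 1)
  have hpre : IsPreconnected {s : ℂ | 1 < s.re} := (convex_halfSpace_re_gt 1).isPreconnected
  refine hne (han.eqOn_zero_of_preconnected_of_eventuallyEq_zero hpre h2 ?_ h1)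
  filter_upwards [hs2, (isOpen_re_gt 1).mem_nhds h2] with s hs hs'
  exact hs hs'

/-- Near a point of the line `re s = 1`, the weighted Dirichlet series has a simple pole with
residue an integral multiple of the number of units, bounded by the order of the pole of the
Dirichlet series. -/
theorem exists_vmSeries_eq (ψ : GaussianInt →* ℂ) (hψ : ∀ z, ‖ψ z‖ ≤ 1) {s₀ : ℂ}
    (hs₀ : s₀.re = 1) {n : ℕ} (hn : PoleOrderLE n (series ψ) s₀) :
    ∃ e : ℤ, e ≤ n ∧ ∃ g : ℂ → ℂ, ContinuousAt g s₀ ∧ ∀ᶠ s in 𝓝 s₀, 1 < s.re →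
      vmSeries ψ s = (divisors 1).card * (e / (s - s₀) + g s) := by
  by_cases hu : ∀ u, IsUnit u → ψ u = 1
  swap
  · push Not at hu
    obtain ⟨u, hu, hne⟩ := hu
    refine ⟨0, by positivity, 0, continuousAt_const, .of_forall fun s _ ↦ ?_⟩
    simp [vmSeries_eq_zero_of_isUnit ψ hu hne]
  obtain ⟨G, hG, he⟩ := hn
  have hG0 : ¬ ∀ᶠ s in 𝓝 s₀, G s = 0 := by
    intro h
    apply frequently_series_ne_zero hψ hu hs₀
    filter_upwards [h, he] with s h1 h2 hs
    have h3 := h2 hs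
    rw [h1, mul_eq_zero] at h3
    refine h3.resolve_left (pow_ne_zero _ (sub_ne_zero.mpr ?_))
    rintro rfl
    linarith
  obtain ⟨N, g, hg, hg0, hgG⟩ := hG.exists_eventuallyEq_pow_smul_nonzero_iff.mpr hG0
  refine ⟨n - N, by simp, fun s ↦ -logDeriv g s, ?_, ?_⟩
  · exact (hg.deriv.div hg hg0).continuousAt.neg
  have hloc : ∀ᶠ s in 𝓝 s₀, 1 < s.re → (s - s₀) ^ n * series ψ s = (s - s₀) ^ N * g s := by
    filter_upwards [he, hgG] with s h1 h2 hs
    rw [h1 hs, h2, smul_eq_mul]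
  filter_upwards [hloc.eventually_nhds, hg.continuousAt.eventually_ne hg0,
    hg.eventually_analyticAt] with s h1 hgs hga hs
  have hss : s - s₀ ≠ 0 := by rw [sub_ne_zero]; rintro rfl; linarith
  have hmem := (isOpen_re_gt 1).mem_nhds hs
  have heq : (fun s ↦ (s - s₀) ^ n * series ψ s) =ᶠ[𝓝 s] fun s ↦ (s - s₀) ^ N * g s := by
    filter_upwards [h1, hmem] with w hw hw'
    exact hw hw'
  have hL0 : series ψ s ≠ 0 := by
    intro h0
    have := heq.eq_of_nhds
    rw [h0, mul_zero] at this
    exact mul_ne_zero (pow_ne_zero N hss) hgs this.symm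
  have hd : DifferentiableAt ℂ (fun w : ℂ ↦ w - s₀) s := by fun_prop
  have hpow (k : ℕ) : logDeriv (fun w : ℂ ↦ (w - s₀) ^ k) s = k / (s - s₀) := by
    rw [logDeriv_fun_pow hd, logDeriv_apply]
    simp [div_eq_mul_inv]
  have hlog : logDeriv (fun s ↦ (s - s₀) ^ n * series ψ s) s =
      logDeriv (fun s ↦ (s - s₀) ^ N * g s) s := by
    rw [logDeriv_apply, logDeriv_apply, heq.deriv_eq, heq.eq_of_nhds]
  have hLd : DifferentiableAt ℂ (series ψ) s :=
    (differentiableOn_series hψ).differentiableAt hmem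
  rw [logDeriv_mul (f := fun w ↦ (w - s₀) ^ n) s (pow_ne_zero n hss) hL0 (by fun_prop) hLd,
    logDeriv_mul (f := fun w ↦ (w - s₀) ^ N) s (pow_ne_zero N hss) hgs (by fun_prop) hga.differentiableAt, hpow, hpow] at hlog
  have hmain := vmSeries_mul_series ψ hψ hs
  have hF : vmSeries ψ s = -(divisors 1).card * logDeriv (series ψ) s := by
    rw [logDeriv_apply, ← mul_div_assoc, ← hmain, mul_div_cancel_right₀ _ hL0]
  rw [hF]
  push_cast
  rw [sub_div]
  linear_combination -((divisors 1).card : ℂ) * hlog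

lemma prime_of_norm_eq {z : GaussianInt} {p : ℕ} (hp : p.Prime) (hz : z.norm = p) : Prime z := by
  refine Irreducible.prime ⟨fun h ↦ ?_, fun a b hab ↦ ?_⟩
  · rw [← nm_eq_one_iff, nm, hz] at h
    exact hp.one_lt.ne' (by exact_mod_cast h)
  · have hpi : Prime (p : ℤ) := Nat.prime_iff_prime_int.mp hp
    rw [hab, Zsqrtd.norm_mul] at hz
    rw [Zsqrtd.isUnit_iff_norm_isUnit, Zsqrtd.isUnit_iff_norm_isUnit]
    exact hpi.irreducible.isUnit_or_isUnit hz.symm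

lemma vm_eq_of_norm_prime {z : GaussianInt} {p : ℕ} (hp : p.Prime) (hz : z.norm = p) :
    vm z = Real.log p := by
  rw [vm_eq (prime_of_norm_eq hp hz) (j := 0) (by simp), nm, hz, Int.cast_natCast]

open ArithmeticFunction in
lemma exists_lower_bound_vm (q : ℕ) [NeZero q] (h4 : 4 ∣ q) : ∃ C : ℝ, ∀ x ∈ Set.Ioc (1 : ℝ) 2,
    (q.totient : ℝ)⁻¹ / (x - 1) - C ≤
      ∑' z : GaussianInt, {z | ((z.norm : ℤ) : ZMod q) = 1}.indicator
        (fun z ↦ vm z * nm z ^ (-x)) z := by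
  obtain ⟨C, hC⟩ := vonMangoldt.LSeries_residueClass_lower_bound (q := q) (a := 1) isUnit_one
  set S : Set ℕ := {p | p.Prime ∧ (p : ZMod q) = 1} with hS
  have hz (p : S) : ∃ z : GaussianInt, z.norm = ((p : ℕ) : ℤ) := by
    obtain ⟨p, hp, hp1⟩ := p
    have := Fact.mk hp
    have h1 : p % 4 = 1 := by
      have h2 : ((p : ℕ) : ZMod q) = ((1 : ℕ) : ZMod q) := by simpa using hp1
      exact ((ZMod.natCast_eq_natCast_iff _ _ _).mp h2).of_dvd h4
    obtain ⟨a, b, hab⟩ := Nat.Prime.sq_add_sq (p := p) (by omega)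
    refine ⟨⟨a, b⟩, ?_⟩
    rw [Zsqrtd.norm_def]
    change (a : ℤ) * a - -1 * b * b = (p : ℤ)
    rw [← hab]; push_cast; ring
  choose f hf using hz
  have hinj : Function.Injective f := fun a b h ↦ Subtype.ext (by
    have := hf a; rw [h, hf b] at this; exact_mod_cast this.symm)
  set C' : ℝ := ∑' n : ℕ, (if n.Prime then 0 else vonMangoldt.residueClass (1 : ZMod q) n) / n
  refine ⟨C + C', fun x hx ↦ ?_⟩
  have hx1 := hx.1
  set rc := vonMangoldt.residueClass (1 : ZMod q) with hrc
  have hrc0 : ∀ n, 0 ≤ rc n := vonMangoldt.residueClass_nonneg (q := q) 1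
  have hsum : Summable fun n : ℕ ↦ rc n / (n : ℝ) ^ x :=
    LSeries.summable_real_of_abscissaOfAbsConv_lt <|
      (vonMangoldt.abscissaOfAbsConv_residueClass_le_one (q := q) 1).trans_lt <| by
        exact_mod_cast hx1
  have hnn (n : ℕ) : 0 ≤ (n : ℝ) ^ x := Real.rpow_nonneg n.cast_nonneg _
  have hsum1 : Summable fun n : ℕ ↦ (if n.Prime then rc n else 0) / (n : ℝ) ^ x := by
    refine Summable.of_nonneg_of_le (fun n ↦ ?_) (fun n ↦ ?_) hsum
    · exact div_nonneg (by split_ifs; exacts [hrc0 n, le_rfl]) (hnn n)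
    · exact div_le_div_of_nonneg_right (by split_ifs; exacts [le_rfl, hrc0 n]) (hnn n)
  have hsum2 : Summable fun n : ℕ ↦ (if n.Prime then 0 else rc n) / (n : ℝ) ^ x := by
    refine Summable.of_nonneg_of_le (fun n ↦ ?_) (fun n ↦ ?_) hsum
    · exact div_nonneg (by split_ifs; exacts [le_rfl, hrc0 n]) (hnn n)
    · exact div_le_div_of_nonneg_right (by split_ifs; exacts [hrc0 n, le_rfl]) (hnn n)
  have hle2 : ∑' n : ℕ, (if n.Prime then 0 else rc n) / (n : ℝ) ^ x ≤ C' := by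
    refine Summable.tsum_le_tsum (fun n ↦ ?_) hsum2
      (vonMangoldt.summable_residueClass_non_primes_div (q := q) 1)
    rcases n.eq_zero_or_pos with rfl | hn
    · simp [hrc]
    · refine div_le_div_of_nonneg_left (by split_ifs; exacts [le_rfl, hrc0 n]) (by positivity) ?_
      conv_lhs => rw [← Real.rpow_one (n : ℝ)]
      exact Real.rpow_le_rpow_of_exponent_le (by exact_mod_cast hn) hx1.le
  have hsplit : ∑' n : ℕ, rc n / (n : ℝ) ^ x =
      ∑' n : ℕ, (if n.Prime then rc n else 0) / (n : ℝ) ^ x +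
      ∑' n : ℕ, (if n.Prime then 0 else rc n) / (n : ℝ) ^ x := by
    rw [← hsum1.tsum_add hsum2]
    refine tsum_congr fun n ↦ ?_
    split_ifs <;> simp
  have hsub : ∑' n : ℕ, (if n.Prime then rc n else 0) / (n : ℝ) ^ x =
      ∑' p : S, (if (p : ℕ).Prime then rc p else 0) / ((p : ℕ) : ℝ) ^ x := by
    refine (tsum_subtype_eq_of_support_subset
      (f := fun n : ℕ ↦ (if n.Prime then rc n else 0) / (n : ℝ) ^ x) (s := S) ?_).symm
    intro n hn
    by_contra hcon
    apply hn
    by_cases hp : n.Prime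
    · have : rc n = 0 := Set.indicator_of_notMem
        (s := {n : ℕ | (n : ZMod q) = 1}) (a := n) (fun h ↦ hcon ⟨hp, h⟩) _
      simp [this]
    · simp [hp]
  have hle1 : ∑' p : S, (if (p : ℕ).Prime then rc p else 0) / ((p : ℕ) : ℝ) ^ x ≤
      ∑' z : GaussianInt, {z | ((z.norm : ℤ) : ZMod q) = 1}.indicator
        (fun z ↦ vm z * nm z ^ (-x)) z := by
    refine Summable.tsum_le_tsum_of_inj f hinj (fun z _ ↦ ?_) (fun p ↦ ?_)
      (hsum1.subtype S) ((summable_vm_mul_nm_rpow hx1).indicator _)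
    · exact Set.indicator_nonneg
        (fun z _ ↦ mul_nonneg (vm_nonneg z) (Real.rpow_nonneg (nm_nonneg z) _)) z
    · rw [if_pos p.2.1, Set.indicator_of_mem (by
        rw [Set.mem_ofPred_eq, hf p]; simpa using p.2.2), vm_eq_of_norm_prime p.2.1 (hf p), nm, hf p,
        Int.cast_natCast, Real.rpow_neg (Nat.cast_nonneg _), ← div_eq_mul_inv]
      refine div_le_div_of_nonneg_right ?_ (hnn p)
      exact (vonMangoldt.residueClass_le (q := q) 1 p).trans
        (vonMangoldt_apply_prime p.2.1).le
  have := hC hx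
  linarith

/-- On `1 < re s` near `s₀`, the function has a simple pole whose residue is `e` times the number
of units. -/
def HasResidue (F : ℂ → ℂ) (s₀ : ℂ) (e : ℤ) : Prop :=
  ∃ g : ℂ → ℂ, ContinuousAt g s₀ ∧ ∀ᶠ s in 𝓝 s₀, 1 < s.re →
      F s = (divisors 1).card * (e / (s - s₀) + g s)

lemma card_divisors_one_pos : 0 < (divisors 1).card :=
  Finset.card_pos.mpr ⟨1, mem_divisors_one.mpr isUnit_one⟩

lemma HasResidue.tendsto {F : ℂ → ℂ} {t : ℝ} {e : ℤ} (h : HasResidue F (1 + t * I) e) :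
    Tendsto (fun σ : ℝ ↦ σ * (F (1 + σ + t * I)).re) (𝓝[>] 0) (𝓝 ((divisors 1).card * e)) := by
  obtain ⟨g, hg, he⟩ := h
  have hcont : Tendsto (fun σ : ℝ ↦ (1 + σ + t * I : ℂ)) (𝓝[>] 0) (𝓝 (1 + t * I)) := by
    have : Continuous fun σ : ℝ ↦ (1 + σ + t * I : ℂ) := by fun_prop
    simpa using this.continuousWithinAt.tendsto (s := Set.Ioi 0) (x := 0)
  have hσ : Tendsto (fun σ : ℝ ↦ (σ : ℂ)) (𝓝[>] 0) (𝓝 0) := by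
    simpa using continuous_ofReal.continuousWithinAt.tendsto (s := Set.Ioi 0) (x := 0)
  have h1 : Tendsto (fun σ : ℝ ↦ ((divisors 1).card : ℂ) * (e + σ * g (1 + σ + t * I))) (𝓝[>] 0)
      (𝓝 ((divisors 1).card * (e + 0 * g (1 + t * I)))) :=
    ((hσ.mul (hg.tendsto.comp hcont)).const_add _).const_mul _
  have h2 := (continuous_re.tendsto _).comp h1
  have h3 : (((divisors 1).card : ℂ) * (e + 0 * g (1 + t * I))).re = (divisors 1).card * e := by
    rw [zero_mul, add_zero]
    norm_cast
  rw [h3] at h2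
  refine h2.congr' ?_
  filter_upwards [hcont.eventually he, self_mem_nhdsWithin] with σ h4 (hσ0 : 0 < σ)
  have h5 := h4 (by simpa using hσ0)
  have hσc : (σ : ℂ) ≠ 0 := by exact_mod_cast hσ0.ne'
  rw [Function.comp_apply, ← re_ofReal_mul, h5]
  congr 1
  rw [show (1 + σ + t * I - (1 + t * I) : ℂ) = σ by ring]
  field_simp

lemma hasSum_re_vmSeries {ψ : GaussianInt → ℂ} (hψ : ∀ z, ‖ψ z‖ ≤ 1) {σ : ℝ} (hσ : 0 < σ)
    (t : ℝ) : HasSum (fun z ↦ vm z * nm z ^ (-(1 + σ)) * (ψ z * (nm z : ℂ) ^ (-(t * I))).re)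
      (vmSeries ψ (1 + σ + t * I)).re := by
  have h := hasSum_re (summable_norm_vm_mul_term hψ (s := 1 + σ + t * I)
    (by simpa using hσ)).of_norm.hasSum
  refine h.congr_fun fun z ↦ ?_
  by_cases hz : z = 0
  · simp [hz, vm_zero]
  · have hz' : (nm z : ℂ) ≠ 0 := by exact_mod_cast (nm_pos hz).ne'
    rw [term, show (-(1 + σ + t * I) : ℂ) = ((-(1 + σ) : ℝ) : ℂ) + -(t * I) by push_cast; ring,
      cpow_add _ _ hz', ← ofReal_cpow (nm_nonneg z), mul_assoc (vm z), ← re_ofReal_mul,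
      ← re_ofReal_mul]
    congr 1
    ring

lemma residue_nonneg {ψ₀ ψ₁ ψ₂ : GaussianInt → ℂ} (h₀ : ∀ z, ‖ψ₀ z‖ ≤ 1) (h₁ : ∀ z, ‖ψ₁ z‖ ≤ 1)
    (h₂ : ∀ z, ‖ψ₂ z‖ ≤ 1) (h : ∀ z ≠ 0, (ψ₀ z = 0 ∧ ψ₁ z = 0 ∧ ψ₂ z = 0) ∨
      (ψ₀ z = 1 ∧ ‖ψ₁ z‖ = 1 ∧ ψ₂ z = ψ₁ z ^ 2)) {t : ℝ} {e₀ e₁ e₂ : ℤ}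
    (r₀ : HasResidue (vmSeries ψ₀) (1 + (0 : ℝ) * I) e₀)
    (r₁ : HasResidue (vmSeries ψ₁) (1 + t * I) e₁)
    (r₂ : HasResidue (vmSeries ψ₂) (1 + (2 * t : ℝ) * I) e₂) : 0 ≤ 3 * e₀ + 4 * e₁ + e₂ := by
  have hlim := ((r₀.tendsto.const_mul 3).add (r₁.tendsto.const_mul 4)).add r₂.tendsto
  have hge := ge_of_tendsto (b := 0) hlim (by
    filter_upwards [self_mem_nhdsWithin] with σ (hσ : 0 < σ)
    have hs := ((hasSum_re_vmSeries h₀ hσ 0).mul_left 3).add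
      ((hasSum_re_vmSeries h₁ hσ t).mul_left 4) |>.add (hasSum_re_vmSeries h₂ hσ (2 * t))
    have := hs.nonneg fun z ↦ ?_
    · nlinarith
    · by_cases hz : z = 0
      · simp [hz, vm_zero]
      have hz' : (nm z : ℂ) ≠ 0 := by exact_mod_cast (nm_pos hz).ne'
      rcases h z hz with ⟨a, b, c⟩ | ⟨a, b, c⟩
      · simp [a, b, c]
      · set x : ℂ := ψ₁ z * (nm z : ℂ) ^ (-(t * I)) with hx
        have hx1 : ‖x‖ = 1 := by
          rw [hx, norm_mul, b, norm_cpow_eq_rpow_re_of_pos (nm_pos hz)]; simp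
        have h2 : ψ₂ z * (nm z : ℂ) ^ (-((2 * t : ℝ) * I)) = x ^ 2 := by
          rw [hx, c, mul_pow, ← cpow_nat_mul]
          congr 2; push_cast; ring
        rw [h2, a]
        have h3 : x.re ^ 2 + x.im ^ 2 = 1 := by
          have := Complex.normSq_eq_norm_sq x
          rw [hx1, normSq_apply] at this
          nlinarith
        have h4 : (x ^ 2).re = 2 * x.re ^ 2 - 1 := by
          rw [sq, mul_re]; nlinarith
        have hp : 0 ≤ vm z * nm z ^ (-(1 + σ)) :=
          mul_nonneg (vm_nonneg z) (Real.rpow_nonneg (nm_nonneg z) _)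
        rw [h4]
        simp only [ofReal_zero, zero_mul, neg_zero, cpow_zero, mul_one, one_re]
        nlinarith [mul_nonneg hp (sq_nonneg (1 + x.re))])
  have hc : (0 : ℝ) < (divisors 1).card := by exact_mod_cast card_divisors_one_pos
  have h5 : (0 : ℝ) ≤ (divisors 1).card * (3 * e₀ + 4 * e₁ + e₂) := by linarith
  have h6 := nonneg_of_mul_nonneg_right h5 hc
  exact_mod_cast h6

lemma residue_pos {ψ₀ ψ₁ : GaussianInt → ℂ} (h₀ : ∀ z, ‖ψ₀ z‖ ≤ 1) (h₁ : ∀ z, ‖ψ₁ z‖ ≤ 1)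
    (h : ∀ z, 0 ≤ (ψ₀ z + ψ₁ z).re) {q : ℕ} [NeZero q] (h4 : 4 ∣ q)
    (hq : ∀ z : GaussianInt, ((z.norm : ℤ) : ZMod q) = 1 → ψ₀ z + ψ₁ z = 2) {e₀ e₁ : ℤ}
    (r₀ : HasResidue (vmSeries ψ₀) (1 + (0 : ℝ) * I) e₀)
    (r₁ : HasResidue (vmSeries ψ₁) (1 + (0 : ℝ) * I) e₁) : 0 < e₀ + e₁ := by
  obtain ⟨C, hC⟩ := exists_lower_bound_vm q h4
  have hlim := r₀.tendsto.add r₁.tendsto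
  have hlim2 : Tendsto (fun σ : ℝ ↦ (q.totient : ℝ)⁻¹ - C * σ) (𝓝[>] 0) (𝓝 (q.totient : ℝ)⁻¹) := by
    have : Continuous fun σ : ℝ ↦ (q.totient : ℝ)⁻¹ - C * σ := by fun_prop
    simpa using this.continuousWithinAt.tendsto (s := Set.Ioi 0) (x := 0)
  have hle := le_of_tendsto_of_tendsto hlim2 hlim (by
    filter_upwards [Ioo_mem_nhdsGT (zero_lt_one' ℝ)] with σ ⟨hσ, hσ1⟩
    have hs := (hasSum_re_vmSeries h₀ hσ 0).add (hasSum_re_vmSeries h₁ hσ 0)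
    have h5 := hC (1 + σ) ⟨by linarith, by linarith⟩
    have h6 : ∑' z : GaussianInt, {z | ((z.norm : ℤ) : ZMod q) = 1}.indicator
        (fun z ↦ vm z * nm z ^ (-(1 + σ))) z ≤ _ :=
      ((summable_vm_mul_nm_rpow (by linarith)).indicator _).tsum_le_tsum (fun z ↦ ?_) hs.summable
    · rw [hs.tsum_eq] at h6
      rw [add_sub_cancel_left] at h5
      have h7 := mul_le_mul_of_nonneg_left (h5.trans h6) hσ.le
      calc (q.totient : ℝ)⁻¹ - C * σ = σ * ((q.totient : ℝ)⁻¹ / σ - C) := by field_simp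
        _ ≤ _ := h7
        _ = _ := by ring
    · have hp : 0 ≤ vm z * nm z ^ (-(1 + σ)) :=
        mul_nonneg (vm_nonneg z) (Real.rpow_nonneg (nm_nonneg z) _)
      simp only [ofReal_zero, zero_mul, neg_zero, cpow_zero, mul_one]
      rw [← mul_add, ← add_re]
      by_cases hz : ((z.norm : ℤ) : ZMod q) = 1
      · rw [Set.indicator_of_mem (by exact hz), hq z hz, re_ofNat]
        linarith
      · rw [Set.indicator_of_notMem (by exact hz)]
        exact mul_nonneg hp (h z))
  have htot : (0 : ℝ) < (q.totient : ℝ)⁻¹ := inv_pos.mpr (mod_cast q.totient.pos_of_neZero)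
  have hc : (0 : ℝ) < (divisors 1).card := by exact_mod_cast card_divisors_one_pos
  have h5 : (0 : ℝ) < (divisors 1).card * (e₀ + e₁) := by linarith
  have h6 := pos_of_mul_pos_right h5 hc.le
  exact_mod_cast h6

/-- The Hecke `L`-functions attached to the two embeddings into `ZMod k` have no zero on the line
`re s = 1`. -/
theorem hasResidue_vmSeries_hecke {k : ℕ} [NeZero k] {ι : ZMod k} (hι : ι * ι = -1) (hk : Odd k)
    (χ : DirichletCharacter ℂ k) (m : ℤ) (t : ℝ) :
    HasResidue (vmSeries (hecke hι χ m)) (1 + t * I) (if χ = 1 ∧ m = 0 ∧ t = 0 then 1 else 0) := by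
  have key (χ : DirichletCharacter ℂ k) (m : ℤ) (t : ℝ) :
      ∃ e : ℤ, e ≤ (if χ = 1 ∧ m = 0 ∧ t = 0 then 1 else 0) ∧
        HasResidue (vmSeries (hecke hι χ m)) (1 + t * I) e := by
    simpa [HasResidue] using exists_vmSeries_eq _ (norm_hecke_le hι χ m) (by simp)
      (poleOrderLE_series_hecke hι hk χ m t)
  have hquad (χ : DirichletCharacter ℂ k) (hχ : χ ^ 2 = 1) (z : GaussianInt) :
      hecke hι χ 0 z = χ ((z.norm : ℤ) : ZMod k) := by
    have hinv : χ⁻¹ = χ := inv_eq_of_mul_eq_one_left (by rw [← sq, hχ])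
    rw [hecke_apply, hinv, phaseHom_zero_apply, mul_one, ← map_mul]
    congr 1
    rw [Zsqrtd.norm_def]
    push_cast
    linear_combination -(z.im : ZMod k) ^ 2 * hι
  have hpos (χ : DirichletCharacter ℂ k) (hχ : χ ^ 2 = 1) {e₀ e₁ : ℤ}
      (r₀ : HasResidue (vmSeries (hecke hι 1 0)) (1 + (0 : ℝ) * I) e₀)
      (r₁ : HasResidue (vmSeries (hecke hι χ 0)) (1 + (0 : ℝ) * I) e₁) : 0 < e₀ + e₁ := by
    have : NeZero (4 * k) := ⟨by simpa using NeZero.ne k⟩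
    refine residue_pos (q := 4 * k) (norm_hecke_le hι 1 0) (norm_hecke_le hι χ 0) (fun z ↦ ?_)
      (dvd_mul_right 4 k) (fun z hz ↦ ?_) r₀ r₁
    · rw [hquad 1 (one_pow 2), hquad χ hχ]
      by_cases hu : IsUnit ((z.norm : ℤ) : ZMod k)
      · rw [MulChar.one_apply hu]
        have h1 : -1 ≤ (χ ((z.norm : ℤ) : ZMod k)).re :=
          (abs_le.mp ((abs_re_le_norm _).trans (χ.norm_le_one _))).1
        simp only [add_re, one_re]
        linarith
      · rw [MulChar.map_nonunit _ hu, MulChar.map_nonunit _ hu]; simp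
    · have h1 : ((z.norm : ℤ) : ZMod k) = 1 := by
        have := congrArg (ZMod.castHom (dvd_mul_left k 4) (ZMod k)) hz
        simpa only [map_intCast, map_one] using this
      rw [hquad 1 (one_pow 2), hquad χ hχ, h1, map_one, map_one]
      norm_num
  obtain ⟨e₀, hle₀, r₀⟩ := key 1 0 0
  obtain ⟨e, hle, r⟩ := key χ m t
  rw [if_pos ⟨rfl, rfl, rfl⟩] at hle₀
  have he₀ : e₀ = 1 := by
    have := hpos 1 (one_pow 2) r₀ r₀
    omega
  suffices he : e = if χ = 1 ∧ m = 0 ∧ t = 0 then 1 else 0 by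
    rw [← he]; exact r
  split_ifs at hle ⊢ with h
  · obtain ⟨rfl, rfl, rfl⟩ := h
    have := hpos 1 (one_pow 2) r r
    omega
  · by_cases h2 : χ ^ 2 = 1 ∧ 2 * m = 0 ∧ 2 * t = 0
    · obtain ⟨hχ, hm, ht⟩ := h2
      obtain rfl : m = 0 := by omega
      obtain rfl : t = 0 := by linarith
      have := hpos χ hχ r₀ r
      omega
    · obtain ⟨e₂, hle₂, r₂⟩ := key (χ ^ 2) (2 * m) (2 * t)
      rw [if_neg h2] at hle₂
      have := residue_nonneg (norm_hecke_le hι 1 0) (norm_hecke_le hι χ m)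
        (norm_hecke_le hι (χ ^ 2) (2 * m)) (fun z hz ↦ ?_) r₀ r r₂
      · omega
      · by_cases hu : IsUnit ((z.re : ZMod k) + z.im * ι) ∧ IsUnit ((z.re : ZMod k) + z.im * -ι)
        · right
          refine ⟨?_, ?_, ?_⟩
          · rw [hecke_apply, phaseHom_zero_apply, inv_one, MulChar.one_apply hu.1,
              MulChar.one_apply hu.2]
            simp
          · rw [hecke_apply, norm_mul, norm_mul, norm_phaseHom hz]
            obtain ⟨⟨a, ha⟩, ⟨b, hb⟩⟩ := hu
            rw [← ha, ← hb, DirichletCharacter.unit_norm_eq_one, DirichletCharacter.unit_norm_eq_one]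
            simp
          · have hphase : phaseHom (2 * m) z = phaseHom m z ^ 2 := by
              simp only [phaseHom, MonoidHom.coe_mk, OneHom.coe_mk]
              rw [mul_comm, zpow_mul]
              norm_cast
            rw [hecke_apply, hecke_apply, ← inv_pow, MulChar.pow_apply' _ two_ne_zero,
              MulChar.pow_apply' _ two_ne_zero, hphase, mul_pow, mul_pow]
        · left
          simp only [hecke_apply]
          rw [not_and_or] at hu
          rcases hu with hu | hu <;>
            exact ⟨by simp only [MulChar.map_nonunit _ hu, mul_zero, zero_mul],
              by simp only [MulChar.map_nonunit _ hu, mul_zero, zero_mul],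
              by simp only [MulChar.map_nonunit _ hu, mul_zero, zero_mul]⟩

lemma HasResidue.exists_bound_near {F : ℂ → ℂ} {P : Prop} [Decidable P] {t₀ : ℝ}
    (h : HasResidue F (1 + t₀ * I) (if P ∧ t₀ = 0 then 1 else 0)) :
    ∃ B δ : ℝ, 0 < δ ∧ ∀ σ t : ℝ, 0 < σ → σ < δ → |t - t₀| < δ →
      ‖F (1 + σ + t * I) - (divisors 1).card * (if P then 1 else 0) / (σ + t * I)‖ ≤ B := by
  obtain ⟨g, hg, he⟩ := h
  -- after subtracting the polar part, the function agrees with a locally bounded one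
  obtain ⟨G, hG, heG⟩ : ∃ G : ℂ → ℂ, ContinuousAt G (1 + t₀ * I) ∧ ∀ᶠ s in 𝓝 (1 + t₀ * I),
      1 < s.re → F s - (divisors 1).card * (if P then 1 else 0) / (s - 1) = G s := by
    by_cases hP : P
    · by_cases ht : t₀ = 0
      · refine ⟨fun s ↦ (divisors 1).card * g s, hg.const_mul _, ?_⟩
        filter_upwards [he] with s hs h1
        rw [hs h1, if_pos ⟨hP, ht⟩, if_pos hP, ht]
        push_cast
        rw [zero_mul, add_zero]
        ring
      · refine ⟨fun s ↦ (divisors 1).card * g s - (divisors 1).card / (s - 1),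
          (hg.const_mul _).sub (continuousAt_const.div (by fun_prop) ?_), ?_⟩
        · simpa using ht
        · filter_upwards [he] with s hs h1
          rw [hs h1, if_neg (by tauto), if_pos hP]
          simp
    · refine ⟨fun s ↦ (divisors 1).card * g s, hg.const_mul _, ?_⟩
      filter_upwards [he] with s hs h1
      rw [hs h1, if_neg (by tauto), if_neg hP]
      simp
  have hb : ∀ᶠ s in 𝓝 (1 + t₀ * I : ℂ), ‖G s‖ < ‖G (1 + t₀ * I)‖ + 1 :=
    hG.norm.eventually_lt_const (lt_add_one _)
  obtain ⟨ε, hε, hball⟩ := Metric.eventually_nhds_iff.mp (heG.and hb)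
  refine ⟨‖G (1 + t₀ * I)‖ + 1, ε / 2, half_pos hε, fun σ t hσ hσε ht ↦ ?_⟩
  have hdist : dist (1 + σ + t * I : ℂ) (1 + t₀ * I) < ε := by
    rw [dist_eq_norm, show (1 + σ + t * I - (1 + t₀ * I) : ℂ) = (σ : ℂ) + ((t - t₀ : ℝ) : ℂ) * I by
      push_cast; ring]
    refine (norm_add_le _ _).trans_lt ?_
    rw [norm_mul, norm_I, mul_one, norm_real, norm_real, Real.norm_of_nonneg hσ.le, Real.norm_eq_abs]
    linarith
  obtain ⟨h1, h2⟩ := hball hdist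
  have h3 := h1 (by simpa using hσ)
  rw [show (1 + σ + t * I - 1 : ℂ) = σ + t * I by ring] at h3
  rw [h3]
  exact h2.le

/-- Subtracting the polar part leaves a function that is bounded on bounded pieces of the strip. -/
lemma exists_bound_of_hasResidue {F : ℂ → ℂ} {P : Prop} [Decidable P]
    (h : ∀ t : ℝ, HasResidue F (1 + t * I) (if P ∧ t = 0 then 1 else 0))
    (hF : ∀ δ > 0, ∃ C, ∀ σ t : ℝ, δ ≤ σ → ‖F (1 + σ + t * I)‖ ≤ C) (T : ℝ) :
    ∃ B : ℝ, ∀ σ t : ℝ, 0 < σ → |t| ≤ T →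
      ‖F (1 + σ + t * I) - (divisors 1).card * (if P then 1 else 0) / (σ + t * I)‖ ≤ B := by
  obtain ⟨B, δ, hδ, hB⟩ : ∃ B δ : ℝ, 0 < δ ∧ ∀ t ∈ Set.Icc (-T) T, ∀ σ : ℝ, 0 < σ → σ < δ →
      ‖F (1 + σ + t * I) - (divisors 1).card * (if P then 1 else 0) / (σ + t * I)‖ ≤ B := by
    refine (isCompact_Icc (a := -T) (b := T)).induction_on (p := fun S ↦ ∃ B δ : ℝ, 0 < δ ∧ ∀ t ∈ S, ∀ σ : ℝ, 0 < σ →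
      σ < δ → ‖F (1 + σ + t * I) - (divisors 1).card * (if P then 1 else 0) / (σ + t * I)‖ ≤ B)
      ⟨0, 1, one_pos, by simp⟩ ?_ ?_ ?_
    · rintro S S' hS ⟨B, δ, hδ, hB⟩
      exact ⟨B, δ, hδ, fun t ht ↦ hB t (hS ht)⟩
    · rintro S S' ⟨B, δ, hδ, hB⟩ ⟨B', δ', hδ', hB'⟩
      refine ⟨max B B', min δ δ', lt_min hδ hδ', fun t ht σ hσ hσδ ↦ ?_⟩
      rcases ht with ht | ht
      · exact (hB t ht σ hσ (hσδ.trans_le (min_le_left _ _))).trans (le_max_left _ _)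
      · exact (hB' t ht σ hσ (hσδ.trans_le (min_le_right _ _))).trans (le_max_right _ _)
    · intro t₀ _
      obtain ⟨B, δ, hδ, hB⟩ := (h t₀).exists_bound_near
      exact ⟨Metric.ball t₀ δ, mem_nhdsWithin_of_mem_nhds (Metric.ball_mem_nhds t₀ hδ), B, δ, hδ,
        fun t ht σ hσ hσδ ↦ hB σ t hσ hσδ (by simpa [Real.dist_eq] using ht)⟩
  obtain ⟨C, hC⟩ := hF δ hδ
  refine ⟨max B (C + (divisors 1).card / δ), fun σ t hσ ht ↦ ?_⟩
  rcases lt_or_ge σ δ with hσδ | hσδ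
  · exact (hB t (abs_le.mp ht) σ hσ hσδ).trans (le_max_left _ _)
  · refine le_trans ((norm_sub_le _ _).trans (add_le_add (hC σ t hσδ) ?_)) (le_max_right _ _)
    rw [norm_div, norm_mul, Complex.norm_natCast]
    have h1 : δ ≤ ‖(σ + t * I : ℂ)‖ := hσδ.trans (by simpa using re_le_norm (σ + t * I : ℂ))
    have h2 : ‖(if P then 1 else 0 : ℂ)‖ ≤ 1 := by split_ifs <;> simp
    gcongr
    exact mul_le_of_le_one_right (Nat.cast_nonneg _) h2

lemma norm_vmSeries_le {ψ : GaussianInt → ℂ} (hψ : ∀ z, ‖ψ z‖ ≤ 1) {δ σ : ℝ} (hδ : 0 < δ)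
    (hσ : δ ≤ σ) (t : ℝ) :
    ‖vmSeries ψ (1 + σ + t * I)‖ ≤ ∑' z, vm z * nm z ^ (-(1 + δ)) := by
  refine tsum_of_norm_bounded (summable_vm_mul_nm_rpow (by linarith)).hasSum fun z ↦ ?_
  by_cases hz : z = 0
  · simp [hz, vm_zero]
  refine (norm_vm_mul_term_le hψ (by simp; linarith) z).trans
    (mul_le_mul_of_nonneg_left ?_ (vm_nonneg z))
  exact Real.rpow_le_rpow_of_exponent_le (one_le_nm hz) (by simpa using hσ)

section Composite

/-- A nonnegative function is summable on a set covered by a family along which it is summable. -/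
lemma summable_indicator_of_subset_range {α β : Type*} {f : β → ℝ} {g : α → β} {S : Set β}
    (hS : S ⊆ Set.range g) (h : Summable (f ∘ g)) : Summable (S.indicator f) := by
  rw [← summable_subtype_iff_indicator]
  choose r hr using fun x : S ↦ hS x.2
  have hinj : Function.Injective r := fun x y hxy ↦ Subtype.ext (by rw [← hr x, ← hr y, hxy])
  refine (h.comp_injective hinj).congr fun x ↦ ?_
  simp [hr]

/-- A Gaussian prime of composite norm is associated to a natural number. -/
lemma exists_associated_natCast_of_prime {π : GaussianInt} (hπ : Prime π)
    (hn : ¬ π.norm.natAbs.Prime) : ∃ r : ℕ, Associated (r : GaussianInt) π := by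
  have hN : π.norm.natAbs ≠ 0 := by simpa [Zsqrtd.norm_eq_zero] using hπ.ne_zero
  have hdvd : π ∣ ((π.norm.natAbs : ℕ) : GaussianInt) := by
    refine ⟨star π, ?_⟩
    rw [← Zsqrtd.norm_eq_mul_conj]
    have : ((π.norm.natAbs : ℕ) : ℤ) = π.norm := Int.natAbs_of_nonneg (GaussianInt.norm_nonneg π)
    rw [← this, Int.cast_natCast, Int.natAbs_natCast]
  rw [← Nat.prod_primeFactorsList hN, Nat.cast_list_prod, hπ.dvd_prod_iff] at hdvd
  obtain ⟨a, ha, c, hc⟩ := hdvd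
  obtain ⟨r, hr, rfl⟩ := List.mem_map.mp ha
  have hrp := Nat.prime_of_mem_primeFactorsList hr
  have hnorm : π.norm.natAbs * c.norm.natAbs = r ^ 2 := by
    rw [← Int.natAbs_mul, ← Zsqrtd.norm_mul, ← hc, Zsqrtd.norm_natCast, Int.natAbs_mul, sq]
    rfl
  refine ⟨r, ?_⟩
  rw [hc]
  have hcu : IsUnit c := by
    rw [← Zsqrtd.norm_eq_one_iff]
    obtain ⟨i, hi, h⟩ := (Nat.dvd_prime_pow hrp).mp (Dvd.intro _ hnorm)
    have h1 : π.norm.natAbs ≠ 1 := fun h1 ↦ hπ.not_isUnit (Zsqrtd.norm_eq_one_iff.mp h1)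
    interval_cases i
    · simp at h; exact absurd h h1
    · rw [pow_one] at h; exact absurd (h ▸ hrp) hn
    · rw [h] at hnorm
      exact Nat.eq_of_mul_eq_mul_left (pow_pos hrp.pos 2) (by rw [hnorm, mul_one])
  exact (associated_mul_unit_right π c hcu).symm

lemma summable_vm_div_nm_of_not_prime :
    Summable ({z : GaussianInt | ¬ z.norm.natAbs.Prime}.indicator fun z ↦ vm z * (nm z)⁻¹) := by
  have hunit : Summable fun _ : divisors 1 ↦ (1 : ℝ) := Summable.of_finite
  have hs1 : Summable fun x : divisors 1 × ℕ ↦ (nm (x.1 * x.2)) ^ (-(3 / 4) : ℝ) := by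
    refine (hunit.mul_of_nonneg (Real.summable_nat_rpow (p := -(3 / 2)) |>.mpr (by norm_num))
      (fun _ ↦ zero_le_one) (fun _ ↦ by positivity)).congr fun x ↦ ?_
    rw [nm_mul, nm_eq_one_iff.mpr (mem_divisors_one.mp x.1.2), nm_natCast, one_mul, one_mul,
      ← Real.rpow_natCast, ← Real.rpow_mul (Nat.cast_nonneg _)]
    norm_num
  have hs2 : Summable fun x : divisors 1 × (GaussianInt × GaussianInt) ↦
      (nm (x.1 * (x.2.1 ^ 2 * x.2.2 ^ 3))) ^ (-(3 / 4) : ℝ) := by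
    refine (hunit.mul_of_nonneg ((summable_nm_rpow (σ := 3 / 2) (by norm_num)).mul_of_nonneg
      (summable_nm_rpow (σ := 9 / 4) (by norm_num)) (fun _ ↦ ?_) fun _ ↦ ?_)
      (fun _ ↦ zero_le_one) fun _ ↦ ?_).congr fun x ↦ ?_
    · exact Real.rpow_nonneg (nm_nonneg _) _
    · exact Real.rpow_nonneg (nm_nonneg _) _
    · exact mul_nonneg (Real.rpow_nonneg (nm_nonneg _) _) (Real.rpow_nonneg (nm_nonneg _) _)
    · rw [nm_mul, nm_eq_one_iff.mpr (mem_divisors_one.mp x.1.2), nm_mul, nm_pow, nm_pow, one_mul,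
        one_mul, Real.mul_rpow (pow_nonneg (nm_nonneg _) _) (pow_nonneg (nm_nonneg _) _),
        ← Real.rpow_natCast, ← Real.rpow_natCast, ← Real.rpow_mul (nm_nonneg _),
        ← Real.rpow_mul (nm_nonneg _)]
      norm_num
  have h1 := summable_indicator_of_subset_range (f := fun z ↦ nm z ^ (-(3 / 4) : ℝ))
    (g := fun x : divisors 1 × ℕ ↦ (x.1 * x.2 : GaussianInt)) subset_rfl hs1
  have h2 := summable_indicator_of_subset_range (f := fun z ↦ nm z ^ (-(3 / 4) : ℝ))
    (g := fun x : divisors 1 × (GaussianInt × GaussianInt) ↦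
      (x.1 * (x.2.1 ^ 2 * x.2.2 ^ 3) : GaussianInt)) subset_rfl hs2
  refine Summable.of_nonneg_of_le (fun z ↦ ?_) (fun z ↦ ?_) ((h1.add h2).mul_left 4)
  · exact Set.indicator_nonneg (fun z _ ↦ mul_nonneg (vm_nonneg z) (inv_nonneg.mpr (nm_nonneg z))) z
  have hnn : ∀ S : Set GaussianInt, 0 ≤ S.indicator (fun z ↦ nm z ^ (-(3 / 4) : ℝ)) z := fun S ↦
    Set.indicator_nonneg (fun z _ ↦ Real.rpow_nonneg (nm_nonneg z) _) z
  by_cases hz : ¬ z.norm.natAbs.Prime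
  swap
  · rw [Set.indicator_of_notMem hz]
    exact mul_nonneg (by norm_num) (add_nonneg (hnn _) (hnn _))
  rw [Set.indicator_of_mem (by exact hz)]
  by_cases hv : vm z = 0
  · rw [hv, zero_mul]
    exact mul_nonneg (by norm_num) (add_nonneg (hnn _) (hnn _))
  have hz0 := ne_zero_of_vm_ne_zero hv
  have hle : vm z * (nm z)⁻¹ ≤ 4 * nm z ^ (-(3 / 4) : ℝ) := by
    have h3 := (vm_le_log z).trans (Real.log_le_rpow_div (nm_nonneg z) (ε := 1 / 4) (by norm_num))
    have h4 : (nm z)⁻¹ = nm z ^ (-1 : ℝ) := (Real.rpow_neg_one _).symm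
    calc vm z * (nm z)⁻¹ ≤ nm z ^ (1 / 4 : ℝ) / (1 / 4) * (nm z)⁻¹ :=
          mul_le_mul_of_nonneg_right h3 (inv_nonneg.mpr (nm_nonneg z))
      _ = 4 * (nm z ^ (1 / 4 : ℝ) * nm z ^ (-1 : ℝ)) := by rw [h4]; ring
      _ = _ := by rw [← Real.rpow_add (nm_pos hz0)]; norm_num
  refine hle.trans (mul_le_mul_of_nonneg_left ?_ (by norm_num))
  obtain ⟨π, hπ, j, hj⟩ := exists_of_vm_ne_zero hv
  have hunit_of {a : GaussianInt} (ha : Associated a z) : ∃ u ∈ divisors 1, u * a = z := by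
    obtain ⟨u, hu⟩ := ha
    exact ⟨u, mem_divisors_one.mpr u.isUnit, by rw [mul_comm, hu]⟩
  have hmem : z ∈ Set.range (fun x : divisors 1 × ℕ ↦ (x.1 * x.2 : GaussianInt)) ∨
      z ∈ Set.range (fun x : divisors 1 × (GaussianInt × GaussianInt) ↦
        (x.1 * (x.2.1 ^ 2 * x.2.2 ^ 3) : GaussianInt)) := by
    obtain ⟨i, b, hib⟩ | hj0 : (∃ i b, j + 1 = 2 * i + 3 * b) ∨ j = 0 := by
      rcases Nat.even_or_odd' j with ⟨c, hc | hc⟩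
      · rcases Nat.eq_zero_or_pos c with h | h
        · right; omega
        · left; exact ⟨c - 1, 1, by omega⟩
      · left; exact ⟨c + 1, 0, by omega⟩
    · right
      obtain ⟨u, hu, hz⟩ := hunit_of hj
      exact ⟨⟨⟨u, hu⟩, π ^ i, π ^ b⟩, by
        rw [← hz, hib, pow_add, pow_mul', pow_mul']⟩
    · left
      rw [hj0, zero_add, pow_one] at hj
      have hπz : Prime z := hj.prime hπ
      obtain ⟨r, hr⟩ := exists_associated_natCast_of_prime hπz hz
      obtain ⟨u, hu, hz⟩ := hunit_of hr
      exact ⟨⟨⟨u, hu⟩, r⟩, hz⟩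
  rcases hmem with h | h
  · rw [Set.indicator_of_mem h]
    exact le_add_of_nonneg_right (hnn _)
  · rw [Set.indicator_of_mem h]
    exact le_add_of_nonneg_left (hnn _)

end Composite

lemma sum_hecke {k : ℕ} [NeZero k] {ι : ZMod k} (hι : ι * ι = -1) (m : ℤ) (z : GaussianInt)
    [Decidable (((z.re : ZMod k) + z.im * ι = z.re + z.im * -ι) ∧
      IsUnit ((z.re : ZMod k) + z.im * ι))] :
    ∑ χ : DirichletCharacter ℂ k, hecke hι χ m z =
      if ((z.re : ZMod k) + z.im * ι = z.re + z.im * -ι) ∧ IsUnit ((z.re : ZMod k) + z.im * ι)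
      then k.totient * phaseHom m z else 0 := by
  simp_rw [hecke_apply, ← Finset.sum_mul]
  by_cases hu : IsUnit ((z.re : ZMod k) + z.im * -ι)
  · have h := DirichletCharacter.sum_char_inv_mul_char_eq ℂ hu ((z.re : ZMod k) + z.im * ι)
    have h' : ∑ χ : DirichletCharacter ℂ k, χ (z.re + z.im * ι) * χ⁻¹ (z.re + z.im * -ι) =
        if (z.re : ZMod k) + z.im * -ι = z.re + z.im * ι then (k.totient : ℂ) else 0 := by
      rw [← h]
      refine Finset.sum_congr rfl fun χ _ ↦ ?_
      obtain ⟨u, hu⟩ := hu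
      rw [mul_comm, MulChar.inv_apply, ← hu, Ring.inverse_unit, ZMod.inv_coe_unit]
    rw [h']
    by_cases he : (z.re : ZMod k) + z.im * -ι = z.re + z.im * ι
    · rw [if_pos he, if_pos ⟨he.symm, he ▸ hu⟩]
    · rw [if_neg he, if_neg (fun h ↦ he h.1.symm), zero_mul]
  · have hne : ¬ (((z.re : ZMod k) + z.im * ι = z.re + z.im * -ι) ∧
        IsUnit ((z.re : ZMod k) + z.im * ι)) := fun h ↦ hu (h.1 ▸ h.2)
    rw [if_neg hne, Finset.sum_eq_zero, zero_mul]
    intro χ _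
    rw [MulChar.map_nonunit _ hu, mul_zero]

/-- Von Mangoldt weights supported on Gaussian integers of prime norm whose imaginary part is
killed by `k`, whose twisted generating functions have at most a simple pole at `0`. -/
theorem exists_weights {k : ℕ} [NeZero k] {ι : ZMod k} (hι : ι * ι = -1) (hk : Odd k) :
    ∃ v : GaussianInt → ℝ, (∀ z, 0 ≤ v z) ∧
      (∀ z, v z ≠ 0 → z.norm.natAbs.Prime ∧ (z.re : ZMod k) + z.im * ι = z.re + z.im * -ι) ∧
      (∀ σ > 0, Summable fun z ↦ v z * Real.exp (-(σ * Real.log (nm z)))) ∧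
      ∃ κ > 0, ∀ (m : ℤ) (T : ℝ), ∃ B : ℝ, ∀ σ t : ℝ, 0 < σ → |t| ≤ T →
        ‖∑' z, v z * phase z ^ m * cexp (-((σ + t * I) * Real.log (nm z))) -
          (if m = 0 then κ else 0 : ℝ) / (σ + t * I)‖ ≤ B := by
  classical
  let C (z : GaussianInt) : Prop :=
    ((z.re : ZMod k) + z.im * ι = z.re + z.im * -ι) ∧ IsUnit ((z.re : ZMod k) + z.im * ι)
  let v (z : GaussianInt) : ℝ := if z.norm.natAbs.Prime ∧ C z then vm z * (nm z)⁻¹ else 0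
  have hvnn (z : GaussianInt) : 0 ≤ vm z * (nm z)⁻¹ :=
    mul_nonneg (vm_nonneg z) (inv_nonneg.mpr (nm_nonneg z))
  have hφ : (0 : ℝ) < k.totient := mod_cast k.totient.pos_of_neZero
  have hφ' : (k.totient : ℂ) ≠ 0 := mod_cast hφ.ne'
  refine ⟨v, fun z ↦ ?_, fun z hz ↦ ?_, fun σ hσ ↦ ?_, (divisors 1).card / k.totient,
    div_pos (mod_cast card_divisors_one_pos) hφ, fun m T ↦ ?_⟩
  · dsimp only [v]
    split_ifs
    exacts [hvnn z, le_rfl]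
  · dsimp only [v] at hz
    split_ifs at hz with h
    · exact ⟨h.1, h.2.1⟩
    · exact absurd rfl hz
  · refine Summable.of_nonneg_of_le (fun z ↦ ?_) (fun z ↦ ?_)
      (summable_vm_mul_nm_rpow (σ := 1 + σ) (by linarith))
    · dsimp only [v]
      split_ifs
      · exact mul_nonneg (hvnn z) (Real.exp_nonneg _)
      · rw [zero_mul]
    · dsimp only [v]
      split_ifs
      · by_cases hz : z = 0
        · simp [hz, vm_zero]
        · rw [neg_add, Real.rpow_add (nm_pos hz), Real.rpow_neg_one, ← mul_assoc,
            Real.rpow_def_of_pos (nm_pos hz) (-σ)]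
          refine (congrArg _ (congrArg _ ?_)).le
          ring
      · rw [zero_mul]
        exact mul_nonneg (vm_nonneg z) (Real.rpow_nonneg (nm_nonneg z) _)
  · have hbound (χ : DirichletCharacter ℂ k) : ∃ B : ℝ, ∀ σ t : ℝ, 0 < σ → |t| ≤ T →
        ‖vmSeries (hecke hι χ m) (1 + σ + t * I) -
          (divisors 1).card * (if χ = 1 ∧ m = 0 then 1 else 0) / (σ + t * I)‖ ≤ B := by
      refine exists_bound_of_hasResidue (fun t ↦ ?_) (fun δ hδ ↦ ⟨_, fun σ t hσ ↦
        norm_vmSeries_le (norm_hecke_le hι χ m) hδ hσ t⟩) T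
      simpa only [and_assoc] using hasResidue_vmSeries_hecke hι hk χ m t
    choose B hB using hbound
    let err : GaussianInt → ℝ := {z : GaussianInt | ¬ z.norm.natAbs.Prime}.indicator
      fun z ↦ vm z * (nm z)⁻¹
    refine ⟨(k.totient : ℝ)⁻¹ * ∑ χ, B χ + ∑' z, err z, fun σ t hσ ht ↦ ?_⟩
    let e (z : GaussianInt) : ℂ := phase z ^ m * cexp (-((σ + t * I) * Real.log (nm z)))
    have he (z : GaussianInt) : ‖e z‖ ≤ 1 := by
      have hlog : 0 ≤ Real.log (nm z) := by
        by_cases hz : z = 0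
        · simp [hz, nm_zero]
        · exact Real.log_nonneg (one_le_nm hz)
      rw [norm_mul, Complex.norm_exp]
      refine mul_le_one₀ (norm_phaseHom_le m z) (Real.exp_nonneg _) (Real.exp_le_one_iff.mpr ?_)
      rw [neg_re, re_mul_ofReal]
      simpa using mul_nonneg hσ.le hlog
    let D (z : GaussianInt) : ℂ :=
      if ¬ z.norm.natAbs.Prime ∧ C z then ((vm z * (nm z)⁻¹ : ℝ) : ℂ) * e z else 0
    have hD (z : GaussianInt) : ‖D z‖ ≤ err z := by
      dsimp only [D]
      split_ifs with h
      · dsimp only [err]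
        rw [Set.indicator_of_mem (by exact h.1), norm_mul, norm_real,
          Real.norm_of_nonneg (hvnn z)]
        exact mul_le_of_le_one_right (hvnn z) (he z)
      · rw [norm_zero]
        exact Set.indicator_nonneg (fun z _ ↦ hvnn z) z
    have hDs : Summable D := Summable.of_norm_bounded summable_vm_div_nm_of_not_prime hD
    have hterm (z : GaussianInt) : v z * phase z ^ m * cexp (-((σ + t * I) * Real.log (nm z))) =
        (k.totient : ℂ)⁻¹ * ∑ χ : DirichletCharacter ℂ k,
          (vm z : ℂ) * term (hecke hι χ m) (1 + σ + t * I) z - D z := by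
      by_cases hz : z = 0
      · simp [hz, vm_zero, v, D]
      have hz' : (nm z : ℂ) ≠ 0 := by exact_mod_cast (nm_pos hz).ne'
      have hcpow : (nm z : ℂ) ^ (-(1 + σ + t * I)) =
          ((nm z)⁻¹ : ℝ) * cexp (-((σ + t * I) * Real.log (nm z))) := by
        rw [show -(1 + σ + t * I : ℂ) = -1 + -(σ + t * I) by ring, cpow_add _ _ hz', cpow_neg_one,
          cpow_def_of_ne_zero hz', ← ofReal_log (nm_nonneg z), ofReal_inv]
        congr 2
        ring
      simp only [term, hcpow]
      rw [← Finset.mul_sum, ← Finset.sum_mul, sum_hecke]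
      have hph : phaseHom m z = phase z ^ m := rfl
      by_cases hC : C z
      · rw [if_pos hC, hph]
        have hval : (k.totient : ℂ)⁻¹ * ((vm z : ℂ) * (k.totient * phase z ^ m * (((nm z)⁻¹ : ℝ) *
            cexp (-((σ + t * I) * Real.log (nm z)))))) = ((vm z * (nm z)⁻¹ : ℝ) : ℂ) * e z := by
          rw [ofReal_mul]
          simp only [e]
          field_simp
        rw [hval]
        by_cases hp : z.norm.natAbs.Prime
        · simp only [v, D]
          rw [if_pos ⟨hp, hC⟩, if_neg (fun h ↦ h.1 hp), sub_zero, mul_assoc]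
        · simp only [v, D]
          rw [if_neg (fun h ↦ hp h.1), if_pos ⟨hp, hC⟩, sub_self, ofReal_zero, zero_mul, zero_mul]
      · simp only [v, D]
        rw [if_neg hC, if_neg (fun h ↦ hC h.2), if_neg (fun h ↦ hC h.2), ofReal_zero]
        simp
    have hsum (χ : DirichletCharacter ℂ k) :
        Summable fun z ↦ (vm z : ℂ) * term (hecke hι χ m) (1 + σ + t * I) z :=
      (summable_norm_vm_mul_term (norm_hecke_le hι χ m) (by simpa using hσ)).of_norm
    rw [tsum_congr hterm, (Summable.mul_left _ (summable_sum fun χ _ ↦ hsum χ)).tsum_sub hDs,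
      tsum_mul_left, Summable.tsum_finsetSum fun χ _ ↦ hsum χ]
    have hpole : (((if m = 0 then (divisors 1).card / k.totient else 0 : ℝ)) : ℂ) / (σ + t * I) =
        (k.totient : ℂ)⁻¹ * ∑ χ : DirichletCharacter ℂ k,
          ((divisors 1).card * (if χ = 1 ∧ m = 0 then 1 else 0) / (σ + t * I) : ℂ) := by
      by_cases hm : m = 0
      · simp only [hm, and_true, if_true]
        rw [← Finset.sum_div, ← Finset.mul_sum, Finset.sum_ite_eq' ]
        simp
        ring
      · simp [hm]
    rw [hpole, sub_right_comm, ← mul_sub, ← Finset.sum_sub_distrib]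
    refine (norm_sub_le _ _).trans (add_le_add ?_ ?_)
    · rw [norm_mul, norm_inv, Complex.norm_natCast]
      gcongr
      exact norm_sum_le_of_le _ fun χ _ ↦ hB χ σ t hσ ht
    · exact tsum_of_norm_bounded summable_vm_div_nm_of_not_prime.hasSum hD

end GaussianInt

namespace LaplacePair

open Complex Filter Topology MeasureTheory ComplexConjugate

variable {α : Type*}

/-- The Laplace transform of the measure with mass `v z` at `u z`, twisted by `ω ^ m`. -/
noncomputable def laplace (v u : α → ℝ) (ω : α → ℂ) (m : ℤ) (σ t : ℝ) : ℂ :=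
  ∑' z, v z * ω z ^ m * cexp (-((σ + t * I) * u z))

lemma norm_laplace_term {v u : α → ℝ} {ω : α → ℂ} (hv : ∀ z, 0 ≤ v z)
    (hω : ∀ z, v z ≠ 0 → ‖ω z‖ = 1) (m : ℤ) (σ t : ℝ) (z : α) :
    ‖(v z * ω z ^ m * cexp (-((σ + t * I) * u z)) : ℂ)‖ = v z * Real.exp (-(σ * u z)) := by
  by_cases hz : v z = 0
  · simp [hz]
  · rw [norm_mul, norm_mul, norm_zpow, hω z hz, one_zpow, mul_one, norm_real,
      Real.norm_of_nonneg (hv z), Complex.norm_exp, neg_re, re_mul_ofReal]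
    simp

lemma summable_laplace {v u : α → ℝ} {ω : α → ℂ} (hv : ∀ z, 0 ≤ v z)
    (hω : ∀ z, v z ≠ 0 → ‖ω z‖ = 1) {σ : ℝ}
    (hs : Summable fun z ↦ v z * Real.exp (-(σ * u z))) (m : ℤ) (t : ℝ) :
    Summable fun z ↦ ‖(v z * ω z ^ m * cexp (-((σ + t * I) * u z)) : ℂ)‖ :=
  hs.congr fun z ↦ (norm_laplace_term hv hω m σ t z).symm

lemma continuous_laplace {v u : α → ℝ} {ω : α → ℂ} (hv : ∀ z, 0 ≤ v z)
    (hω : ∀ z, v z ≠ 0 → ‖ω z‖ = 1) {σ : ℝ}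
    (hs : Summable fun z ↦ v z * Real.exp (-(σ * u z))) (m : ℤ) :
    Continuous (laplace v u ω m σ) :=
  continuous_tsum (fun z ↦ by fun_prop) hs fun z t ↦ (norm_laplace_term hv hω m σ t z).le

lemma hasSum_mul_conj {f : α → ℂ} (h : Summable fun z ↦ ‖f z‖) :
    HasSum (fun x : α × α ↦ f x.1 * conj (f x.2)) ((∑' z, f z) * conj (∑' z, f z)) := by
  have h1 := h.of_norm.hasSum
  have h2 : HasSum (fun z ↦ conj (f z)) (conj (∑' z, f z)) := hasSum_conj'.mpr h1
  have h3 : Summable fun z ↦ ‖conj (f z)‖ := by simpa only [RCLike.norm_conj] using h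
  exact HasSum.mul (f := f) (g := fun z ↦ conj (f z)) h1 h2
    (summable_mul_of_summable_norm (f := f) (g := fun z ↦ conj (f z)) h h3)

lemma hasSum_laplace_mul_conj {v u : α → ℝ} {ω : α → ℂ} (hv : ∀ z, 0 ≤ v z)
    (hω : ∀ z, v z ≠ 0 → ‖ω z‖ = 1) {σ : ℝ}
    (hs : Summable fun z ↦ v z * Real.exp (-(σ * u z))) (m : ℤ) (t : ℝ) :
    HasSum (fun x : α × α ↦ ((v x.1 * Real.exp (-(σ * u x.1)) : ℝ) : ℂ) *
        (v x.2 * Real.exp (-(σ * u x.2)) : ℝ) * (ω x.1 * conj (ω x.2)) ^ m *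
        cexp (-(t * (u x.1 - u x.2)) * I))
      (laplace v u ω m σ t * conj (laplace v u ω m σ t)) := by
  refine (hasSum_mul_conj (summable_laplace hv hω hs m t)).congr_fun fun x ↦ ?_
  rw [map_mul, map_mul, conj_ofReal, map_zpow₀, ← exp_conj, mul_zpow]
  have : cexp (-((σ + t * I) * u x.1)) * cexp (conj (-((σ + t * I) * u x.2))) =
      Real.exp (-(σ * u x.1)) * Real.exp (-(σ * u x.2)) * cexp (-(t * (u x.1 - u x.2)) * I) := by
    rw [ofReal_exp, ofReal_exp, ← exp_add, ← exp_add, ← exp_add]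
    congr 1
    simp only [map_neg, map_mul, map_add, conj_ofReal, conj_I]
    push_cast
    ring
  push_cast
  push_cast at this
  linear_combination (-(v x.1 * v x.2 * ω x.1 ^ m * conj (ω x.2) ^ m : ℂ)) * this

/-- The pair sum weighted by a cosine, written through Laplace transforms. -/
noncomputable def pairCos (v u : α → ℝ) (ω : α → ℂ) (ζ : ℂ) (y T : ℝ) (m : ℤ) (σ x : ℝ) : ℂ :=
  conj ζ ^ m * ((cexp (-(T * x * y) * I) *
    (laplace v u ω m σ (-(T * x)) * conj (laplace v u ω m σ (-(T * x)))) +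
    cexp ((T * x * y) * I) * (laplace v u ω m σ (T * x) * conj (laplace v u ω m σ (T * x)))) / 2)

lemma hasSum_pairCos {v u : α → ℝ} {ω : α → ℂ} (hv : ∀ z, 0 ≤ v z)
    (hω : ∀ z, v z ≠ 0 → ‖ω z‖ = 1) {σ : ℝ}
    (hs : Summable fun z ↦ v z * Real.exp (-(σ * u z))) (ζ : ℂ) (y T : ℝ) (m : ℤ) (x : ℝ) :
    HasSum (fun p : α × α ↦ ((v p.1 * Real.exp (-(σ * u p.1)) : ℝ) : ℂ) *
        (v p.2 * Real.exp (-(σ * u p.2)) : ℝ) * (ω p.1 * conj (ω p.2) * conj ζ) ^ m *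
        Real.cos (T * (u p.1 - u p.2 - y) * x))
      (pairCos v u ω ζ y T m σ x) := by
  have h := ((((hasSum_laplace_mul_conj hv hω hs m (-(T * x))).mul_left
    (cexp (-(T * x * y) * I))).add ((hasSum_laplace_mul_conj hv hω hs m (T * x)).mul_left
    (cexp ((T * x * y) * I)))).div_const 2).mul_left (conj ζ ^ m)
  refine h.congr_fun fun p ↦ ?_
  have hcos : (Real.cos (T * (u p.1 - u p.2 - y) * x) : ℂ) =
      (cexp (-(T * x * y) * I) * cexp (-((-(T * x) : ℝ) * (u p.1 - u p.2)) * I) +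
      cexp ((T * x * y) * I) * cexp (-((T * x : ℝ) * (u p.1 - u p.2)) * I)) / 2 := by
    rw [ofReal_cos, Complex.cos, ← exp_add, ← exp_add]
    congr 3 <;> · push_cast; ring
  rw [hcos, mul_zpow _ (conj ζ)]
  ring

lemma continuous_pairCos {v u : α → ℝ} {ω : α → ℂ} (hv : ∀ z, 0 ≤ v z)
    (hω : ∀ z, v z ≠ 0 → ‖ω z‖ = 1) {σ : ℝ}
    (hs : Summable fun z ↦ v z * Real.exp (-(σ * u z))) (ζ : ℂ) (y T : ℝ) (m : ℤ) :
    Continuous (pairCos v u ω ζ y T m σ) := by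
  have h := continuous_laplace hv hω hs m
  have h1 : Continuous fun x : ℝ ↦ laplace v u ω m σ (T * x) := h.comp (by fun_prop)
  have h2 : Continuous fun x : ℝ ↦ laplace v u ω m σ (-(T * x)) := h.comp (by fun_prop)
  unfold pairCos
  fun_prop

lemma hasSum_integral_pairCos [Countable α] {v u : α → ℝ} {ω : α → ℂ} (hv : ∀ z, 0 ≤ v z)
    (hω : ∀ z, v z ≠ 0 → ‖ω z‖ = 1) {σ : ℝ}
    (hs : Summable fun z ↦ v z * Real.exp (-(σ * u z))) {ζ : ℂ} (hζ : ‖ζ‖ = 1) (y T : ℝ) (m : ℤ)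
    {k : ℝ → ℝ} (hk : Continuous k) :
    HasSum (fun p : α × α ↦ ((v p.1 * Real.exp (-(σ * u p.1)) : ℝ) : ℂ) *
        (v p.2 * Real.exp (-(σ * u p.2)) : ℝ) * (ω p.1 * conj (ω p.2) * conj ζ) ^ m *
        (∫ x in (0 : ℝ)..2, k x * Real.cos (T * (u p.1 - u p.2 - y) * x) : ℝ))
      (∫ x in (0 : ℝ)..2, k x * pairCos v u ω ζ y T m σ x) := by
  obtain ⟨M, hM⟩ := isCompact_Icc.exists_bound_of_continuousOn (s := Set.Icc (0 : ℝ) 2)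
    hk.continuousOn
  have hM0 : 0 ≤ M := (_root_.norm_nonneg _).trans (hM 0 (by simp))
  have hw (z : α) : 0 ≤ v z * Real.exp (-(σ * u z)) := mul_nonneg (hv z) (Real.exp_nonneg _)
  have hsum := (hs.mul_of_nonneg hs hw hw).mul_left M
  have h := intervalIntegral.hasSum_integral_of_dominated_convergence (μ := volume) (a := 0) (b := 2)
    (F := fun (p : α × α) (x : ℝ) ↦ (k x : ℂ) * (((v p.1 * Real.exp (-(σ * u p.1)) : ℝ) : ℂ) *
        (v p.2 * Real.exp (-(σ * u p.2)) : ℝ) * (ω p.1 * conj (ω p.2) * conj ζ) ^ m *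
        Real.cos (T * (u p.1 - u p.2 - y) * x)))
    (f := fun x ↦ k x * pairCos v u ω ζ y T m σ x)
    (fun p _ ↦ M * (v p.1 * Real.exp (-(σ * u p.1)) * (v p.2 * Real.exp (-(σ * u p.2)))))
    (fun p ↦ Continuous.aestronglyMeasurable (by fun_prop))
    (fun p ↦ ae_of_all _ fun x hx ↦ ?_) (ae_of_all _ fun x _ ↦ hsum) (by simp)
    (ae_of_all _ fun x _ ↦ (hasSum_pairCos hv hω hs ζ y T m x).mul_left _)
  · refine h.congr_fun fun p ↦ ?_
    rw [← intervalIntegral.integral_ofReal, ← intervalIntegral.integral_const_mul]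
    refine intervalIntegral.integral_congr fun x _ ↦ ?_
    push_cast
    ring
  · rw [Set.uIoc_of_le (by norm_num)] at hx
    by_cases h1 : v p.1 = 0
    · simp [h1]
    by_cases h2 : v p.2 = 0
    · simp [h2]
    rw [norm_mul, norm_mul, norm_mul, norm_mul, norm_zpow, norm_mul, norm_mul, RCLike.norm_conj,
      RCLike.norm_conj, hω _ h1, hω _ h2, hζ, norm_real, norm_real, norm_real, norm_real,
      Real.norm_of_nonneg (hw _), Real.norm_of_nonneg (hw _)]
    refine mul_le_mul (hM x ⟨hx.1.le, hx.2⟩) ?_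
      (mul_nonneg (by simpa using mul_nonneg (hw _) (hw _)) (abs_nonneg _)) hM0
    simp only [mul_one, one_zpow]
    exact mul_le_of_le_one_right (mul_nonneg (hw _) (hw _)) (Real.abs_cos_le_one _)

lemma norm_mul_conj_sub_le {a b : ℂ} {B : ℝ} (h : ‖a - b‖ ≤ B) :
    ‖a * conj a - b * conj b‖ ≤ 2 * B * ‖b‖ + B ^ 2 := by
  have hB : 0 ≤ B := (_root_.norm_nonneg _).trans h
  have ha : ‖a‖ ≤ ‖b‖ + B := by
    calc ‖a‖ = ‖b + (a - b)‖ := by rw [add_sub_cancel]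
      _ ≤ _ := (norm_add_le _ _).trans (by gcongr)
  calc ‖a * conj a - b * conj b‖ = ‖(a - b) * conj a + b * conj (a - b)‖ := by
        rw [map_sub]; congr 1; ring
    _ ≤ ‖a - b‖ * ‖a‖ + ‖b‖ * ‖a - b‖ := by
        refine (norm_add_le _ _).trans ?_
        rw [norm_mul, norm_mul, RCLike.norm_conj, RCLike.norm_conj]
    _ ≤ B * (‖b‖ + B) + ‖b‖ * B := by gcongr
    _ = _ := by ring

lemma norm_pairCos_sub_le {v u : α → ℝ} {ω : α → ℂ} {ζ : ℂ} (hζ : ‖ζ‖ = 1) {y T κ B : ℝ}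
    {m : ℤ} (hκ : m ≠ 0 → κ = 0) {σ x : ℝ}
    (h₁ : ‖laplace v u ω m σ (T * x) - κ / (σ + (T * x : ℝ) * I)‖ ≤ B)
    (h₂ : ‖laplace v u ω m σ (-(T * x)) - κ / (σ + (-(T * x) : ℝ) * I)‖ ≤ B) :
    ‖pairCos v u ω ζ y T m σ x -
      (Real.cos (T * x * y) * (κ ^ 2 / (σ ^ 2 + (T * x) ^ 2)) : ℝ)‖ ≤
      2 * B * (|κ| / √(σ ^ 2 + (T * x) ^ 2)) + B ^ 2 := by
  have hnorm (t : ℝ) : ‖(κ / (σ + t * I) : ℂ)‖ = |κ| / √(σ ^ 2 + t ^ 2) := by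
    rw [norm_div, norm_real, Real.norm_eq_abs, norm_add_mul_I]
  have hconj (t : ℝ) : (κ / (σ + t * I) : ℂ) * conj (κ / (σ + t * I) : ℂ) =
      (κ ^ 2 / (σ ^ 2 + t ^ 2) : ℝ) := by
    rw [mul_conj, normSq_eq_norm_sq, hnorm, div_pow, sq_abs,
      Real.sq_sqrt (add_nonneg (sq_nonneg _) (sq_nonneg _))]
  have e₁ := norm_mul_conj_sub_le h₁
  have e₂ := norm_mul_conj_sub_le h₂
  rw [hconj, hnorm] at e₁ e₂
  rw [neg_sq] at e₂
  set P : ℝ := κ ^ 2 / (σ ^ 2 + (T * x) ^ 2) with hP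
  have hζP : conj ζ ^ m * (P : ℂ) = P := by
    by_cases hm : m = 0
    · simp [hm]
    · simp [hP, hκ hm]
  have hcos : (Real.cos (T * x * y) : ℂ) =
      (cexp (-(T * x * y) * I) + cexp ((T * x * y) * I)) / 2 := by
    rw [ofReal_cos, Complex.cos, add_comm]
    push_cast
    rfl
  have hexp (r : ℝ) : ‖cexp (r * I)‖ = 1 := norm_exp_ofReal_mul_I r
  have hE₁ : ‖cexp ((T * x * y) * I)‖ = 1 := by simpa using hexp (T * x * y)
  have hE₂ : ‖cexp (-(T * x * y) * I)‖ = 1 := by simpa using hexp (-(T * x * y))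
  rw [pairCos, ofReal_mul, hcos, ← hζP]
  set A₁ := laplace v u ω m σ (T * x) * conj (laplace v u ω m σ (T * x))
  set A₂ := laplace v u ω m σ (-(T * x)) * conj (laplace v u ω m σ (-(T * x)))
  have hsplit : conj ζ ^ m * ((cexp (-(T * x * y) * I) * A₂ + cexp ((T * x * y) * I) * A₁) / 2) -
      (cexp (-(T * x * y) * I) + cexp ((T * x * y) * I)) / 2 * (conj ζ ^ m * (P : ℂ)) =
      conj ζ ^ m * ((cexp (-(T * x * y) * I) * (A₂ - P) + cexp ((T * x * y) * I) * (A₁ - P)) / 2) := by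
    ring
  rw [hsplit, norm_mul, norm_zpow, RCLike.norm_conj, hζ, one_zpow, one_mul, norm_div]
  have h3 := norm_add_le (cexp (-(T * x * y) * I) * (A₂ - P)) (cexp ((T * x * y) * I) * (A₁ - P))
  rw [norm_mul, norm_mul, hE₁, hE₂, one_mul, one_mul] at h3
  rw [Complex.norm_ofNat, div_le_iff₀ two_pos]
  linarith

lemma tendsto_integral_poisson {T : ℝ} (hT : 0 < T) :
    Tendsto (fun σ : ℝ ↦ ∫ x in (0 : ℝ)..2, σ / (σ ^ 2 + (T * x) ^ 2)) (𝓝[>] 0)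
      (𝓝 (Real.pi / (2 * T))) := by
  have hint (σ : ℝ) (hσ : 0 < σ) : ∫ x in (0 : ℝ)..2, σ / (σ ^ 2 + (T * x) ^ 2) =
      Real.arctan (2 * T * σ⁻¹) / T := by
    have hpos (x : ℝ) : 0 < σ ^ 2 + (T * x) ^ 2 := by positivity
    rw [intervalIntegral.integral_eq_sub_of_hasDerivAt (f := fun x ↦ Real.arctan (T / σ * x) / T)]
    · rw [mul_zero, Real.arctan_zero, zero_div, sub_zero]
      congr 2
      ring
    · intro x _
      refine ((((hasDerivAt_id x).const_mul (T / σ)).arctan).div_const T).congr_deriv ?_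
      have := (hpos x).ne'
      have h2 : 1 + (T / σ * x) ^ 2 ≠ 0 := by positivity
      simp only [id]
      field_simp
    · exact (continuous_const.div (by fun_prop) fun x ↦ (hpos x).ne').intervalIntegrable _ _
  have h1 : Tendsto (fun σ : ℝ ↦ Real.arctan (2 * T * σ⁻¹) / T) (𝓝[>] 0)
      (𝓝 (Real.pi / 2 / T)) := by
    refine Tendsto.div_const ?_ T
    exact (Real.tendsto_arctan_atTop.mono_right nhdsWithin_le_nhds).comp
      (tendsto_inv_nhdsGT_zero.const_mul_atTop (by positivity))
  rw [div_div] at h1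
  refine h1.congr' ?_
  filter_upwards [self_mem_nhdsWithin] with σ hσ using (hint σ hσ).symm

lemma tendsto_integral_pairCos {v u : α → ℝ} {ω : α → ℂ} (hv : ∀ z, 0 ≤ v z)
    (hω : ∀ z, v z ≠ 0 → ‖ω z‖ = 1)
    (hs : ∀ σ > 0, Summable fun z ↦ v z * Real.exp (-(σ * u z))) {κ B : ℝ} {ζ : ℂ} (hζ : ‖ζ‖ = 1)
    (y : ℝ) {T : ℝ} (hT : 0 < T) {m : ℤ} (hκ : m ≠ 0 → κ = 0)
    (hB : ∀ σ t : ℝ, 0 < σ → |t| ≤ 2 * T → ‖laplace v u ω m σ t - κ / (σ + t * I)‖ ≤ B)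
    {k : ℝ → ℝ} (hk : ContDiff ℝ 1 k) :
    Tendsto (fun σ : ℝ ↦ σ * ∫ x in (0 : ℝ)..2, k x * pairCos v u ω ζ y T m σ x) (𝓝[>] 0)
      (𝓝 ((k 0 * κ ^ 2 * (Real.pi / (2 * T)) : ℝ) : ℂ)) := by
  have hB0 : 0 ≤ B := (_root_.norm_nonneg _).trans (hB 1 0 one_pos (by simpa using hT.le))
  obtain ⟨M, hM⟩ := isCompact_Icc.exists_bound_of_continuousOn (s := Set.Icc (0 : ℝ) 2)
    hk.continuous.continuousOn
  have hM0 : 0 ≤ M := (_root_.norm_nonneg _).trans (hM 0 (by simp))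
  obtain ⟨L, hL⟩ : ∃ L : NNReal,
      LipschitzOnWith L (fun x ↦ k x * Real.cos (T * x * y)) (Set.Icc 0 2) := by
    have h1 : ContDiff ℝ 1 fun x ↦ k x * Real.cos (T * x * y) := by fun_prop
    exact h1.contDiffOn.exists_lipschitzOnWith one_ne_zero (convex_Icc _ _) isCompact_Icc
  have hL' (x : ℝ) (hx : x ∈ Set.Ioc (0 : ℝ) 2) :
      |k x * Real.cos (T * x * y) - k 0| ≤ L * x := by
    have h := hL.dist_le_mul x ⟨hx.1.le, hx.2⟩ 0 (by simp)
    simpa [Real.dist_eq, abs_of_pos hx.1] using h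
  let r (σ x : ℝ) : ℝ := √(σ ^ 2 + (T * x) ^ 2)
  let R (σ x : ℝ) : ℝ := σ * (M * (2 * B * (|κ| / r σ x) + B ^ 2)) + L * x * (κ ^ 2 * (σ / r σ x ^ 2))
  let rem (σ x : ℝ) : ℂ := σ * (k x * pairCos v u ω ζ y T m σ x) -
    (k 0 * κ ^ 2 * (σ / (σ ^ 2 + (T * x) ^ 2)) : ℝ)
  have hr (σ x : ℝ) : r σ x ^ 2 = σ ^ 2 + (T * x) ^ 2 := Real.sq_sqrt (by positivity)
  have hrem (σ : ℝ) (hσ : 0 < σ) (x : ℝ) (hx : x ∈ Set.Ioc (0 : ℝ) 2) : ‖rem σ x‖ ≤ R σ x := by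
    have habs : |T * x| ≤ 2 * T := by
      rw [abs_of_nonneg (mul_nonneg hT.le hx.1.le), mul_comm 2]
      exact mul_le_mul_of_nonneg_left hx.2 hT.le
    have h1 := norm_pairCos_sub_le (y := y) hζ hκ (hB σ _ hσ habs)
      (hB σ _ hσ (by rwa [abs_neg]))
    have hsplit : rem σ x = σ * (k x * (pairCos v u ω ζ y T m σ x -
        (Real.cos (T * x * y) * (κ ^ 2 / (σ ^ 2 + (T * x) ^ 2)) : ℝ))) +
        ((k x * Real.cos (T * x * y) - k 0) * (κ ^ 2 * (σ / (σ ^ 2 + (T * x) ^ 2))) : ℝ) := by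
      simp only [rem]
      push_cast
      ring
    rw [hsplit]
    refine (norm_add_le _ _).trans (add_le_add ?_ ?_)
    · rw [norm_mul, norm_mul, norm_real, norm_real, Real.norm_of_nonneg hσ.le]
      exact mul_le_mul_of_nonneg_left (mul_le_mul (hM x ⟨hx.1.le, hx.2⟩) h1
        (_root_.norm_nonneg _) hM0) hσ.le
    · rw [norm_real, norm_mul, hr]
      have h2 : 0 ≤ κ ^ 2 * (σ / (σ ^ 2 + (T * x) ^ 2)) := by positivity
      rw [Real.norm_of_nonneg h2]
      exact mul_le_mul_of_nonneg_right (hL' x hx) h2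
  have hR (σ : ℝ) (hσ : 0 < σ) (hσ1 : σ < 1) (x : ℝ) (hx : x ∈ Set.Ioc (0 : ℝ) 2) :
      R σ x ≤ M * (2 * B * |κ| + B ^ 2) + L * (κ ^ 2 * T⁻¹) := by
    have hrpos : 0 < r σ x := Real.sqrt_pos.mpr (by positivity)
    have h1 : σ ≤ r σ x := Real.le_sqrt_of_sq_le (by nlinarith [sq_nonneg (T * x)])
    have h2 : T * x ≤ r σ x := Real.le_sqrt_of_sq_le (by nlinarith [sq_nonneg σ])
    have h3 : σ * (2 * B * (|κ| / r σ x) + B ^ 2) ≤ 2 * B * |κ| + B ^ 2 := by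
      have h4 : σ / r σ x ≤ 1 := (div_le_one hrpos).mpr h1
      have h5 : 0 ≤ 2 * B * |κ| := by positivity
      calc σ * (2 * B * (|κ| / r σ x) + B ^ 2) = 2 * B * |κ| * (σ / r σ x) + σ * B ^ 2 := by ring
        _ ≤ 2 * B * |κ| * 1 + 1 * B ^ 2 := by gcongr
        _ = _ := by ring
    have h6 : x * (σ / r σ x ^ 2) ≤ T⁻¹ := by
      rw [mul_div_assoc', div_le_iff₀ (by positivity), inv_mul_eq_div, le_div_iff₀ hT]
      have h7 : 0 ≤ T * x := mul_nonneg hT.le hx.1.le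
      nlinarith [mul_le_mul h2 h1 hσ.le hrpos.le]
    calc R σ x = M * (σ * (2 * B * (|κ| / r σ x) + B ^ 2)) +
          L * (κ ^ 2 * (x * (σ / r σ x ^ 2))) := by simp only [R]; ring
      _ ≤ _ := by gcongr
  have hR0 (x : ℝ) (hx : x ∈ Set.Ioc (0 : ℝ) 2) : Tendsto (fun σ ↦ R σ x) (𝓝[>] 0) (𝓝 0) := by
    have hne : r 0 x ≠ 0 := (Real.sqrt_pos.mpr (by have := mul_pos hT hx.1; positivity)).ne'
    have hrc : ContinuousAt (fun σ ↦ r σ x) 0 := by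
      simp only [r]
      fun_prop
    have hc : ContinuousAt (fun σ ↦ R σ x) 0 := by
      simp only [R]
      refine (continuousAt_id.mul (continuousAt_const.mul ((continuousAt_const.mul
        (continuousAt_const.div hrc hne)).add continuousAt_const))).add (continuousAt_const.mul
        (continuousAt_const.mul (continuousAt_id.div (hrc.pow 2) (pow_ne_zero 2 hne))))
    have := hc.tendsto
    simp only [R, zero_mul, zero_div, mul_zero, add_zero] at this
    exact this.mono_left nhdsWithin_le_nhds
  have hcont (σ : ℝ) (hσ : 0 < σ) : Continuous fun x ↦ (k x : ℂ) * pairCos v u ω ζ y T m σ x :=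
    (continuous_ofReal.comp hk.continuous).mul (continuous_pairCos hv hω (hs σ hσ) ζ y T m)
  have hcont2 (σ : ℝ) (hσ : 0 < σ) :
      Continuous fun x ↦ k 0 * κ ^ 2 * (σ / (σ ^ 2 + (T * x) ^ 2)) :=
    continuous_const.mul (continuous_const.div (by fun_prop) fun x ↦ by positivity)
  have hmain : Tendsto (fun σ ↦ ∫ x in (0 : ℝ)..2, rem σ x) (𝓝[>] 0)
      (𝓝 (∫ _ in (0 : ℝ)..2, (0 : ℂ))) := by
    refine intervalIntegral.tendsto_integral_filter_of_dominated_convergence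
      (fun _ ↦ M * (2 * B * |κ| + B ^ 2) + L * (κ ^ 2 * T⁻¹)) ?_ ?_ (by simp) ?_
    · filter_upwards [self_mem_nhdsWithin] with σ hσ
      exact ((continuous_const.mul (hcont σ hσ)).sub
        (continuous_ofReal.comp (hcont2 σ hσ))).aestronglyMeasurable
    · filter_upwards [Ioo_mem_nhdsGT (zero_lt_one' ℝ)] with σ hσ
      refine ae_of_all _ fun x hx ↦ ?_
      rw [Set.uIoc_of_le (by norm_num)] at hx
      exact (hrem σ hσ.1 x hx).trans (hR σ hσ.1 hσ.2 x hx)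
    · refine ae_of_all _ fun x hx ↦ ?_
      rw [Set.uIoc_of_le (by norm_num)] at hx
      refine squeeze_zero_norm' ?_ (hR0 x hx)
      filter_upwards [self_mem_nhdsWithin] with σ hσ using hrem σ hσ x hx
  rw [intervalIntegral.integral_zero] at hmain
  have hlim := hmain.add ((continuous_ofReal.tendsto _).comp
    ((tendsto_integral_poisson hT).const_mul (k 0 * κ ^ 2)))
  rw [zero_add] at hlim
  refine hlim.congr' ?_
  filter_upwards [self_mem_nhdsWithin] with σ (hσ : 0 < σ)
  simp only [rem, Function.comp_apply]
  have i₁ : IntervalIntegrable (fun x ↦ (σ : ℂ) * (k x * pairCos v u ω ζ y T m σ x)) volume 0 2 :=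
    (continuous_const.mul (hcont σ hσ)).intervalIntegrable _ _
  have i₂ : IntervalIntegrable
      (fun x ↦ ((k 0 * κ ^ 2 * (σ / (σ ^ 2 + (T * x) ^ 2)) : ℝ) : ℂ)) volume 0 2 :=
    (continuous_ofReal.comp (hcont2 σ hσ)).intervalIntegrable _ _
  rw [intervalIntegral.integral_sub i₁ i₂,
    intervalIntegral.integral_const_mul, intervalIntegral.integral_ofReal,
    intervalIntegral.integral_const_mul, sub_add_cancel]

lemma one_add_re_pow {X : ℂ} (hX : ‖X‖ = 1) (n : ℕ) : (((1 + X.re) ^ n : ℝ) : ℂ) =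
    ((2 : ℂ) ^ n)⁻¹ * ∑ j ∈ Finset.range (2 * n + 1), ((2 * n).choose j : ℂ) * X ^ ((j : ℤ) - n) := by
  have hX0 : X ≠ 0 := by rintro rfl; simp at hX
  have h1 : ∑ j ∈ Finset.range (2 * n + 1), ((2 * n).choose j : ℂ) * X ^ ((j : ℤ) - n) =
      (X + 1) ^ (2 * n) * (X ^ n)⁻¹ := by
    rw [add_pow, Finset.sum_mul]
    refine Finset.sum_congr rfl fun j _ ↦ ?_
    rw [zpow_sub₀ hX0, zpow_natCast, zpow_natCast, one_pow]
    ring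
  have h2 : (X.re : ℂ) * (2 * X) = X ^ 2 + 1 := by
    have h3 : X * conj X = 1 := by rw [mul_conj, normSq_eq_norm_sq, hX]; simp
    have h4 : (2 : ℂ) * X.re = X + conj X := by rw [add_conj]; push_cast; ring
    linear_combination X * h4 + h3
  rw [h1, pow_mul, ofReal_pow, eq_inv_mul_iff_mul_eq₀ (pow_ne_zero n two_ne_zero), ← div_eq_mul_inv,
    eq_div_iff (pow_ne_zero _ hX0), ← mul_pow, ← mul_pow]
  congr 1
  push_cast
  linear_combination h2

/-- The pair sum weighted by a cosine transform and a Fejér-type power of the angle. -/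
lemma exists_hasSum_pair_tendsto [Countable α] {v u : α → ℝ} {ω : α → ℂ} (hv : ∀ z, 0 ≤ v z)
    (hω : ∀ z, v z ≠ 0 → ‖ω z‖ = 1)
    (hs : ∀ σ > 0, Summable fun z ↦ v z * Real.exp (-(σ * u z))) {κ : ℝ} {ζ : ℂ} (hζ : ‖ζ‖ = 1)
    (y : ℝ) {T : ℝ} (hT : 0 < T)
    (hB : ∀ (m : ℤ) (T : ℝ), ∃ B : ℝ, ∀ σ t : ℝ, 0 < σ → |t| ≤ T →
      ‖laplace v u ω m σ t - (if m = 0 then κ else 0 : ℝ) / (σ + t * I)‖ ≤ B)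
    {k : ℝ → ℝ} (hk : ContDiff ℝ 1 k) (n : ℕ) :
    ∃ G : ℝ → ℝ, (∀ σ > 0, HasSum (fun p : α × α ↦ v p.1 * Real.exp (-(σ * u p.1)) *
        (v p.2 * Real.exp (-(σ * u p.2))) * (1 + (ω p.1 * conj (ω p.2) * conj ζ).re) ^ n *
        ∫ x in (0 : ℝ)..2, k x * Real.cos (T * (u p.1 - u p.2 - y) * x)) (G σ)) ∧
      Tendsto (fun σ ↦ σ * G σ) (𝓝[>] 0)
        (𝓝 (n.centralBinom / 2 ^ n * (k 0 * κ ^ 2 * (Real.pi / (2 * T))))) := by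
  let J (m : ℤ) (σ : ℝ) : ℂ := ∫ x in (0 : ℝ)..2, k x * pairCos v u ω ζ y T m σ x
  let G (σ : ℝ) : ℂ := ((2 : ℂ) ^ n)⁻¹ *
    ∑ j ∈ Finset.range (2 * n + 1), ((2 * n).choose j : ℂ) * J ((j : ℤ) - n) σ
  refine ⟨fun σ ↦ (G σ).re, fun σ hσ ↦ ?_, ?_⟩
  · have h : HasSum _ (G σ) := (hasSum_sum fun (j : ℕ) _ ↦ (hasSum_integral_pairCos hv hω (hs σ hσ) hζ y T
      ((j : ℤ) - n) hk.continuous).mul_left ((2 * n).choose j : ℂ)).mul_left ((2 : ℂ) ^ n)⁻¹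
    refine (hasSum_re h).congr_fun fun p ↦ ?_
    by_cases h1 : v p.1 = 0
    · simp [h1]
    by_cases h2 : v p.2 = 0
    · simp [h2]
    have hX : ‖ω p.1 * conj (ω p.2) * conj ζ‖ = 1 := by
      rw [norm_mul, norm_mul, RCLike.norm_conj, RCLike.norm_conj, hω _ h1, hω _ h2, hζ]
      norm_num
    rw [← ofReal_re (_ * _)]
    congr 1
    rw [ofReal_mul, ofReal_mul, ofReal_mul, one_add_re_pow hX, Finset.mul_sum, Finset.mul_sum,
      Finset.mul_sum, Finset.sum_mul]
    refine Finset.sum_congr rfl fun j _ ↦ ?_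
    ring
  · have hJ (m : ℤ) : Tendsto (fun σ : ℝ ↦ (σ : ℂ) * J m σ) (𝓝[>] 0)
        (𝓝 (if m = 0 then ((k 0 * κ ^ 2 * (Real.pi / (2 * T)) : ℝ) : ℂ) else 0)) := by
      obtain ⟨B, hB⟩ := hB m (2 * T)
      have := tendsto_integral_pairCos hv hω hs hζ y hT (m := m) (fun h ↦ if_neg h) hB hk
      convert this using 2
      split_ifs <;> simp
    have h1 : Tendsto (fun σ : ℝ ↦ (σ : ℂ) * G σ) (𝓝[>] 0) (𝓝 (((2 : ℂ) ^ n)⁻¹ *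
        ∑ j ∈ Finset.range (2 * n + 1), ((2 * n).choose j : ℂ) * (if (j : ℤ) - n = 0 then
          ((k 0 * κ ^ 2 * (Real.pi / (2 * T)) : ℝ) : ℂ) else 0))) := by
      refine ((tendsto_finsetSum _ fun (j : ℕ) _ ↦ (hJ ((j : ℤ) - n)).const_mul
        ((2 * n).choose j : ℂ)).const_mul ((2 : ℂ) ^ n)⁻¹).congr fun σ ↦ ?_
      simp only [G]
      rw [mul_left_comm, Finset.mul_sum (_ : Finset ℕ) _ (σ : ℂ)]
      congr 1
      exact Finset.sum_congr rfl fun j _ ↦ by ring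
    have h2 := (continuous_re.tendsto _).comp h1
    simp only [Function.comp_def, re_ofReal_mul] at h2
    convert h2 using 2
    rw [Finset.sum_eq_single n]
    · rw [sub_self, if_pos rfl, ← ofReal_re (_ * _), Nat.centralBinom_eq_two_mul_choose]
      congr 1
      push_cast
      ring
    · intro j _ hj
      rw [if_neg (by omega), mul_zero]
    · intro h
      simp at h
      omega

section Kernel

open Real

lemma integral_sin_mul_cos (V : ℝ) : ((π / 2) ^ 2 - V ^ 2) *
    ∫ x in (0 : ℝ)..2, Real.sin (π / 2 * x) * Real.cos (V * x) = π * Real.cos V ^ 2 := by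
  have h := intervalIntegral.integral_eq_sub_of_hasDerivAt (a := 0) (b := 2)
    (f := fun x ↦ π / 2 * Real.cos (π / 2 * x) * Real.cos (V * x) +
      V * Real.sin (π / 2 * x) * Real.sin (V * x))
    (f' := fun x ↦ (V ^ 2 - (π / 2) ^ 2) * (Real.sin (π / 2 * x) * Real.cos (V * x)))
    (fun x _ ↦ ?_) (Continuous.intervalIntegrable (by fun_prop) _ _)
  · rw [intervalIntegral.integral_const_mul] at h
    rw [show π / 2 * 2 = π by ring, mul_comm V 2, Real.cos_two_mul] at h
    simp only [Real.cos_pi, Real.sin_pi, mul_zero, Real.cos_zero, Real.sin_zero] at h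
    linarith
  · have h1 (c : ℝ) : HasDerivAt (fun x ↦ c * x) c x := by
      simpa using (hasDerivAt_id x).const_mul c
    refine ((((h1 (π / 2)).cos.const_mul (π / 2)).mul (h1 V).cos).add
      (((h1 (π / 2)).sin.const_mul V).mul (h1 V).sin)).congr_deriv ?_
    ring

/-- A kernel on `[0, 2]` whose cosine transform is nonnegative. -/
noncomputable def kernel (x : ℝ) : ℝ :=
  ((2 - x) * Real.cos (π / 2 * x) + Real.sin (π / 2 * x) / (π / 2)) / 2

lemma contDiff_kernel : ContDiff ℝ 1 kernel := by
  unfold kernel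
  fun_prop

lemma integral_kernel_mul_cos (V : ℝ) : ((π / 2) ^ 2 - V ^ 2) *
    ∫ x in (0 : ℝ)..2, kernel x * Real.cos (V * x) =
    π / 2 * ∫ x in (0 : ℝ)..2, Real.sin (π / 2 * x) * Real.cos (V * x) := by
  have h := intervalIntegral.integral_eq_sub_of_hasDerivAt (a := 0) (b := 2)
    (f := fun x ↦ -(π / 2 * ((2 - x) * Real.sin (π / 2 * x)) / 2) * Real.cos (V * x) +
      V * kernel x * Real.sin (V * x))
    (f' := fun x ↦ (V ^ 2 - (π / 2) ^ 2) * (kernel x * Real.cos (V * x)) +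
      π / 2 * (Real.sin (π / 2 * x) * Real.cos (V * x)))
    (fun x _ ↦ ?_)
    (Continuous.intervalIntegrable (by have := contDiff_kernel.continuous; fun_prop) _ _)
  · have hc := contDiff_kernel.continuous
    rw [intervalIntegral.integral_add (Continuous.intervalIntegrable (by fun_prop) _ _)
      (Continuous.intervalIntegrable (by fun_prop) _ _), intervalIntegral.integral_const_mul,
      intervalIntegral.integral_const_mul, kernel, show π / 2 * 2 = π by ring] at h
    simp only [Real.sin_pi, mul_zero, Real.sin_zero, sub_self, zero_mul, zero_div, neg_zero, add_zero] at h
    linarith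
  · have h1 (c : ℝ) : HasDerivAt (fun x ↦ c * x) c x := by
      simpa using (hasDerivAt_id x).const_mul c
    have h2 : HasDerivAt (fun x ↦ 2 - x) (-1) x := by simpa using (hasDerivAt_id x).const_sub 2
    have h3 : HasDerivAt kernel (-(π / 2 * ((2 - x) * Real.sin (π / 2 * x)) / 2)) x := by
      refine (((h2.mul (h1 (π / 2)).cos).add ((h1 (π / 2)).sin.div_const (π / 2))).div_const
        2).congr_deriv ?_
      field_simp
      ring
    refine (((((h2.mul (h1 (π / 2)).sin).const_mul (π / 2)).div_const 2).neg.mul (h1 V).cos).add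
      ((h3.const_mul V).mul (h1 V).sin)).congr_deriv ?_
    simp only [Pi.neg_apply, Pi.mul_apply]
    rw [kernel]
    field_simp
    ring

lemma integral_kernel_nonneg (V : ℝ) : 0 ≤ ∫ x in (0 : ℝ)..2, kernel x * Real.cos (V * x) := by
  have hcont : Continuous fun V ↦ ∫ x in (0 : ℝ)..2, kernel x * Real.cos (V * x) := by
    have := contDiff_kernel.continuous
    refine intervalIntegral.continuous_parametric_intervalIntegral_of_continuous' ?_ 0 2
    simp only [Function.uncurry_def]
    fun_prop
  have hdense : Dense ({π / 2, -(π / 2)}ᶜ : Set ℝ) :=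
    (Set.toFinite _).countable.dense_compl ℝ
  have hsub : ({π / 2, -(π / 2)}ᶜ : Set ℝ) ⊆
      {V | 0 ≤ ∫ x in (0 : ℝ)..2, kernel x * Real.cos (V * x)} := by
    intro V hV
    rw [Set.mem_compl_iff, Set.mem_insert_iff, Set.mem_singleton_iff, ← sq_eq_sq_iff_eq_or_eq_neg] at hV
    have h1 : 0 < ((π / 2) ^ 2 - V ^ 2) ^ 2 := by
      have : (π / 2) ^ 2 - V ^ 2 ≠ 0 := fun h ↦ hV (by linarith)
      positivity
    refine nonneg_of_mul_nonneg_right (a := ((π / 2) ^ 2 - V ^ 2) ^ 2) ?_ h1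
    rw [sq, mul_assoc, integral_kernel_mul_cos, mul_left_comm, integral_sin_mul_cos]
    positivity
  exact (isClosed_Ici.preimage hcont).closure_subset_iff.mpr hsub (hdense V)

end Kernel

/-- If the Laplace transforms of the weights `v` along `u`, twisted by powers of `ω`, have at most
a simple pole at `0`, present only for the trivial twist, then the pairs
`(u p - u q, ω p * conj (ω q))` are dense. -/
theorem exists_pair_close [Countable α] {v u : α → ℝ} {ω : α → ℂ} (hv : ∀ z, 0 ≤ v z)
    (hω : ∀ z, v z ≠ 0 → ‖ω z‖ = 1)
    (hs : ∀ σ > 0, Summable fun z ↦ v z * Real.exp (-(σ * u z))) {κ : ℝ} (hκ : 0 < κ)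
    (hB : ∀ (m : ℤ) (T : ℝ), ∃ B : ℝ, ∀ σ t : ℝ, 0 < σ → |t| ≤ T →
      ‖laplace v u ω m σ t - (if m = 0 then κ else 0 : ℝ) / (σ + t * I)‖ ≤ B)
    {ζ : ℂ} (hζ : ‖ζ‖ = 1) (y : ℝ) {η : ℝ} (hη : 0 < η) :
    ∃ p q, v p ≠ 0 ∧ v q ≠ 0 ∧
      (u p - u q - y) ^ 2 + (1 - (ω p * conj (ω q) * conj ζ).re) < η := by
  by_contra! H
  obtain ⟨n, hn⟩ := exists_nat_ge (2 / η)
  set T : ℝ := Real.pi / √η with hTdef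
  have hT : 0 < T := by positivity
  have hT2 : η * T ^ 2 = Real.pi ^ 2 := by
    rw [hTdef, div_pow, Real.sq_sqrt hη.le]
    field_simp
  obtain ⟨G₁, hG₁, hl₁⟩ := exists_hasSum_pair_tendsto hv hω hs hζ y hT hB
    (k := fun x ↦ Real.sin (Real.pi / 2 * x)) (by fun_prop) n
  obtain ⟨G₂, hG₂, hl₂⟩ := exists_hasSum_pair_tendsto hv hω hs hζ y hT hB contDiff_kernel n
  obtain ⟨G₃, hG₃, hl₃⟩ := exists_hasSum_pair_tendsto hv hω hs hζ y hT hB contDiff_kernel (n + 1)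
  have hle (σ : ℝ) (hσ : 0 < σ) : Real.pi / 2 * G₁ σ + (η * T ^ 2 - (Real.pi / 2) ^ 2) * G₂ σ -
      T ^ 2 * (2 * G₂ σ - G₃ σ) ≤ 0 := by
    refine hasSum_le (g := fun _ ↦ (0 : ℝ)) (fun p ↦ ?_)
      ((((hG₁ σ hσ).mul_left _).add ((hG₂ σ hσ).mul_left _)).sub
        ((((hG₂ σ hσ).mul_left 2).sub (hG₃ σ hσ)).mul_left _)) hasSum_zero
    by_cases h1 : v p.1 = 0
    · simp [h1]
    by_cases h2 : v p.2 = 0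
    · simp [h2]
    have hX : ‖ω p.1 * conj (ω p.2) * conj ζ‖ = 1 := by
      rw [norm_mul, norm_mul, RCLike.norm_conj, RCLike.norm_conj, hω _ h1, hω _ h2, hζ]
      norm_num
    have hc := H _ _ h1 h2
    have hc1 := (abs_le.mp ((abs_re_le_norm _).trans hX.le)).1
    set c := (ω p.1 * conj (ω p.2) * conj ζ).re
    have hK := integral_kernel_mul_cos (T * (u p.1 - u p.2 - y))
    have hK0 := integral_kernel_nonneg (T * (u p.1 - u p.2 - y))
    set A := ∫ x in (0 : ℝ)..2, Real.sin (Real.pi / 2 * x) *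
      Real.cos (T * (u p.1 - u p.2 - y) * x)
    set K := ∫ x in (0 : ℝ)..2, kernel x * Real.cos (T * (u p.1 - u p.2 - y) * x)
    set w := v p.1 * Real.exp (-(σ * u p.1)) * (v p.2 * Real.exp (-(σ * u p.2)))
    have hw : 0 ≤ w := mul_nonneg (mul_nonneg (hv _) (Real.exp_nonneg _))
      (mul_nonneg (hv _) (Real.exp_nonneg _))
    have h3 : 0 ≤ w * (1 + c) ^ n * K * (T ^ 2 * ((u p.1 - u p.2 - y) ^ 2 + (1 - c) - η)) :=
      mul_nonneg (mul_nonneg (mul_nonneg hw (pow_nonneg (by linarith) _)) hK0)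
        (mul_nonneg (sq_nonneg T) (by linarith))
    linear_combination h3 - w * (1 + c) ^ n * hK
  have hlim := ((hl₁.const_mul (Real.pi / 2)).add
    (hl₂.const_mul (η * T ^ 2 - (Real.pi / 2) ^ 2))).sub
      (((hl₂.const_mul 2).sub hl₃).const_mul (T ^ 2))
  have hnonpos := le_of_tendsto hlim (b := 0) <| by
    filter_upwards [self_mem_nhdsWithin] with σ (hσ : 0 < σ)
    have := mul_nonpos_of_nonneg_of_nonpos hσ.le (hle σ hσ)
    linarith
  have hk0 : kernel 0 = 1 := by simp [kernel]
  have hs0 : Real.sin (Real.pi / 2 * 0) = 0 := by simp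
  have hC : ((n : ℝ) + 1) * (n + 1).centralBinom = 2 * (2 * n + 1) * n.centralBinom := by
    exact_mod_cast Nat.succ_mul_centralBinom_succ n
  have hC' : ((n + 1).centralBinom : ℝ) = 2 * (2 * n + 1) / (n + 1) * n.centralBinom := by
    field_simp
    linarith
  rw [hk0, hs0, hC', hT2, pow_succ] at hnonpos
  have hpos : 0 < (n.centralBinom : ℝ) / 2 ^ n * (κ ^ 2 * (Real.pi / (2 * T))) := by
    have : (0 : ℝ) < n.centralBinom := by exact_mod_cast n.centralBinom_pos
    positivity
  have hT3 : T ^ 2 / (n + 1) ≤ Real.pi ^ 2 / 2 := by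
    rw [div_le_div_iff₀ (by positivity) two_pos, ← hT2]
    have : 2 ≤ n * η := (div_le_iff₀ hη).mp hn
    nlinarith [sq_nonneg T]
  have h5 : 0 < n.centralBinom / 2 ^ n * (κ ^ 2 * (Real.pi / (2 * T))) *
      (Real.pi ^ 2 - (Real.pi / 2) ^ 2 - T ^ 2 / (n + 1)) := by
    refine mul_pos hpos ?_
    nlinarith [Real.pi_pos]
  refine h5.not_ge (le_of_eq_of_le ?_ hnonpos)
  field_simp
  ring

end LaplacePair

namespace GaussianInt

open Complex Filter Topology ComplexConjugate

lemma dvd_im_of_add_mul_eq {k : ℕ} {ι : ZMod k} (hι : ι * ι = -1) (hk : Odd k) {z : GaussianInt}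
    (h : (z.re : ZMod k) + z.im * ι = z.re + z.im * -ι) : (k : ℤ) ∣ z.im := by
  have h1 : ((2 * z.im : ℤ) : ZMod k) = 0 := by
    push_cast
    linear_combination -ι * h + 2 * (z.im : ZMod k) * hι
  rw [ZMod.intCast_zmod_eq_zero_iff_dvd] at h1
  refine IsCoprime.dvd_of_dvd_mul_left ?_ h1
  have := Nat.isCoprime_iff_coprime.mpr (Nat.coprime_two_right.mpr hk)
  exact_mod_cast this

lemma exp_mul_phase_mul_conj {p q : GaussianInt} (hp : p ≠ 0) (hq : q ≠ 0) :
    (Real.exp ((Real.log (nm p) - Real.log (nm q)) / 2) : ℂ) * (phase p * conj (phase q)) =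
      (p : ℂ) / (q : ℂ) := by
  have hp' : 0 < ‖(p : ℂ)‖ := norm_pos_iff.mpr (toComplex_eq_zero.not.mpr hp)
  have hq' : 0 < ‖(q : ℂ)‖ := norm_pos_iff.mpr (toComplex_eq_zero.not.mpr hq)
  have h1 : conj (phase q) = (phase q)⁻¹ := by
    refine eq_inv_of_mul_eq_one_right ?_
    rw [mul_conj, normSq_eq_norm_sq, norm_phase hq]
    simp
  rw [h1, nm_eq_norm_sq, nm_eq_norm_sq, Real.log_pow, Real.log_pow, ← mul_sub, Nat.cast_ofNat,
    mul_div_cancel_left₀ _ two_ne_zero, Real.exp_sub, Real.exp_log hp', Real.exp_log hq', phase,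
    phase]
  have hp2 : ((‖(p : ℂ)‖ : ℝ) : ℂ) ≠ 0 := ofReal_ne_zero.mpr hp'.ne'
  have hq2 : ((‖(q : ℂ)‖ : ℝ) : ℂ) ≠ 0 := ofReal_ne_zero.mpr hq'.ne'
  push_cast
  have hq3 : (q : ℂ) ≠ 0 := toComplex_eq_zero.not.mpr hq
  field_simp

/-- Quotients of Gaussian integers of prime norm and imaginary part divisible by `k` are dense. -/
theorem dense_prime_quotients {k : ℕ} (hk : Odd k) {ι : ZMod k} (hι : ι * ι = -1) :
    Dense {w : ℂ | ∃ p q : GaussianInt, (p.norm.natAbs.Prime ∧ (k : ℤ) ∣ p.im) ∧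
      (q.norm.natAbs.Prime ∧ (k : ℤ) ∣ q.im) ∧ w = (p : ℂ) / (q : ℂ)} := by
  have : NeZero k := ⟨by rintro rfl; simp at hk⟩
  obtain ⟨v, hv, hsupp, hs, κ, hκ, hB⟩ := exists_weights hι hk
  have : Countable GaussianInt := equivFinTwo.injective.countable
  have h0 (z : GaussianInt) (hz : v z ≠ 0) : z ≠ 0 := by
    rintro rfl
    simpa [Nat.not_prime_zero] using (hsupp _ hz).1
  rw [dense_iff_closure_eq, Set.eq_univ_iff_forall]
  have hdense : Dense ({0}ᶜ : Set ℂ) := dense_compl_singleton 0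
  refine fun w ↦ (isClosed_closure.closure_subset_iff.mpr fun w hw ↦ ?_) (hdense w)
  rw [Set.mem_compl_singleton_iff] at hw
  rw [Metric.mem_closure_iff]
  intro ε hε
  set ζ : ℂ := w / ‖w‖
  have hw' : 0 < ‖w‖ := norm_pos_iff.mpr hw
  have hζ : ‖ζ‖ = 1 := by simp [ζ, hw'.ne']
  have hcont : Continuous fun x : ℝ × ℂ ↦ (Real.exp (x.1 / 2) : ℂ) * x.2 := by fun_prop
  obtain ⟨δ, hδ, hclose⟩ := Metric.continuous_iff.mp hcont (2 * Real.log ‖w‖, ζ) ε hε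
  obtain ⟨p, q, hp, hq, hpq⟩ := LaplacePair.exists_pair_close (u := fun z ↦ Real.log (nm z))
    (ω := phase) hv (fun z hz ↦ norm_phase (h0 z hz)) hs hκ hB hζ (2 * Real.log ‖w‖)
    (η := δ ^ 2 / 2) (by positivity)
  refine ⟨_, ⟨p, q, ⟨(hsupp p hp).1, dvd_im_of_add_mul_eq hι hk (hsupp p hp).2⟩,
    ⟨(hsupp q hq).1, dvd_im_of_add_mul_eq hι hk (hsupp q hq).2⟩, rfl⟩, ?_⟩
  set X := phase p * conj (phase q) with hXdef
  have hX : ‖X‖ = 1 := by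
    rw [norm_mul, RCLike.norm_conj, norm_phase (h0 p hp), norm_phase (h0 q hq), one_mul]
  have hXc : ‖X * conj ζ‖ = 1 := by rw [norm_mul, RCLike.norm_conj, hX, hζ, one_mul]
  have h1 : (X * conj ζ).re ≤ 1 := (re_le_norm _).trans hXc.le
  have h2 : ‖X - ζ‖ ^ 2 = 2 * (1 - (X * conj ζ).re) := by
    rw [← normSq_eq_norm_sq, normSq_sub, normSq_eq_norm_sq, normSq_eq_norm_sq, hX, hζ]
    ring
  have h3 := hclose (Real.log (nm p) - Real.log (nm q), X) (by
    rw [Prod.dist_eq, max_lt_iff, Real.dist_eq, dist_eq_norm]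
    constructor
    · exact abs_lt_of_sq_lt_sq (by nlinarith) hδ.le
    · exact lt_of_pow_lt_pow_left₀ 2 hδ.le (by
        nlinarith [sq_nonneg (Real.log (nm p) - Real.log (nm q) - 2 * Real.log ‖w‖)]))
  simp only [hXdef] at h3
  rw [exp_mul_phase_mul_conj (h0 p hp) (h0 q hq), mul_div_cancel_left₀ _ two_ne_zero,
    Real.exp_log hw', mul_div_cancel₀ _ (ofReal_ne_zero.mpr hw'.ne'), dist_comm] at h3
  exact h3

end GaussianInt

namespace HurwitzPrime

open Filter Topology Quaternion

/-- Quotients of two Hurwitz primes with integer coordinates. -/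
def quotients : Set (Quaternion ℝ) :=
  {x | ∃ p q : Quaternion ℝ, IsHurwitzPrime p ∧ IsHurwitzPrime q ∧
    (∃ x₁ x₂ x₃ x₄ : ℤ, p = ⟨(x₁ : ℝ), x₂, x₃, x₄⟩) ∧
    (∃ x₁ x₂ x₃ x₄ : ℤ, q = ⟨(x₁ : ℝ), x₂, x₃, x₄⟩) ∧ x = p * q⁻¹}

/-- The quaternion with given coordinates. -/
@[simps]
def ofCoords (a b c d : ℝ) : Quaternion ℝ := ⟨a, b, c, d⟩

lemma qNorm_ofCoords (a b c d : ℝ) : qNorm (ofCoords a b c d) = a ^ 2 + b ^ 2 + c ^ 2 + d ^ 2 := rfl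

lemma continuous_ofCoords {X : Type*} [TopologicalSpace X] {a b c d : X → ℝ} (ha : Continuous a)
    (hb : Continuous b) (hc : Continuous c) (hd : Continuous d) :
    Continuous fun x ↦ ofCoords (a x) (b x) (c x) (d x) := by
  have h (x : X) : ofCoords (a x) (b x) (c x) (d x) = a x • ofCoords 1 0 0 0 +
      b x • ofCoords 0 1 0 0 + c x • ofCoords 0 0 1 0 +
      d x • ofCoords 0 0 0 1 := by
    ext <;> simp
  simp only [h]
  fun_prop

/-- A point of a plane spanned by `1` and a rational unit vector is a limit of quotients. -/
lemma ofCoords_mem_closure_of_sq_eq {k : ℕ} (hk : Odd k) (hsq : IsSquare (-1 : ZMod k)) {w₁ w₂ w₃ : ℤ}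
    (hw : w₁ ^ 2 + w₂ ^ 2 + w₃ ^ 2 = (k : ℤ) ^ 2) (A B : ℝ) :
    ofCoords A (B * (w₁ / k)) (B * (w₂ / k)) (B * (w₃ / k)) ∈ closure quotients := by
  obtain ⟨ι, hι⟩ := hsq
  have hk0 : (k : ℝ) ≠ 0 := by
    rintro h
    simp [Nat.cast_eq_zero.mp h] at hk
  have hw' : (w₁ : ℝ) ^ 2 + w₂ ^ 2 + w₃ ^ 2 = k ^ 2 := by exact_mod_cast hw
  let n := ofCoords 0 (w₁ / k) (w₂ / k) (w₃ / k)
  have hn : n * n = -1 := by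
    ext <;> simp [n]
    · field_simp
      linarith
    all_goals ring
  let θ : ℂ →ₐ[ℝ] Quaternion ℝ := Complex.liftAux n hn
  have hθ (z : ℂ) : θ z =
      ofCoords z.re (z.im * (w₁ / k)) (z.im * (w₂ / k)) (z.im * (w₃ / k)) := by
    simp only [θ, Complex.liftAux_apply]
    ext <;> simp [n]
  have hθc : Continuous θ := by
    rw [show (θ : ℂ → Quaternion ℝ) = _ from funext hθ]
    exact continuous_ofCoords (by fun_prop) (by fun_prop) (by fun_prop) (by fun_prop)
  have hθp (p : GaussianInt) : θ p =
      ofCoords p.re (p.im * (w₁ / k)) (p.im * (w₂ / k)) (p.im * (w₃ / k)) := by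
    rw [hθ, ← GaussianInt.intCast_re, ← GaussianInt.intCast_im]
  have hint (p : GaussianInt) (hp : (k : ℤ) ∣ p.im) :
      ∃ x₁ x₂ x₃ x₄ : ℤ, θ p = ⟨(x₁ : ℝ), x₂, x₃, x₄⟩ := by
    obtain ⟨b, hb⟩ := hp
    refine ⟨p.re, b * w₁, b * w₂, b * w₃, ?_⟩
    rw [hθp, hb, ofCoords]
    push_cast
    congr 1 <;> field_simp
  have hprime (p : GaussianInt) (hp : p.norm.natAbs.Prime ∧ (k : ℤ) ∣ p.im) :
      IsHurwitzPrime (θ p) := by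
    refine ⟨Or.inl (hint p hp.2), _, hp.1, ?_⟩
    rw [GaussianInt.natCast_natAbs_norm, Zsqrtd.norm_def, hθp, qNorm_ofCoords]
    push_cast
    field_simp
    linear_combination (p.im : ℝ) ^ 2 * hw'
  have hmem : θ (A + B * Complex.I) ∈ closure quotients := by
    refine closure_mono ?_ (image_closure_subset_closure_image hθc ⟨_,
      GaussianInt.dense_prime_quotients hk hι.symm (A + B * Complex.I), rfl⟩)
    rintro _ ⟨_, ⟨p, q, hp, hq, rfl⟩, rfl⟩
    exact ⟨θ p, θ q, hprime p hp, hprime q hq, hint p hp.2, hint q hq.2, by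
      rw [map_div₀, div_eq_mul_inv]⟩
  rw [hθ] at hmem
  simpa using hmem

/-- The point of the plane spanned by `1` and a stereographically parametrized unit vector. -/
noncomputable def stereo (A B s t : ℝ) : Quaternion ℝ :=
  ofCoords A (B * ((s ^ 2 - 1) / (s ^ 2 + 1)))
    (B * (2 * s / (s ^ 2 + 1) * ((t ^ 2 - 1) / (t ^ 2 + 1))))
    (B * (2 * s / (s ^ 2 + 1) * (2 * t / (t ^ 2 + 1))))

lemma stereo_mem_closure_of_dvd {u v' r d : ℤ} (hu : Odd u) (hd : d ≠ 0) (hv' : v' ≠ 0)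
    (hv : Even v') (huv : IsCoprime u ((r ^ 2 + d ^ 2) * v')) (A B : ℝ) :
    stereo A B (u / ((r ^ 2 + d ^ 2) * v')) (r / d) ∈ closure quotients := by
  have hdR : (d : ℝ) ≠ 0 := by exact_mod_cast hd
  have hvR : (v' : ℝ) ≠ 0 := by exact_mod_cast hv'
  have hh : (0 : ℝ) < r ^ 2 + d ^ 2 := by positivity
  have hk0 : (0 : ℤ) ≤ u ^ 2 + ((r ^ 2 + d ^ 2) * v') ^ 2 := by positivity
  have hodd : Odd (u ^ 2 + ((r ^ 2 + d ^ 2) * v') ^ 2).natAbs :=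
    (hu.pow.add_even ((hv.mul_left _).pow_of_ne_zero two_ne_zero)).natAbs
  have hsq := ZMod.isSquare_neg_one_of_eq_sq_add_sq_of_isCoprime rfl huv
  have hcast : (((u ^ 2 + ((r ^ 2 + d ^ 2) * v') ^ 2).natAbs : ℤ)) =
      u ^ 2 + ((r ^ 2 + d ^ 2) * v') ^ 2 := Int.natAbs_of_nonneg hk0
  have hcastR : (((u ^ 2 + ((r ^ 2 + d ^ 2) * v') ^ 2).natAbs : ℝ)) =
      (u : ℝ) ^ 2 + ((r ^ 2 + d ^ 2) * v') ^ 2 := by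
    rw [← Int.cast_natCast, hcast]
    push_cast
    rfl
  have h := ofCoords_mem_closure_of_sq_eq hodd hsq (w₁ := u ^ 2 - ((r ^ 2 + d ^ 2) * v') ^ 2)
    (w₂ := 2 * u * v' * (r ^ 2 - d ^ 2)) (w₃ := 2 * u * v' * (2 * r * d))
    (by rw [hcast]; ring) A B
  have hk : (0 : ℝ) < (u : ℝ) ^ 2 + ((r ^ 2 + d ^ 2) * v') ^ 2 := by positivity
  have hk' : ((u : ℝ) / ((r ^ 2 + d ^ 2) * v')) ^ 2 + 1 =
      (u ^ 2 + ((r ^ 2 + d ^ 2) * v') ^ 2) / ((r ^ 2 + d ^ 2) * v') ^ 2 := by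
    field_simp
  have hh' : ((r : ℝ) / d) ^ 2 + 1 = (r ^ 2 + d ^ 2) / d ^ 2 := by field_simp
  rw [hcastR] at h
  push_cast at h
  convert h using 1
  rw [stereo, hk', hh']
  congr 1 <;> field_simp

lemma continuous_stereo_fst (A B t : ℝ) : Continuous fun s ↦ stereo A B s t := by
  unfold stereo
  have h (s : ℝ) : s ^ 2 + 1 ≠ 0 := by positivity
  exact continuous_ofCoords (by fun_prop) (by fun_prop (disch := exact h _))
    (by fun_prop (disch := exact h _)) (by fun_prop (disch := exact h _))

lemma continuous_stereo_snd (A B s : ℝ) : Continuous fun t ↦ stereo A B s t := by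
  unfold stereo
  have h (s : ℝ) : s ^ 2 + 1 ≠ 0 := by positivity
  exact continuous_ofCoords (by fun_prop) (by fun_prop (disch := exact h _))
    (by fun_prop (disch := exact h _)) (by fun_prop (disch := exact h _))

lemma tendsto_one_add_mul_floor_div {H : ℝ} (hH : 1 < H) (s : ℝ) :
    Tendsto (fun N : ℕ ↦ (1 + H * ⌊s * H ^ N⌋) / H ^ (N + 1)) atTop (𝓝 s) := by
  have hH0 : 0 < H := one_pos.trans hH
  have h1 : Tendsto (fun N : ℕ ↦ (H⁻¹) ^ N) atTop (𝓝 0) :=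
    tendsto_pow_atTop_nhds_zero_of_lt_one (by positivity) (inv_lt_one_of_one_lt₀ hH)
  refine tendsto_iff_dist_tendsto_zero.mpr (squeeze_zero (fun _ ↦ dist_nonneg) (fun N ↦ ?_) h1)
  have h2 : (1 + H * ⌊s * H ^ N⌋) / H ^ (N + 1) - s =
      (H⁻¹ - (s * H ^ N - ⌊s * H ^ N⌋)) * (H⁻¹) ^ N := by
    rw [inv_pow]
    field_simp
    ring
  rw [Real.dist_eq, h2, abs_mul, abs_of_nonneg (a := H⁻¹ ^ N) (by positivity)]
  refine mul_le_of_le_one_left (by positivity) (abs_le.mpr ⟨?_, ?_⟩)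
  · linarith [Int.lt_floor_add_one (s * H ^ N), inv_pos.mpr hH0]
  · linarith [Int.floor_le (s * H ^ N), inv_lt_one_of_one_lt₀ hH]

lemma stereo_mem_closure (A B s t : ℝ) : stereo A B s t ∈ closure quotients := by
  refine (Rat.isDenseEmbedding_coe_real.dense).induction_on t
    (isClosed_closure.preimage (continuous_stereo_snd A B s)) fun q ↦ ?_
  let r := q.num
  let d : ℤ := q.den
  have hd : d ≠ 0 := Int.natCast_ne_zero.mpr q.den_ne_zero
  have hq : (q : ℝ) = r / d := by
    rw [Rat.cast_def]
    simp [r, d]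
  rw [hq]
  have hh : 0 < r ^ 2 + d ^ 2 := by positivity
  have hH : (1 : ℝ) < ((2 * (r ^ 2 + d ^ 2) : ℤ) : ℝ) := by
    have : 1 < 2 * (r ^ 2 + d ^ 2) := by omega
    exact_mod_cast this
  refine isClosed_closure.mem_of_tendsto (((continuous_stereo_fst A B (r / d)).tendsto s).comp
    (tendsto_one_add_mul_floor_div hH s)) (Eventually.of_forall fun N ↦ ?_)
  set H : ℤ := 2 * (r ^ 2 + d ^ 2) with hHdef
  set m := ⌊s * (H : ℝ) ^ N⌋
  have hcop : IsCoprime (1 + H * m) (H ^ (N + 1)) := IsCoprime.pow_right ⟨1, -m, by ring⟩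
  have hv : (r ^ 2 + d ^ 2) * (2 * H ^ N) = H ^ (N + 1) := by rw [pow_succ, hHdef]; ring
  have h := stereo_mem_closure_of_dvd (u := 1 + H * m) (v' := 2 * H ^ N) (r := r) (d := d)
    (odd_one.add_even (Even.mul_right (even_two_mul _) m)) hd
    (by positivity) (even_two_mul _) (hv ▸ hcop) A B
  have hvR : ((r : ℝ) ^ 2 + d ^ 2) * ((2 * H ^ N : ℤ) : ℝ) = (H : ℝ) ^ (N + 1) := by
    exact_mod_cast hv
  rw [hvR] at h
  simpa using h

lemma exists_stereo_eq (A b c : ℝ) {e : ℝ} (he : e ≠ 0) :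
    ∃ B s t, stereo A B s t = ofCoords A b c e := by
  have he2 : 0 < e ^ 2 := by positivity
  obtain ⟨R, hR, hR2⟩ : ∃ R : ℝ, 0 < R ∧ R ^ 2 = c ^ 2 + e ^ 2 :=
    ⟨√(c ^ 2 + e ^ 2), by positivity, Real.sq_sqrt (by positivity)⟩
  obtain ⟨N, hN, hN2⟩ : ∃ N : ℝ, 0 < N ∧ N ^ 2 = b ^ 2 + R ^ 2 :=
    ⟨√(b ^ 2 + R ^ 2), by positivity, Real.sq_sqrt (by positivity)⟩
  have hRc : 0 < R + c := by linarith [(abs_lt_of_sq_lt_sq' (by linarith : c ^ 2 < R ^ 2) hR.le).1]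
  have hNb : 0 < N + b := by
    linarith [(abs_lt_of_sq_lt_sq' (by nlinarith : b ^ 2 < N ^ 2) hN.le).1]
  refine ⟨N, (N + b) / R, (R + c) / e, ?_⟩
  have hs : ((N + b) / R) ^ 2 + 1 = 2 * N * (N + b) / R ^ 2 := by
    field_simp
    linear_combination -hN2
  have hs' : ((N + b) / R) ^ 2 - 1 = 2 * b * (N + b) / R ^ 2 := by
    field_simp
    linear_combination hN2
  have ht : ((R + c) / e) ^ 2 + 1 = 2 * R * (R + c) / e ^ 2 := by
    field_simp
    linear_combination -hR2
  have ht' : ((R + c) / e) ^ 2 - 1 = 2 * c * (R + c) / e ^ 2 := by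
    field_simp
    linear_combination hR2
  rw [stereo, hs, hs', ht, ht']
  congr 1 <;> field_simp

theorem dense_quotients : Dense quotients := by
  rintro ⟨a, b, c, e⟩
  have hdense : Dense ({0}ᶜ : Set ℝ) := dense_compl_singleton 0
  have hclosed : IsClosed ((fun e ↦ ofCoords a b c e) ⁻¹' closure quotients) :=
    isClosed_closure.preimage (continuous_ofCoords continuous_const continuous_const
      continuous_const continuous_id)
  refine hclosed.closure_subset_iff.mpr (fun e he ↦ ?_) (hdense e)
  obtain ⟨B, s, t, h⟩ := exists_stereo_eq a b c he
  rw [Set.mem_preimage, ← h]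
  exact stereo_mem_closure a B s t

end HurwitzPrime

theorem hurwitz_prime_quotients_integer_coords_dense :
    Dense {x : Quaternion ℝ | ∃ p q : Quaternion ℝ,
      IsHurwitzPrime p ∧ IsHurwitzPrime q ∧
      (∃ x₁ x₂ x₃ x₄ : ℤ, p = ⟨(x₁ : ℝ), x₂, x₃, x₄⟩) ∧
      (∃ x₁ x₂ x₃ x₄ : ℤ, q = ⟨(x₁ : ℝ), x₂, x₃, x₄⟩) ∧
      x = p * q⁻¹} := by
  exact HurwitzPrime.dense_quotients
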